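/- There exist natural numbers m, n and positive real numbers x_1, …, x_m, y_1, …, y_n such that P_Λ(t) · ∏_{j=1}^n (1 − y_j t) = ∏_{i=1}^m (1 + x_i t) as formal power series over ℝ; moreover, writing ∏_{i=1}^m (1 + x_i t) = ∑_{i=0}^m a_i t^i and ∏_{j=1}^n (1 − y_j t) = ∑_{j=0}^n (−1)^j b_j t^j, the numerator is reciprocal, i.e. a_i = a_{m−i} for all 0 ≤ i ≤ m, and the denominator is skew-reciprocal, i.e. b_j = b_{n−j} for all 0 ≤ j ≤ n. -/

import Mathlib

open TensorProduct Polynomial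

noncomputable section

/-- The linear map `V ⊗ V → T(V)` sending `v ⊗ w` to `ι v * ι w`. -/
def mulTwo (K : Type) [Field K] (V : Type) [AddCommGroup V] [Module K V] :
    V ⊗[K] V →ₗ[K] TensorAlgebra K V :=
  TensorProduct.lift
    ((LinearMap.mul K (TensorAlgebra K V)).compl₁₂ (TensorAlgebra.ι K) (TensorAlgebra.ι K))

/-- `R : V ⊗ V → V ⊗ V` is a Hecke symmetry with parameter `q`:
it is invertible, satisfies the braid relation, the Hecke relation
`(R + 1)(R - q) = 0`, and its half adjoint `R♯ : V* ⊗ V → V ⊗ V*`,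
characterized by `⟨R♯(ξ ⊗ v), w⟩ = ⟨ξ, R(v ⊗ w)⟩`, is invertible. -/
def IsHeckeSymmetry (K : Type) [Field K] (V : Type) [AddCommGroup V] [Module K V]
    (q : K) (R : V ⊗[K] V →ₗ[K] V ⊗[K] V) : Prop :=
  Function.Bijective R ∧
  (TensorProduct.map R LinearMap.id ∘ₗ
      ((TensorProduct.assoc K V V V).symm.toLinearMap ∘ₗ
        TensorProduct.map LinearMap.id R ∘ₗ (TensorProduct.assoc K V V V).toLinearMap) ∘ₗ
      TensorProduct.map R LinearMap.id =
    ((TensorProduct.assoc K V V V).symm.toLinearMap ∘ₗ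
        TensorProduct.map LinearMap.id R ∘ₗ (TensorProduct.assoc K V V V).toLinearMap) ∘ₗ
      TensorProduct.map R LinearMap.id ∘ₗ
      ((TensorProduct.assoc K V V V).symm.toLinearMap ∘ₗ
        TensorProduct.map LinearMap.id R ∘ₗ (TensorProduct.assoc K V V V).toLinearMap)) ∧
  ((R + LinearMap.id) ∘ₗ (R - q • LinearMap.id) = 0) ∧
  (∃ Rs : Module.Dual K V ⊗[K] V →ₗ[K] V ⊗[K] Module.Dual K V,
    Function.Bijective Rs ∧
    ∀ (ξ : Module.Dual K V) (v w : V),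
      dualTensorHom K V V ((TensorProduct.comm K V (Module.Dual K V)) (Rs (ξ ⊗ₜ[K] v))) w =
        TensorProduct.lid K V (TensorProduct.map ξ LinearMap.id (R (v ⊗ₜ[K] w))))

/-- The relation on `T(V)` whose closure cuts out the exterior algebra `Λ` of `R`:
all elements of the image of `R + 1` in degree two are set to zero. -/
def lambdaRel (K : Type) [Field K] (V : Type) [AddCommGroup V] [Module K V]
    (R : V ⊗[K] V →ₗ[K] V ⊗[K] V) :
    TensorAlgebra K V → TensorAlgebra K V → Prop :=
  fun a b => b = 0 ∧ ∃ u : V ⊗[K] V, a = mulTwo K V ((R + (LinearMap.id : V ⊗[K] V →ₗ[K] V ⊗[K] V)) u)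

/-- The `l`-th homogeneous component of the exterior algebra `Λ = T(V)/(im(R+1))`,
as the image of the `l`-th graded piece of the tensor algebra. -/
def lambdaGrade (K : Type) [Field K] (V : Type) [AddCommGroup V] [Module K V]
    (R : V ⊗[K] V →ₗ[K] V ⊗[K] V) (l : ℕ) :
    Submodule K (RingQuot (lambdaRel K V R)) :=
  Submodule.map (RingQuot.mkAlgHom K (lambdaRel K V R)).toLinearMap
    (LinearMap.range (TensorAlgebra.ι K : V →ₗ[K] TensorAlgebra K V) ^ l)

/-- The Poincaré series `P_Λ(t) = ∑ (dim Λ_l) t^l` of the exterior algebra,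
as a formal power series over `ℝ`. -/
def poincareLambda (K : Type) [Field K] (V : Type) [AddCommGroup V] [Module K V]
    (R : V ⊗[K] V →ₗ[K] V ⊗[K] V) : PowerSeries ℝ :=
  PowerSeries.mk fun l => (Module.finrank K (lambdaGrade K V R l) : ℝ)

section
set_option linter.unusedSectionVars false
set_option linter.unusedSimpArgs false
set_option linter.unusedVariables false
open Finset (sum_congr mul_sum sum_comm sum_mul sum_smul smul_sum sum_eq_zero mem_image mem_filter mem_range sum_eq_single)
variable {K : Type} {B : Type} [Field K] [Ring B] [Algebra K B] {q : K} {T : ℕ → B}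
variable {ι : Type} [Fintype ι] [DecidableEq ι]
section
def AddR (w : List ℕ) : Finset ℕ :=
  (Finset.range (w.length + 1)).filter fun r => r = 0 ∨ w.count r < w.count (r - 1)
def Std : List ℕ → Prop
  | [] => True
  | r :: w => r ∈ AddR w ∧ Std w
def ct (w : List ℕ) (r : ℕ) : ℤ := (w.count r : ℤ) - r
lemma AddR_perm {w w' : List ℕ} (h : w.Perm w') : AddR w = AddR w' := by
  unfold AddR; rw [h.length_eq]; ext r; simp [h.count_eq]
lemma ct_perm {w w' : List ℕ} (h : w.Perm w') (r : ℕ) : ct w r = ct w' r := by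
  unfold ct; rw [h.count_eq]
lemma Std.lt {w : List ℕ} (h : Std w) : ∀ x ∈ w, x < w.length := by
  induction w with
  | nil => simp
  | cons r w ih =>
    intro x hx
    rcases List.mem_cons.1 hx with rfl | hx
    · have := h.1; simp [AddR] at this; simpa using this.1
    · have := ih h.2 x hx; simp; omega
lemma Std.mem_iff {w : List ℕ} (h : Std w) (r : ℕ) :
    r ∈ AddR w ↔ (r = 0 ∨ w.count r < w.count (r - 1)) := by
  constructor
  · intro hr; exact (mem_filter.1 hr).2
  · intro hr
    refine mem_filter.2 ⟨?_, hr⟩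
    rcases hr with rfl | hr
    · simp
    · have h1 : r - 1 ∈ w := List.count_pos_iff.1 (by omega)
      have := h.lt _ h1
      simp; omega
lemma cnt_cons (r x : ℕ) (w : List ℕ) : (r :: w).count x = w.count x + if r = x then 1 else 0 := by
  rw [List.count_cons]; simp
lemma Std.anti {w : List ℕ} (h : Std w) : Antitone fun r => w.count r := by
  induction w with
  | nil => intro a b _; simp
  | cons r w ih =>
    have h1 := ih h.2
    apply antitone_nat_of_succ_le
    intro n
    have h2 : w.count (n+1) ≤ w.count n := h1 (Nat.le_succ n)
    have h3 := (h.2.mem_iff r).1 h.1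
    simp only [cnt_cons]
    split_ifs with h4 h5 h5 <;> try omega
    subst h4
    simp at h3; omega
lemma Std.le {w : List ℕ} (h : Std w) {a b : ℕ} (hab : a ≤ b) : w.count b ≤ w.count a := h.anti hab
lemma Std.ct_sep {w : List ℕ} (h : Std w) {r r' : ℕ} (hr' : r' ∈ AddR w)
    (hlt : r < r') : ct w r' + 2 ≤ ct w r := by
  have h2 := (h.mem_iff r').1 hr'
  have := h.le (show r ≤ r' - 1 by omega)
  unfold ct
  omega
lemma Std.corner {w : List ℕ} (h : Std w) {i : ℕ} (hi : w.count (i+1) < w.count i) :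
    ∃ w', Std (i :: w') ∧ w.Perm (i :: w') := by
  induction w with
  | nil => simp at hi
  | cons r w ih =>
    by_cases hri : r = i
    · subst hri; exact ⟨w, h, List.Perm.refl _⟩
    · have hi' : w.count (i+1) < w.count i := by
        simp only [cnt_cons, hri, if_false] at hi
        omega
      obtain ⟨w2, hs, hp⟩ := ih h.2 hi'
      have hc : ∀ x, w.count x = w2.count x + if i = x then 1 else 0 := fun x => by
        rw [hp.count_eq, cnt_cons]
      have hr := (h.2.mem_iff r).1 h.1
      have hst : Std (r :: w2) := by
        refine ⟨(hs.2.mem_iff r).2 ?_, hs.2⟩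
        rcases hr with hr | hr
        · exact Or.inl hr
        · right
          by_cases h1 : i = r - 1
          · have : r = i + 1 ∨ r = 0 := by omega
            rcases this with rfl | rfl
            · simp only [cnt_cons, hc] at hi hr ⊢
              simp at hi hr ⊢; omega
            · simp at hr
          · rw [hc, hc] at hr
            simp only [h1, if_false] at hr
            omega
      refine ⟨r :: w2, ⟨(hst.mem_iff i).2 ?_, hst⟩, ?_⟩
      · rcases Nat.eq_zero_or_pos i with rfl | hi0
        · exact Or.inl rfl
        · right
          have h3 := h.le (show i - 1 ≤ i by omega)
          simp only [cnt_cons, hc, hri] at h3 ⊢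
          simp at h3 ⊢
          have : ¬ i = i - 1 := by omega
          simp [this] at h3
          omega
      · exact (hp.cons r).trans (List.Perm.swap _ _ _)
lemma Std.rem {w : List ℕ} {r : ℕ} (h : Std (r :: w)) :
    (r :: w).count (r+1) < (r :: w).count r := by
  have := h.2.le (show r ≤ r+1 by omega)
  simp only [cnt_cons]; simp; omega
lemma Std.cons_of_rem {w : List ℕ} (h : Std w) {r : ℕ}
    (h2 : r = 0 ∨ w.count r < w.count (r-1)) : Std (r :: w) := ⟨(h.mem_iff r).2 h2, h⟩
lemma Std.two {r r' : ℕ} {w w' : List ℕ} (h : Std (r :: w)) (h' : Std (r' :: w'))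
    (hp : (r :: w).Perm (r' :: w')) (hne : r ≠ r') :
    ∃ v, Std (r' :: v) ∧ Std (r :: v) ∧ w.Perm (r' :: v) ∧ w'.Perm (r :: v) := by
  have h1 := h.rem
  have h2 := h'.rem
  have hc := fun x => hp.count_eq x
  obtain ⟨v, hv, hpv⟩ := h.2.corner (i := r') (by
    rw [← hc, ← hc] at h2
    simp only [cnt_cons, hne, if_false] at h2
    omega)
  have hpv' : w'.Perm (r :: v) := by
    have := hp.symm.trans (hpv.cons r)
    exact (List.perm_cons r').1 (this.trans (List.Perm.swap _ _ _))
  refine ⟨v, hv, hv.2.cons_of_rem ?_, hpv, hpv'⟩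
  rcases Nat.eq_zero_or_pos r with h0 | h0
  · exact Or.inl h0
  right
  have hx := (h.2.mem_iff r).1 h.1
  rw [hpv.count_eq, hpv.count_eq] at hx
  rw [← hc, ← hc] at h2
  simp only [cnt_cons, hpv.count_eq, hne, if_false] at h2 hx
  by_cases h4 : r' = r - 1
  · have : r = r' + 1 := by omega
    subst this
    simp at h2 hx ⊢; omega
  · simp only [h4, if_false, hne.symm] at hx
    omega
lemma Std.add_cons {w : List ℕ} {r : ℕ} (h : Std (r :: w)) (x : ℕ) (hx : x ≠ r) (hx' : x ≠ r + 1) :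
    x ∈ AddR (r :: w) ↔ x ∈ AddR w := by
  rw [h.mem_iff, h.2.mem_iff]
  simp only [cnt_cons, hx.symm, if_false]
  have : x = 0 ∨ ¬ r = x - 1 := by omega
  rcases this with rfl | this
  · simp
  · simp [this]
lemma ct_cons_ne {w : List ℕ} {r x : ℕ} (hx : x ≠ r) : ct (r :: w) x = ct w x := by
  simp [ct, cnt_cons, hx.symm]
lemma ct_cons_self {w : List ℕ} {r : ℕ} : ct (r :: w) r = ct w r + 1 := by
  simp [ct, cnt_cons]; ring
structure HK (q : K) (T : ℕ → B) : Prop where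
  q0 : q ≠ 0
  qn : ∀ n : ℕ, 1 ≤ n → q ^ n ≠ 1
  quad : ∀ i, T i * T i = (q - 1) • T i + q • 1
  braid : ∀ i, T i * T (i+1) * T i = T (i+1) * T i * T (i+1)
  far : ∀ i j, i + 2 ≤ j → Commute (T i) (T j)
def JM (q : K) (T : ℕ → B) : ℕ → B
  | 0 => 1
  | n+1 => q⁻¹ • (T n * JM q T n * T n)
def HA (K : Type) [Field K] [Algebra K B] (T : ℕ → B) (n : ℕ) : Subalgebra K B :=
  Algebra.adjoin K {x | ∃ i, i + 2 ≤ n ∧ x = T i}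
lemma HA_T {n i : ℕ} (h : i + 2 ≤ n) : T i ∈ HA K T n := Algebra.subset_adjoin ⟨i, h, rfl⟩
lemma HA_mono {m n : ℕ} (h : m ≤ n) : HA K T m ≤ HA K T n :=
  Algebra.adjoin_mono fun _ ⟨i, hi, e⟩ => ⟨i, by omega, e⟩
lemma HA_comm {n : ℕ} {y x : B} (h : ∀ i, i + 2 ≤ n → Commute y (T i)) (hx : x ∈ HA K T n) :
    Commute y x := by
  induction hx using Algebra.adjoin_induction with
  | mem x hx => obtain ⟨i, hi, rfl⟩ := hx; exact h i hi
  | algebraMap r => exact (Algebra.commutes r y).symm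
  | add a b _ _ ha hb => exact ha.add_right hb
  | mul a b _ _ ha hb => exact ha.mul_right hb
lemma HA_induction {n : ℕ} {P : (x : B) → Prop} (hT : ∀ i, i + 2 ≤ n → P (T i))
    (ha : ∀ r : K, P (algebraMap K B r)) (hadd : ∀ x y, P x → P y → P (x + y))
    (hmul : ∀ x y, x ∈ HA K T n → y ∈ HA K T n → P x → P y → P (x * y)) {x : B} (hx : x ∈ HA K T n) : P x := by
  induction hx using Algebra.adjoin_induction with
  | mem x hx => obtain ⟨i, hi, rfl⟩ := hx; exact hT i hi
  | algebraMap r => exact ha r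
  | add a b _ _ h1 h2 => exact hadd a b h1 h2
  | mul a b h1 h2 h3 h4 => exact hmul a b h1 h2 h3 h4
attribute [irreducible] HA
namespace HK
variable (h : HK q T)
include h
lemma q1 : q - 1 ≠ 0 := by
  have := h.qn 1 le_rfl; simp at this; exact sub_ne_zero.2 this
lemma qq1 : 1 + q ≠ 0 := fun e => h.qn 2 (by norm_num) (by linear_combination (q - 1) * e)
lemma zinj {a b : ℤ} (e : q ^ a = q ^ b) : a = b := by
  by_contra hne
  have key : ∀ m : ℤ, 0 < m → q ^ m ≠ 1 := by
    intro m hm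
    obtain ⟨k, rfl⟩ := Int.eq_ofNat_of_zero_le hm.le
    rw [zpow_natCast]; exact h.qn k (by omega)
  rcases lt_or_gt_of_ne hne with h1 | h1
  · apply key (b - a) (by omega); rw [zpow_sub₀ h.q0, ← e]; exact div_self (zpow_ne_zero _ h.q0)
  · apply key (a - b) (by omega); rw [zpow_sub₀ h.q0, e]; exact div_self (zpow_ne_zero _ h.q0)
lemma T_comm {n m : ℕ} (hn : n ≤ m) {x : B} (hx : x ∈ HA K T n) : Commute (T m) x :=
  HA_comm (fun i hi => (h.far i m (by omega)).symm) hx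
lemma J_mem (n : ℕ) : JM q T n ∈ HA K T (n+1) := by
  induction n with
  | zero => exact one_mem _
  | succ n ih =>
    have h1 : T n ∈ HA K T (n+1+1) := HA_T (by omega)
    exact Subalgebra.smul_mem _ (mul_mem (mul_mem h1 (HA_mono (by omega) ih)) h1) _
lemma J_T {n i : ℕ} (hi : i + 2 ≤ n) : Commute (JM q T n) (T i) := by
  induction n with
  | zero => omega
  | succ n ih =>
    rcases Nat.lt_or_ge i (n-1) with h1 | h1
    · have c1 := h.far i n (by omega)
      have c2 := ih (by omega)
      exact (((c1.symm.mul_left c2).mul_left c1.symm).smul_left _)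
    · obtain ⟨m, rfl⟩ : ∃ m, n = m + 1 := ⟨n-1, by omega⟩
      have : i = m := by omega
      subst this
      simp only [JM]
      have cJ : T (i+1) * JM q T i = JM q T i * T (i+1) := h.T_comm (le_refl _) (h.J_mem i)
      have b := h.braid i
      refine Commute.smul_left ?_ _
      simp only [mul_smul_comm, smul_mul_assoc]
      refine Commute.smul_left ?_ _
      show _ * _ = _ * _
      set a := T i; set b' := T (i+1); set j := JM q T i
      calc b' * (a * j * a) * b' * a = b' * a * j * (a * b' * a) := by noncomm_ring
        _ = b' * a * (j * b') * (a * b') := by rw [b]; noncomm_ring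
        _ = (b' * a * b') * j * (a * b') := by rw [← cJ]; noncomm_ring
        _ = a * (b' * (a * j * a) * b') := by rw [← b]; noncomm_ring
lemma J_comm {n m : ℕ} (hn : n ≤ m) {x : B} (hx : x ∈ HA K T n) : Commute (JM q T m) x :=
  HA_comm (fun i hi => h.J_T (by omega)) hx
lemma J_J (n m : ℕ) : Commute (JM q T n) (JM q T m) := by
  rcases lt_trichotomy n m with h1 | rfl | h1
  · exact (h.J_comm (by omega) (h.J_mem n)).symm
  · exact Commute.refl _
  · exact h.J_comm (by omega) (h.J_mem m)
lemma TJ (n : ℕ) : T n * JM q T (n+1) = JM q T n * T n + (q-1) • JM q T (n+1) := by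
  simp only [JM]
  have : T n * (q⁻¹ • (T n * JM q T n * T n)) = q⁻¹ • ((T n * T n) * JM q T n * T n) := by
    rw [mul_smul_comm]; congr 1; noncomm_ring
  rw [this, h.quad, add_mul, add_mul]
  simp only [smul_mul_assoc, one_mul, smul_add, smul_smul, inv_mul_cancel₀ h.q0, one_smul]
  rw [add_comm, mul_comm]
lemma JT (n : ℕ) : JM q T (n+1) * T n = T n * JM q T n + (q-1) • JM q T (n+1) := by
  simp only [JM]
  have : (q⁻¹ • (T n * JM q T n * T n)) * T n = q⁻¹ • (T n * JM q T n * (T n * T n)) := by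
    rw [smul_mul_assoc]; congr 1; noncomm_ring
  rw [this, h.quad, mul_add]
  simp only [mul_smul_comm, mul_one, smul_add, smul_smul, inv_mul_cancel₀ h.q0, one_smul]
  rw [add_comm, mul_comm]
end HK
def zz (q : K) (w : List ℕ) (r : ℕ) : K := q ^ (ct w r)
def ee (q : K) (w : List ℕ) (r : ℕ) : K[X] := Lagrange.basis (AddR w) (zz q w) r
def pp (q : K) (T : ℕ → B) : List ℕ → B
  | [] => 1
  | r :: w => pp q T w * aeval (JM q T w.length) (ee q w r)
local notation "ϖ" => pp q T
def KL (q : K) (T : ℕ → B) (w : List ℕ) : Prop :=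
  pp q T w * aeval (JM q T w.length) (Lagrange.nodal (AddR w) (zz q w)) = 0
def Good (q : K) (T : ℕ → B) : List ℕ → Prop
  | [] => KL q T []
  | r :: w => KL q T (r :: w) ∧ Good q T w
lemma Good.kl {w : List ℕ} (g : Good q T w) : KL q T w := by cases w; exacts [g, g.1]
lemma ee_perm {w w' : List ℕ} (hp : w.Perm w') (r : ℕ) : ee q w r = ee q w' r := by
  unfold ee zz; rw [AddR_perm hp]; congr 1; ext a; rw [ct_perm hp]
lemma aeval_eig {J x : B} {a : K} (hx : J * x = a • x) (f : K[X]) : aeval J f * x = f.eval a • x := by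
  induction f using Polynomial.induction_on' with
  | add f g hf hg => simp [add_mul, hf, hg, add_smul]
  | monomial n c =>
    have : J ^ n * x = a ^ n • x := by
      induction n with
      | zero => simp
      | succ n ih => rw [pow_succ, mul_assoc, hx, mul_smul_comm, ih, smul_smul, pow_succ, mul_comm]
    simp [aeval_monomial, mul_assoc, this, Algebra.algebraMap_eq_smul_one, smul_smul]
namespace HK
variable (h : HK q T)
include h
lemma aeval_comm {n m : ℕ} (hn : n ≤ m) {x : B} (hx : x ∈ HA K T n) (f : K[X]) :
    Commute (aeval (JM q T m) f) x := by
  induction f using Polynomial.induction_on' with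
  | add f g hf hg => rw [map_add]; exact hf.add_left hg
  | monomial k c =>
    rw [aeval_monomial]
    exact Commute.mul_left (Algebra.commutes c x) ((h.J_comm hn hx).pow_left k)
lemma aeval_mem {n m : ℕ} (hn : n < m) (f : K[X]) : aeval (JM q T n) f ∈ HA K T m := by
  rw [aeval_eq_sum_range]
  exact sum_mem fun i _ => Subalgebra.smul_mem _ (pow_mem (HA_mono hn (h.J_mem n)) i) _
lemma pp_mem (w : List ℕ) : ϖ w ∈ HA K T w.length := by
  induction w with
  | nil => exact one_mem _
  | cons r w ih => exact mul_mem (HA_mono (by simp) ih) (h.aeval_mem (by simp) _)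
lemma zz_inj {w : List ℕ} (hw : Std w) : Set.InjOn (zz q w) (AddR w) := by
  intro a ha b hb e
  have := h.zinj e
  rcases lt_trichotomy a b with h1 | h1 | h1
  · have := hw.ct_sep hb h1; omega
  · exact h1
  · have := hw.ct_sep ha h1; omega
lemma kl_zero {w : List ℕ} (hw : Std w) (g : KL q T w) {f : K[X]}
    (hf : ∀ a ∈ AddR w, f.eval (zz q w a) = 0) : ϖ w * aeval (JM q T w.length) f = 0 := by
  have : Lagrange.nodal (AddR w) (zz q w) ∣ f := by
    rw [Lagrange.nodal]
    apply Finset.prod_dvd_of_coprime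
    · intro a ha b hb hab
      exact pairwise_coprime_X_sub_C (s := fun i : AddR w => zz q w i)
        (fun x y e => Subtype.ext (h.zz_inj hw x.2 y.2 e)) (i := ⟨a, ha⟩) (j := ⟨b, hb⟩)
          (by simpa using hab)
    · intro a ha; exact dvd_iff_isRoot.2 (hf a ha)
  obtain ⟨k, rfl⟩ := this
  rw [map_mul, ← mul_assoc, g, zero_mul]
lemma pp_sum {w : List ℕ} (hw : Std w) : ∑ r ∈ AddR w, ϖ (r :: w) = ϖ w := by
  simp only [pp]
  rw [← mul_sum, ← map_sum]
  unfold ee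
  rw [Lagrange.sum_basis (h.zz_inj hw) ⟨0, (hw.mem_iff 0).2 (Or.inl rfl)⟩]; simp
lemma pp_eig {w : List ℕ} {r : ℕ} (hw : Std (r :: w)) (g : KL q T w) :
    JM q T w.length * ϖ (r :: w) = zz q w r • ϖ (r :: w) := by
  have h1 := h.kl_zero hw.2 g (f := (X - C (zz q w r)) * ee q w r) (by
    intro a ha
    by_cases e : a = r
    · subst e; simp
    · rw [eval_mul, ee, Lagrange.eval_basis_of_ne (Ne.symm e) ha, mul_zero])
  simp only [pp]
  rw [← mul_assoc, h.J_comm le_rfl (h.pp_mem w), mul_assoc]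
  rw [← sub_eq_zero, ← h1]
  simp [sub_mul, mul_sub, Algebra.algebraMap_eq_smul_one]
lemma pp_of_eig {w : List ℕ} {r : ℕ} (hw : Std (r :: w)) {x : B} (h1 : ϖ w * x = x)
    (h2 : JM q T w.length * x = zz q w r • x) : ϖ (r :: w) * x = x := by
  simp only [pp]
  rw [mul_assoc, aeval_eig h2, ee, Lagrange.eval_basis_self (h.zz_inj hw.2) hw.1, one_smul, h1]
lemma eig_zero {w : List ℕ} (g : KL q T w) {x : B} {a : K} (h1 : ϖ w * x = x)
    (h2 : JM q T w.length * x = a • x) (h3 : ∀ r ∈ AddR w, a ≠ zz q w r) : x = 0 := by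
  have : aeval (JM q T w.length) (Lagrange.nodal (AddR w) (zz q w)) * (ϖ w * x) = 0 := by
    rw [← mul_assoc, (h.aeval_comm le_rfl (h.pp_mem w) _).eq, g, zero_mul]
  rw [h1, aeval_eig h2] at this
  refine (smul_eq_zero.1 this).resolve_left ?_
  rw [Lagrange.eval_nodal]
  refine Finset.prod_ne_zero_iff.2 ?_
  intro r hr; exact sub_ne_zero.2 (h3 r hr)
lemma pp_idem {w : List ℕ} (hw : Std w) (g : Good q T w) : ϖ w * ϖ w = ϖ w := by
  induction w with
  | nil => simp [pp]
  | cons r w ih =>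
    refine h.pp_of_eig hw ?_ (h.pp_eig hw g.2.kl)
    simp only [pp]; rw [← mul_assoc, ih hw.2 g.2]
lemma pp_sub {w : List ℕ} (hw : Std w) (g : Good q T w) (r : ℕ) :
    ϖ w * ϖ (r :: w) = ϖ (r :: w) := by
  simp only [pp]; rw [← mul_assoc, h.pp_idem hw g]
lemma pp_sub' {w : List ℕ} (hw : Std w) (g : Good q T w) (r : ℕ) :
    ϖ (r :: w) * ϖ w = ϖ (r :: w) := by
  simp only [pp]; rw [mul_assoc, (h.aeval_comm le_rfl (h.pp_mem w) _).eq, ← mul_assoc, h.pp_idem hw g]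
lemma itw {n : ℕ} {x : B} {a b : K} (hab : a ≠ b) (h1 : JM q T n * x = a • x)
    (h2 : JM q T (n+1) * x = b • x) :
    JM q T n * (T n * x - ((q-1)*b/(b-a)) • x) = b • (T n * x - ((q-1)*b/(b-a)) • x) ∧
    JM q T (n+1) * (T n * x - ((q-1)*b/(b-a)) • x) = a • (T n * x - ((q-1)*b/(b-a)) • x) := by
  have e : b - a ≠ 0 := sub_ne_zero.2 hab.symm
  have t1 : JM q T n * (T n * x) = b • (T n * x) - ((q-1)*b) • x := by
    rw [← mul_assoc, eq_sub_of_add_eq (h.TJ n).symm, sub_mul, mul_assoc, h2, smul_mul_assoc, h2,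
      mul_smul_comm, smul_smul]
  have t2 : JM q T (n+1) * (T n * x) = a • (T n * x) + ((q-1)*b) • x := by
    rw [← mul_assoc, h.JT n, add_mul, mul_assoc, h1, smul_mul_assoc, h2, mul_smul_comm, smul_smul]
  constructor
  · rw [mul_sub, mul_smul_comm, h1, t1]
    match_scalars
    · ring
    · field_simp; ring
  · rw [mul_sub, mul_smul_comm, h2, t2]
    match_scalars
    · ring
    · field_simp; ring
lemma AL {v : List ℕ} (g : KL q T v) {x : B} {a b : K} (hab : a ≠ b) (h0 : ϖ v * x = x)
    (h1 : JM q T v.length * x = a • x) (h2 : JM q T (v.length+1) * x = b • x)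
    (h3 : ∀ r ∈ AddR v, b ≠ zz q v r) : T v.length * x = ((q-1)*b/(b-a)) • x := by
  rw [← sub_eq_zero]
  refine h.eig_zero g ?_ (h.itw hab h1 h2).1 h3
  rw [mul_sub, ← mul_assoc, ← (h.T_comm le_rfl (h.pp_mem v)).eq, mul_assoc, mul_smul_comm, h0]
end HK
def MvN (K : Type) [Field K] [Algebra K B] (T : ℕ → B) (n : ℕ) (a b : B) : Prop :=
  ∃ u u', u ∈ HA K T n ∧ u' ∈ HA K T n ∧ u * u' = a ∧ u' * u = b ∧ a * u = u ∧ u * b = u ∧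
    b * u' = u' ∧ u' * a = u'
lemma MvN.symm {n : ℕ} {a b : B} (h : MvN K T n a b) : MvN K T n b a := by
  obtain ⟨u, u', h1, h2, h3, h4, h5, h6, h7, h8⟩ := h
  exact ⟨u', u, h2, h1, h4, h3, h7, h8, h5, h6⟩
lemma MvN.trans {n : ℕ} {a b c : B} (h : MvN K T n a b) (g : MvN K T n b c) : MvN K T n a c := by
  obtain ⟨u, u', h1, h2, h3, h4, h5, h6, h7, h8⟩ := h
  obtain ⟨v, v', g1, g2, g3, g4, g5, g6, g7, g8⟩ := g
  refine ⟨u * v, v' * u', mul_mem h1 g1, mul_mem g2 h2, ?_, ?_, ?_, ?_, ?_, ?_⟩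
  · rw [mul_assoc, ← mul_assoc v, g3, ← mul_assoc, h6, h3]
  · rw [mul_assoc, ← mul_assoc u', h4, ← mul_assoc, g8, g4]
  · rw [← mul_assoc, h5]
  · rw [mul_assoc, g6]
  · rw [← mul_assoc, g7]
  · rw [mul_assoc, h8]
lemma MvN.mk' {n : ℕ} {a b x x' : B} (ha : a * a = a) (hb : b * b = b) (ma : a ∈ HA K T n)
    (mb : b ∈ HA K T n) (mx : x ∈ HA K T n) (mx' : x' ∈ HA K T n) (h1 : x * x' = a)
    (h2 : x' * x = b) : MvN K T n a b := by
  refine ⟨a * x * b, b * x' * a, mul_mem (mul_mem ma mx) mb, mul_mem (mul_mem mb mx') ma,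
    ?_, ?_, ?_, ?_, ?_, ?_⟩
  · calc a * x * b * (b * x' * a) = a * x * (b * b) * x' * a := by noncomm_ring
      _ = a * ((x * x') * (x * x')) * a := by rw [hb, ← h2]; noncomm_ring
      _ = a := by rw [h1, ha, ha, ha]
  · calc b * x' * a * (a * x * b) = b * x' * (a * a) * x * b := by noncomm_ring
      _ = b * ((x' * x) * (x' * x)) * b := by rw [ha, ← h1]; noncomm_ring
      _ = b := by rw [h2, hb, hb, hb]
  · rw [← mul_assoc, ← mul_assoc, ha]
  · rw [mul_assoc, hb]
  · rw [← mul_assoc, ← mul_assoc, hb]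
  · rw [mul_assoc, ha]
lemma Std.sw {r r' : ℕ} {v : List ℕ} (hr : Std (r :: v)) (hr' : Std (r' :: v)) (hne : r ≠ r') :
    Std (r' :: r :: v) := by
  refine ⟨(hr.mem_iff r').2 ?_, hr⟩
  have := (hr.2.mem_iff r').1 hr'.1
  simp only [cnt_cons, hne, if_false]
  rcases this with h | h
  · exact Or.inl h
  · right; split_ifs <;> omega
namespace HK
variable (h : HK q T)
include h
lemma mvn_refl {w : List ℕ} (hw : Std w) (g : Good q T w) :
    MvN K T w.length (ϖ w) (ϖ w) :=
  have e := h.pp_idem hw g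
  ⟨_, _, h.pp_mem w, h.pp_mem w, e, e, e, e, e, e⟩
lemma pp_e {w : List ℕ} {r : ℕ} (hw : Std (r :: w)) (g : KL q T w) :
    aeval (JM q T w.length) (ee q w r) * ϖ (r :: w) = ϖ (r :: w) := by
  rw [aeval_eig (h.pp_eig hw g), ee, Lagrange.eval_basis_self (h.zz_inj hw.2) hw.1, one_smul]
lemma pp_cons' (w : List ℕ) (r : ℕ) :
    ϖ (r :: w) = aeval (JM q T w.length) (ee q w r) * ϖ w := by
  simp only [pp]; rw [(h.aeval_comm le_rfl (h.pp_mem w) _).eq]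
lemma mvn_cons {w w' : List ℕ} {r : ℕ} (hw : Std (r :: w)) (g : Good q T w)
    (hw' : Std (r :: w')) (g' : Good q T w')
    (hp : w.Perm w') (m : MvN K T w.length (ϖ w) (ϖ w')) :
    MvN K T (w.length+1) (ϖ (r :: w)) (ϖ (r :: w')) := by
  have hl := hp.length_eq
  obtain ⟨u, u', h1, h2, h3, h4, h5, h6, h7, h8⟩ := m
  have e1 := h.pp_e hw g.kl
  have e2 := h.pp_e hw' g'.kl
  have d1 := h.pp_cons' w r
  have d2 := h.pp_cons' w' r
  rw [← hl, ← ee_perm hp] at d2 e2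
  set E := aeval (JM q T w.length) (ee q w r) with hE
  have c1 : E * u = u * E := (h.aeval_comm le_rfl h1 _).eq
  have c2 : E * u' = u' * E := (h.aeval_comm le_rfl h2 _).eq
  have hEm : E ∈ HA K T (w.length+1) := h.aeval_mem (by omega) _
  have l2 : ϖ (r :: w') ∈ HA K T (w.length+1) := by
    have := h.pp_mem (r :: w'); rwa [List.length_cons, ← hl] at this
  have l1 : ϖ (r :: w) ∈ HA K T (w.length+1) := h.pp_mem (r :: w)
  have i1 := h.pp_of_eig hw (h.pp_sub hw.2 g r) (h.pp_eig hw g.kl)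
  have i2 := h.pp_of_eig hw' (h.pp_sub hw'.2 g' r) (h.pp_eig hw' g'.kl)
  have x1 := mul_mem hEm (HA_mono (Nat.le_succ _) h1)
  have x2 := mul_mem hEm (HA_mono (Nat.le_succ _) h2)
  refine MvN.mk' i1 i2 l1 l2 x1 x2 ?_ ?_
  · rw [mul_assoc, ← mul_assoc u, ← c1, mul_assoc E u, h3, ← d1, e1]
  · rw [mul_assoc, ← mul_assoc u', ← c2, mul_assoc E u', h4, ← d2, e2]
lemma kap {a b : K} (hab : a ≠ b) (h1 : b ≠ q * a) (h2 : a ≠ q * b) :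
    q + (q-1)*b/(b-a) * ((q-1)*a/(a-b)) ≠ 0 := by
  have e : b - a ≠ 0 := sub_ne_zero.2 hab.symm
  have e' : a - b ≠ 0 := sub_ne_zero.2 hab
  have : q + (q-1)*b/(b-a) * ((q-1)*a/(a-b)) = (b - q*a)*(q*b-a)/(b-a)^2 := by
    have : a - b = -(b-a) := by ring
    rw [this]; field_simp; ring
  rw [this]
  refine div_ne_zero (mul_ne_zero (sub_ne_zero.2 h1) (sub_ne_zero.2 h2.symm)) (pow_ne_zero _ e)
lemma sw_itw {v : List ℕ} {r r' : ℕ} (hr : Std (r :: v)) (hr' : Std (r' :: v)) (hne : r ≠ r')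
    (g : Good q T (r :: v)) :
    let P := ϖ (r' :: r :: v)
    let k := (q-1)*zz q v r'/(zz q v r'-zz q v r)
    ϖ (r :: r' :: v) * (T v.length * P - k • P) = T v.length * P - k • P := by
  intro P k
  have hz : zz q v r ≠ zz q v r' := fun e => hne (h.zz_inj hr.2 hr.1 hr'.1 e)
  have i1 : JM q T v.length * P = zz q v r • P := by
    show _ * ϖ (r' :: r :: v) = _
    rw [pp, ← mul_assoc, h.pp_eig hr g.2.kl, smul_mul_assoc]; rfl
  have i2 : JM q T (v.length+1) * P = zz q v r' • P := by
    have := h.pp_eig (hr.sw hr' hne) g.kl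
    rw [zz, ct_cons_ne hne.symm] at this; exact this
  have i0 : ϖ v * P = P := by
    show _ * ϖ (r' :: r :: v) = _
    rw [pp, ← mul_assoc, h.pp_sub hr.2 g.2]; rfl
  obtain ⟨w1, w2⟩ := h.itw hz i1 i2
  have w0 : ϖ v * (T v.length * P - k • P) = T v.length * P - k • P := by
    rw [mul_sub, ← mul_assoc, ← (h.T_comm le_rfl (h.pp_mem v)).eq, mul_assoc, mul_smul_comm, i0]
  refine h.pp_of_eig (hr'.sw hr hne.symm) (h.pp_of_eig hr' w0 w1) ?_
  rw [zz, ct_cons_ne hne]; exact w2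
lemma pp_ne {w : List ℕ} {r r' : ℕ} (hw : Std (r :: w)) (hw' : Std (r' :: w)) (g : Good q T w)
    (hne : r ≠ r') : ϖ (r :: w) * ϖ (r' :: w) = 0 := by
  rw [pp, mul_assoc, aeval_eig (h.pp_eig hw' g.kl), ee, Lagrange.eval_basis_of_ne hne hw'.1,
    zero_smul, mul_zero]
lemma sw_ne {v : List ℕ} {r r' : ℕ} (hr : Std (r :: v)) (hr' : Std (r' :: v)) (hne : r ≠ r')
    (g : Good q T v) : ϖ (r' :: r :: v) * ϖ (r :: r' :: v) = 0 := by
  rw [h.pp_cons' (r :: v), h.pp_cons' (r' :: v)]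
  have c : Commute (aeval (JM q T (r' :: v).length) (ee q (r' :: v) r)) (ϖ (r :: v)) :=
    h.aeval_comm (n := v.length+1) le_rfl (h.pp_mem (r :: v)) _
  rw [mul_assoc, ← mul_assoc (ϖ (r :: v)), ← c.eq, mul_assoc, h.pp_ne hr hr' g hne]
  simp
lemma sw_TP {v : List ℕ} {r r' : ℕ} (hr : Std (r :: v)) (hr' : Std (r' :: v)) (hne : r ≠ r')
    (g : Good q T (r :: v)) :
    let P := ϖ (r' :: r :: v)
    let k := (q-1)*zz q v r'/(zz q v r'-zz q v r)
    ϖ (r :: r' :: v) * T v.length * P = T v.length * P - k • P := by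
  intro P k
  have := h.sw_itw hr hr' hne g
  simp only at this
  rw [mul_sub, mul_smul_comm, h.sw_ne hr' hr hne.symm g.2, smul_zero, sub_zero, ← mul_assoc] at this
  exact this
lemma sw_PTP {v : List ℕ} {r r' : ℕ} (hr : Std (r :: v)) (hr' : Std (r' :: v)) (hne : r ≠ r')
    (g : Good q T (r :: v)) (g' : Good q T (r' :: v)) :
    let P := ϖ (r' :: r :: v)
    let P' := ϖ (r :: r' :: v)
    let k := (q-1)*zz q v r'/(zz q v r'-zz q v r)
    let k' := (q-1)*zz q v r/(zz q v r-zz q v r')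
    (P * T v.length * P') * (P' * T v.length * P) = (q + k * k') • P := by
  intro P P' k k'
  have hz : zz q v r ≠ zz q v r' := fun e => hne (h.zz_inj hr.2 hr.1 hr'.1 e)
  have a1 : P' * T v.length * P = T v.length * P - k • P := h.sw_TP hr hr' hne g
  have a2 : P * T v.length * P' = T v.length * P' - k' • P' := h.sw_TP hr' hr hne.symm g'
  have b1 : P * P' = 0 := h.sw_ne hr hr' hne g.2
  have pid : P * P = P := by
    refine h.pp_of_eig (hr.sw hr' hne) ?_ (h.pp_eig (hr.sw hr' hne) g.kl)
    exact h.pp_sub hr g _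
  have p'id : P' * P' = P' := by
    refine h.pp_of_eig (hr'.sw hr hne.symm) ?_ (h.pp_eig (hr'.sw hr hne.symm) g'.kl)
    exact h.pp_sub hr' g' _
  have b2 : P * (T v.length * P) = k • P := by
    have e : T v.length * P = P' * T v.length * P + k • P := by rw [a1]; abel
    rw [e, mul_add, ← mul_assoc, ← mul_assoc, b1, mul_smul_comm, pid]; simp
  have kk : k + k' = q - 1 := by
    have e : zz q v r' - zz q v r ≠ 0 := sub_ne_zero.2 hz.symm
    have : zz q v r - zz q v r' = -(zz q v r' - zz q v r) := by ring
    simp only [k, k']; rw [this]; field_simp; ring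
  calc (P * T v.length * P') * (P' * T v.length * P) = P * T v.length * ((P' * P') * T v.length * P) := by
        noncomm_ring
    _ = P * (T v.length * T v.length * P) - k • (P * (T v.length * P)) := by
        rw [p'id, a1, mul_sub, mul_smul_comm]; noncomm_ring
    _ = _ := by
        rw [h.quad, add_mul, mul_add, smul_mul_assoc, mul_smul_comm, b2, smul_mul_assoc, one_mul,
          mul_smul_comm, pid]
        have : q - 1 = k + k' := kk.symm
        rw [this]; module
lemma sw_far {v : List ℕ} {r r' : ℕ} (hr : Std (r :: v)) (hr' : Std (r' :: v)) (hne : r ≠ r') :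
    zz q v r ≠ zz q v r' ∧ zz q v r' ≠ q * zz q v r ∧ zz q v r ≠ q * zz q v r' := by
  have key : ∀ a b : ℤ, q * q ^ a = q ^ b → a + 1 = b := fun a b e => by
    apply h.zinj; rw [zpow_add₀ h.q0, zpow_one, mul_comm, e]
  refine ⟨fun e => hne (h.zz_inj hr.2 hr.1 hr'.1 e), fun e => ?_, fun e => ?_⟩
  all_goals
    have := key _ _ e.symm
    rcases lt_or_gt_of_ne hne with h1 | h1
    · have := hr.2.ct_sep hr'.1 h1; omega
    · have := hr.2.ct_sep hr.1 h1; omega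
lemma mvn_sw {v : List ℕ} {r r' : ℕ} (hr : Std (r :: v)) (hr' : Std (r' :: v)) (hne : r ≠ r')
    (g : Good q T (r :: v)) (g' : Good q T (r' :: v)) :
    MvN K T (v.length+2) (ϖ (r' :: r :: v)) (ϖ (r :: r' :: v)) := by
  obtain ⟨f1, f2, f3⟩ := h.sw_far hr hr' hne
  have s1 := h.sw_PTP hr hr' hne g g'
  have s2 := h.sw_PTP hr' hr hne.symm g' g
  have k0 := h.kap f1 f2 f3
  simp only at s1 s2
  rw [mul_comm ((q-1)*zz q v r/(zz q v r-zz q v r'))] at s2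
  set P := ϖ (r' :: r :: v)
  set P' := ϖ (r :: r' :: v)
  set k := q + (q-1)*zz q v r'/(zz q v r'-zz q v r) * ((q-1)*zz q v r/(zz q v r-zz q v r'))
  have m1 : P ∈ HA K T (v.length+2) := h.pp_mem (r' :: r :: v)
  have m2 : P' ∈ HA K T (v.length+2) := h.pp_mem (r :: r' :: v)
  have m3 : T v.length ∈ HA K T (v.length+2) := HA_T le_rfl
  have i1 := h.pp_of_eig (hr.sw hr' hne) (h.pp_sub hr g _) (h.pp_eig (hr.sw hr' hne) g.kl)
  have i2 := h.pp_of_eig (hr'.sw hr hne.symm) (h.pp_sub hr' g' _) (h.pp_eig (hr'.sw hr hne.symm) g'.kl)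
  have x1 := mul_mem (mul_mem m1 m3) m2
  have x2 := Subalgebra.smul_mem _ (mul_mem (mul_mem m2 m3) m1) k⁻¹
  refine MvN.mk' i1 i2 m1 m2 x1 x2 ?_ ?_
  · rw [mul_smul_comm, s1, smul_smul, inv_mul_cancel₀ k0, one_smul]
  · rw [smul_mul_assoc, s2, smul_smul, inv_mul_cancel₀ k0, one_smul]
lemma mvn_step {n : ℕ} (G : ∀ w, Std w → w.length ≤ n → Good q T w)
    (E : ∀ w w', Std w → Std w' → w.length = n → w.Perm w' →
      MvN K T n (ϖ w) (ϖ w')) {w w' : List ℕ} (hw : Std w) (hw' : Std w')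
    (hl : w.length = n+1) (hp : w.Perm w') :
    MvN K T (n+1) (ϖ w) (ϖ w') := by
  have hl' := hp.length_eq ▸ hl
  match w, w' with
  | [], _ => simp at hl
  | _, [] => simp at hl'
  | r :: w, r' :: w' =>
    have l1 : w.length = n := by simpa using hl
    have l2 : w'.length = n := by simpa using hl'
    by_cases e : r = r'
    · subst e
      have hp' := (List.perm_cons r).1 hp
      have := h.mvn_cons hw (G w hw.2 l1.le) hw' (G w' hw'.2 l2.le) hp' (l1 ▸ E w w' hw.2 hw'.2 l1 hp')
      rwa [l1] at this
    · obtain ⟨v, v1, v2, p1, p2⟩ := Std.two hw hw' hp e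
      have l3 : (r' :: v).length = n := p1.length_eq ▸ l1
      have l4 : (r :: v).length = n := p2.length_eq ▸ l2
      have c1 := h.mvn_cons hw (G w hw.2 l1.le) (v1.sw v2 (Ne.symm e)) (G _ v1 l3.le) p1
        (l1 ▸ E w _ hw.2 v1 l1 p1)
      have c2 := h.mvn_cons (v2.sw v1 e) (G _ v2 l4.le) hw' (G w' hw'.2 l2.le) p2.symm
        (l4 ▸ E _ w' v2 hw'.2 l4 p2.symm)
      have c3 := h.mvn_sw v1 v2 (Ne.symm e) (G _ v1 l3.le) (G _ v2 l4.le)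
      rw [l1] at c1
      rw [l4] at c2
      have : v.length + 2 = n + 1 := by simpa using l3
      rw [this] at c3
      exact (c1.trans c3).trans c2
end HK
lemma nodal_dvd' {ι : Type} [DecidableEq ι] {s : Finset ι} {v : ι → K} (hv : Set.InjOn v s) {f : K[X]}
    (hf : ∀ a ∈ s, f.eval (v a) = 0) : Lagrange.nodal s v ∣ f := by
  rw [Lagrange.nodal]
  apply Finset.prod_dvd_of_coprime
  · intro a ha b hb hab
    exact pairwise_coprime_X_sub_C (s := fun i : s => v i)
      (fun x y e => Subtype.ext (hv x.2 y.2 e)) (i := ⟨a, ha⟩) (j := ⟨b, hb⟩)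
        (by simpa using hab)
  · intro a ha; exact dvd_iff_isRoot.2 (hf a ha)
open Classical in
lemma spectral {J x : B} {W : Finset K} (hW : aeval J (Lagrange.nodal W id) * x = 0) {N : K[X]}
    (hN : ∀ w ∈ W, N.eval w = 0 ∨ ∀ f : K[X],
      J * (aeval J f * x) = w • (aeval J f * x) → aeval J f * x = 0) : aeval J N * x = 0 := by
  rcases W.eq_empty_or_nonempty with rfl | hne
  · simp at hW; simp [hW]
  have hs := Lagrange.sum_basis (s := W) (v := (id : K → K)) (Set.injOn_id _) hne
  have : aeval J N * x = ∑ w ∈ W, aeval J N * (aeval J (Lagrange.basis W id w) * x) := by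
    rw [← mul_sum, ← sum_mul, ← map_sum, hs]; simp
  rw [this]
  refine sum_eq_zero fun w hw => ?_
  have he : J * (aeval J (Lagrange.basis W id w) * x) = w • (aeval J (Lagrange.basis W id w) * x) := by
    obtain ⟨k, hk⟩ := nodal_dvd' (s := W) (v := (id : K → K)) (Set.injOn_id _)
      (f := Lagrange.basis W id w * (X - C w)) (by
        intro a ha
        by_cases e : a = w
        · subst e; simp
        · rw [eval_mul, Lagrange.eval_basis_of_ne (Ne.symm e) ha, zero_mul])
    have h2 : aeval J ((X - C w) * Lagrange.basis W id w) * x = 0 := by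
      rw [mul_comm, hk, mul_comm, map_mul, mul_assoc, hW, mul_zero]
    rw [← sub_eq_zero, ← h2]
    simp [sub_mul, mul_sub, Algebra.algebraMap_eq_smul_one, mul_assoc]
  rcases hN w hw with h1 | h1
  · rw [aeval_eig he, h1, zero_smul]
  · rw [h1 _ he, mul_zero]
namespace HK
variable (h : HK q T)
include h
lemma TJpoly {n : ℕ} {z : K} (g : K[X]) : ∀ x : B, JM q T n * x = z • x →
    T n * (aeval (JM q T (n+1)) ((X - C z) * g) * x) =
      aeval (JM q T n) ((X - C z) * g) * (T n * x) +
        (q-1) • (JM q T (n+1) * (aeval (JM q T (n+1)) g * x)) := by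
  have hT := h.TJ n
  have hJJ := (h.J_J n (n+1)).eq
  set J1 := JM q T n
  set J2 := JM q T (n+1)
  set t := T n
  induction g using Polynomial.induction_on with
  | C a =>
    intro x hx
    have : t * (J2 * x) = J1 * (t * x) + (q-1) • (J2 * x) := by
      rw [← mul_assoc, hT, add_mul, mul_assoc, smul_mul_assoc]
    simp only [map_mul, map_sub, aeval_X, aeval_C, Algebra.algebraMap_eq_smul_one, sub_mul,
      mul_smul_comm, smul_mul_assoc, one_mul, mul_one, mul_sub, smul_sub, this]
    module
  | add f g hf hg =>
    intro x hx
    simp only [mul_add, map_add, add_mul, hf x hx, hg x hx, smul_add]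
    abel
  | monomial m a ih =>
    intro x hx
    have hx2 : J1 * (J2 * x) = z • (J2 * x) := by
      rw [← mul_assoc, hJJ, mul_assoc, hx, mul_smul_comm]
    have i := ih _ hx2
    have e1 : ∀ J : B, aeval J ((X - C z) * (C a * X ^ (m+1))) = aeval J ((X - C z) * (C a * X ^ m)) * J := by
      intro J; rw [pow_succ, ← mul_assoc, ← mul_assoc, map_mul, aeval_X, mul_assoc (X - C z)]
    have e2 : ∀ J : B, aeval J (C a * X ^ (m+1)) = aeval J (C a * X ^ m) * J := by
      intro J; rw [pow_succ, ← mul_assoc, map_mul, aeval_X]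
    have e3 : aeval J1 ((X - C z) * (C a * X ^ m)) * (J2 * x) = 0 := by
      rw [aeval_eig hx2]; simp
    rw [e1, e1, e2, mul_assoc, i, mul_assoc, mul_assoc, ← mul_assoc t, hT, add_mul, mul_add,
      smul_mul_assoc, mul_smul_comm, e3, smul_zero, add_zero, mul_assoc]
lemma weak {n : ℕ} {z : K} (hz : z ≠ 0) {x : B} (hx : JM q T n * x = z • x) (g : K[X])
    (H : aeval (JM q T n) ((X - C z) * g) * (T n * x) = 0) :
    aeval (JM q T (n+1)) ((X - C (q * z)) * ((X - C (q⁻¹ * z)) * g)) * x = 0 := by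
  have hJJ := (h.J_J n (n+1)).eq
  have hT := h.TJ n
  have D1 := h.TJpoly g x hx
  have hx2 : JM q T n * (JM q T (n+1) * x) = z • (JM q T (n+1) * x) := by
    rw [← mul_assoc, hJJ, mul_assoc, hx, mul_smul_comm]
  have D2 := h.TJpoly g _ hx2
  have H2 : aeval (JM q T n) ((X - C z) * g) * (T n * (JM q T (n+1) * x)) = 0 := by
    have c : aeval (JM q T n) ((X - C z) * g) * JM q T n = JM q T n * aeval (JM q T n) ((X - C z) * g) := by
      have := congrArg (aeval (JM q T n)) (mul_comm ((X - C z) * g) X)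
      simpa only [map_mul _ _ X, map_mul _ X, aeval_X] using this
    rw [← mul_assoc (T n), hT, add_mul, mul_add, mul_assoc, ← mul_assoc, c, mul_assoc, H, mul_zero,
      smul_mul_assoc, mul_smul_comm, aeval_eig hx2]
    simp
  rw [H, zero_add] at D1
  rw [H2, zero_add] at D2
  have c2 : aeval (JM q T (n+1)) g * JM q T (n+1) = JM q T (n+1) * aeval (JM q T (n+1)) g := by
    have := congrArg (aeval (JM q T (n+1))) (mul_comm g X)
    simpa only [map_mul, aeval_X] using this
  have hq := h.quad n
  set J1 := JM q T n
  set J2 := JM q T (n+1)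
  set t := T n
  set y := aeval J2 g * x with hy
  have y1 : J1 * y = z • y := by
    have : J1 * aeval J2 g = aeval J2 g * J1 :=
      ((h.aeval_comm (n := n+1) (m := n+1) le_rfl (h.J_mem n) g).eq).symm
    rw [hy, ← mul_assoc, this, mul_assoc, hx, mul_smul_comm]
  have gy : aeval J2 g * (J2 * x) = J2 * y := by rw [← mul_assoc, c2, mul_assoc]
  have pe : ∀ v : B, aeval J2 ((X - C z) * g) * v = J2 * (aeval J2 g * v) - z • (aeval J2 g * v) := by
    intro v; simp [sub_mul, mul_assoc, Algebra.algebraMap_eq_smul_one]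
  rw [pe, gy] at D2
  rw [pe, ← hy] at D1
  have tq : ∀ v : B, t * (t * v) = (q-1) • (t * v) + q • v := by
    intro v; rw [← mul_assoc, hq, add_mul, smul_mul_assoc, smul_mul_assoc, one_mul]
  have E : ∀ v : B, t * (J2 * v - z • v) = (q-1) • (J2 * v) → ((q-1)*z) • (t * v) = q • (J2 * v - z • v) := by
    intro v hv
    have a := tq (J2 * v - z • v)
    rw [hv, mul_smul_comm] at a
    have b : t * (J2 * v) = (q-1) • (J2 * v) + z • (t * v) := by
      rw [← hv, mul_sub, mul_smul_comm]; abel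
    rw [b] at a
    linear_combination (norm := module) a
  have E1 := E y D1
  have E2 := E (J2 * y) D2
  have tJ : t * (J2 * y) = J1 * (t * y) + (q-1) • (J2 * y) := by
    rw [← mul_assoc, hT, add_mul, mul_assoc, smul_mul_assoc]
  have J1t : ((q-1)*z) • (J1 * (t * y)) = (q*z) • (J2 * y - z • y) := by
    rw [← mul_smul_comm, E1, mul_smul_comm, mul_sub, ← mul_assoc, hJJ, mul_assoc, mul_smul_comm, y1,
      mul_smul_comm]
    module
  rw [tJ, smul_add, J1t] at E2
  have fin : aeval J2 ((X - C (q * z)) * ((X - C (q⁻¹ * z)) * g)) * x =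
      J2 * (J2 * y) - (q*z + q⁻¹*z) • (J2 * y) + (z*z) • y := by
    simp only [map_mul, map_sub, aeval_X, aeval_C, mul_assoc, sub_mul, mul_sub,
      Algebra.algebraMap_eq_smul_one, smul_mul_assoc, one_mul, mul_smul_comm, smul_smul, ← hy]
    have := h.q0
    match_scalars <;> field_simp <;> ring
  rw [fin]
  have hq0 := h.q0
  have key : q • (J2 * (J2 * y) - (q*z + q⁻¹*z) • (J2 * y) + (z*z) • y) = 0 := by
    have : q • (J2 * (J2 * y) - (q*z + q⁻¹*z) • (J2 * y) + (z*z) • y) =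
      q • (J2 * (J2 * y)) - (q*q*z + z) • (J2 * y) + (q*z*z) • y := by
      match_scalars <;> field_simp
    rw [this]
    linear_combination (norm := module) -E2
  exact (smul_eq_zero.1 key).resolve_left hq0
lemma BR {v : List ℕ} {i r : ℕ} (hv : Std (r :: i :: v)) (g : Good q T (i :: v)) {y : B}
    (hy : ϖ (r :: i :: v) * y = y)
    (hc : ct (i :: v) r = ct v i + 1 ∨ ct (i :: v) r = ct v i - 1)
    (h3 : JM q T (v.length+2) * y = zz q v i • y) : y = 0 := by
  have y1 : ϖ (i :: v) * y = y := by
    rw [← hy, ← mul_assoc, h.pp_sub hv.2 g]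
  have y0 : ϖ v * y = y := by
    rw [← y1, ← mul_assoc, h.pp_sub hv.2.2 g.2]
  have j1 : JM q T v.length * y = zz q v i • y := by
    rw [← y1, ← mul_assoc, h.pp_eig hv.2 g.2.kl, smul_mul_assoc]
  have j2 : JM q T (v.length+1) * y = zz q (i :: v) r • y := by
    have := h.pp_eig hv g.kl
    rw [← hy, ← mul_assoc]; erw [this]; rw [smul_mul_assoc]
  have zne : zz q v i ≠ zz q (i :: v) r := fun e => by have := h.zinj e; omega
  have a1 := h.AL g.2.kl zne y0 j1 j2 (fun s hs e => by
    have := h.zinj e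
    rcases lt_trichotomy s i with h1 | rfl | h1
    · have := hv.2.2.ct_sep hv.2.1 h1; omega
    · omega
    · have := hv.2.2.ct_sep hs h1; omega)
  have a2 := h.AL (v := i :: v) g.kl zne.symm y1 j2 h3 (fun s hs e => by
    have := h.zinj e
    rcases lt_trichotomy s r with h1 | rfl | h1
    · have := hv.2.ct_sep hv.1 h1; omega
    · omega
    · have := hv.2.ct_sep hs h1; omega)
  rw [List.length_cons] at a2
  have br := congrArg (· * y) (h.braid v.length)
  simp only [mul_assoc, a1, a2, mul_smul_comm, smul_smul] at br
  rw [← sub_eq_zero, ← sub_smul] at br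
  refine (smul_eq_zero.1 br).resolve_left ?_
  have qz : zz q v i ≠ 0 := zpow_ne_zero _ h.q0
  have q0 := h.q0
  have q1 := h.q1
  have qq := h.qq1
  have q1' : 1 - q ≠ 0 := by rw [← neg_sub]; exact neg_ne_zero.2 q1
  have hb : zz q (i :: v) r = q * zz q v i ∨ zz q (i :: v) r = q⁻¹ * zz q v i := by
    rcases hc with e | e
    · left; rw [zz, e, zpow_add₀ q0, zpow_one, mul_comm]; rfl
    · right; rw [zz, e, zpow_sub₀ q0, zpow_one, div_eq_inv_mul]; rfl
  set a := zz q v i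
  have v1 : (q-1)*(q*a)/(q*a-a) = q := by
    have : q*a - a = (q-1)*a := by ring
    rw [this]; field_simp
  have v2 : (q-1)*(q⁻¹*a)/(q⁻¹*a-a) = -1 := by
    have : q⁻¹*a-a = -((q-1)*(q⁻¹*a)) := by field_simp; ring
    rw [this, div_neg, div_self (by positivity)]
  have v3 : (q-1)*a/(a-q⁻¹*a) = q := by
    have : a-q⁻¹*a = (q-1)*a*q⁻¹ := by field_simp
    rw [this]; field_simp
  have v4 : (q-1)*a/(a-q*a) = -1 := by
    have : a - q*a = -((q-1)*a) := by ring
    rw [this, div_neg, div_self (mul_ne_zero q1 qz)]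
  rcases hb with e | e
  · rw [e, v1, v4]; intro h0; apply mul_ne_zero q0 qq; linear_combination -h0
  · rw [e, v2, v3]; intro h0; apply mul_ne_zero q0 qq; linear_combination h0
lemma van {n : ℕ} (G : ∀ w, Std w → w.length ≤ n → Good q T w)
    (E : ∀ w w', Std w → Std w' → w.length = n → w.Perm w' →
      MvN K T n (ϖ w) (ϖ w')) {w : List ℕ} {r i : ℕ} (hw : Std (r :: w))
    (hl : w.length = n) (hi : w.count (i+1) < w.count i)
    (hc : ct w r = ct w i ∨ ct w r = ct w i - 2) (hne : r = i ∨ r = i + 1) (f : K[X])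
    (hy : JM q T (n+1) * (aeval (JM q T (n+1)) f * ϖ (r :: w)) =
      q ^ (ct w i - 1) • (aeval (JM q T (n+1)) f * ϖ (r :: w))) :
    aeval (JM q T (n+1)) f * ϖ (r :: w) = 0 := by
  obtain ⟨v, hv, hp⟩ := hw.2.corner hi
  have hs : Std (r :: i :: v) := ⟨AddR_perm hp ▸ hw.1, hv⟩
  have lv : (i :: v).length = n := hp.length_eq ▸ hl
  have m := h.mvn_cons hw (G w hw.2 hl.le) hs (G _ hv lv.le) hp (hl ▸ E _ _ hw.2 hv hl hp)
  obtain ⟨u, u', h1, h2, h3, h4, h5, h6, h7, h8⟩ := m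
  rw [hl] at h1 h2
  set y := aeval (JM q T (n+1)) f * ϖ (r :: w) with hyd
  have cJ := h.J_comm (le_refl (n+1)) h2
  have cp : ϖ (r :: w) * y = y := by
    have c := h.aeval_comm (n := n+1) (m := n+1) le_rfl (by have := h.pp_mem (r :: w); rwa [List.length_cons, hl] at this) f
    rw [hyd, ← mul_assoc, ← c.eq, mul_assoc, h.pp_of_eig hw (h.pp_sub hw.2 (G w hw.2 hl.le) r)
      (h.pp_eig hw (G w hw.2 hl.le).kl)]
  have ci : ct v i = ct w i - 1 := by
    rw [ct_perm hp, ct_cons_self]; ring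
  have : u' * y = 0 := by
    refine h.BR hs (G _ hv lv.le) ?_ ?_ ?_ (i := i) (r := r)
    · rw [← mul_assoc, h7]
    · rw [← ct_perm hp, ci]; omega
    · have : v.length + 2 = n + 1 := by simpa using lv
      rw [this, ← mul_assoc, cJ.eq, mul_assoc, hy, mul_smul_comm, zz, ci]
  rw [← cp, ← h3, mul_assoc, this, mul_zero]
lemma kl_step {n : ℕ} (G : ∀ w, Std w → w.length ≤ n → Good q T w)
    (E : ∀ w w', Std w → Std w' → w.length = n → w.Perm w' →
      MvN K T n (ϖ w) (ϖ w')) {w : List ℕ} {r : ℕ} (hw : Std (r :: w))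
    (hl : w.length = n) : KL q T (r :: w) := by
  classical
  have gw := G w hw.2 hl.le
  have q0 := h.q0
  have hzz := hw.2.mem_iff r |>.1 hw.1
  set z := zz q w r with hz
  have z0 : z ≠ 0 := zpow_ne_zero _ h.q0
  have hx := h.pp_eig hw gw.kl
  have H : aeval (JM q T w.length) ((X - C z) * Lagrange.nodal ((AddR w).erase r) (zz q w)) *
      (T w.length * ϖ (r :: w)) = 0 := by
    rw [hz, ← Lagrange.nodal_eq_mul_nodal_erase hw.1, ← h.pp_sub hw.2 gw r, ← mul_assoc (T _),
      (h.T_comm le_rfl (h.pp_mem w)).eq, ← mul_assoc, ← mul_assoc,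
      (h.aeval_comm le_rfl (h.pp_mem w) _).eq, gw.kl, zero_mul, zero_mul]
  have wk := h.weak z0 hx _ H
  have e1 : q * z = q ^ (ct w r + 1) := by rw [hz, zz, zpow_add₀ q0, zpow_one, mul_comm]
  have e2 : q⁻¹ * z = q ^ (ct w r - 1) := by rw [hz, zz, zpow_sub₀ q0, zpow_one, div_eq_inv_mul]
  have far : ∀ a ∈ (AddR w).erase r, ct w a ≠ ct w r + 1 ∧ ct w a ≠ ct w r - 1 := by
    intro a ha
    rw [Finset.mem_erase] at ha
    rcases lt_or_gt_of_ne ha.1 with h1 | h1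
    · have := hw.2.ct_sep hw.1 h1; omega
    · have := hw.2.ct_sep ha.2 h1; omega
  have n2 : q⁻¹ * z ∉ ((AddR w).erase r).image (zz q w) := by
    rw [mem_image]; rintro ⟨a, ha, e⟩; rw [e2] at e; exact (far a ha).2 (h.zinj e)
  have n1 : q * z ∉ insert (q⁻¹ * z) (((AddR w).erase r).image (zz q w)) := by
    rw [Finset.mem_insert, mem_image]; rintro (e | ⟨a, ha, e⟩)
    · rw [e1, e2] at e; have := h.zinj e; omega
    · rw [e1] at e; exact (far a ha).1 (h.zinj e)
  have hnod : Lagrange.nodal (insert (q * z) (insert (q⁻¹ * z) (((AddR w).erase r).image (zz q w)))) id =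
      (X - C (q * z)) * ((X - C (q⁻¹ * z)) * Lagrange.nodal ((AddR w).erase r) (zz q w)) := by
    rw [Lagrange.nodal_insert_eq_nodal n1, Lagrange.nodal_insert_eq_nodal n2, Lagrange.nodal_eq,
      Finset.prod_image (fun a ha b hb e => h.zz_inj hw.2 (Finset.mem_of_mem_erase ha)
        (Finset.mem_of_mem_erase hb) e)]
    rfl
  rw [← hnod] at wk
  unfold KL
  have cc := h.aeval_comm (m := (r :: w).length) le_rfl (h.pp_mem (r :: w)) (Lagrange.nodal (AddR (r :: w)) (zz q (r :: w)))
  rw [← cc.eq]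
  refine spectral (W := _) wk ?_
  intro s hs
  simp only [Finset.mem_insert, mem_image] at hs
  have root : ∀ a ∈ AddR (r :: w), s = zz q (r :: w) a →
      eval s (Lagrange.nodal (AddR (r :: w)) (zz q (r :: w))) = 0 := by
    intro a ha e; rw [e]; exact Lagrange.eval_nodal_at_node ha
  have r1 : r + 1 ∈ AddR (r :: w) := by
    rw [hw.mem_iff]; right; have := hw.rem; simpa using this
  rcases hs with rfl | rfl | ⟨a, ha, rfl⟩
  · by_cases hr : r ∈ AddR (r :: w)
    · left; exact root r hr (by rw [e1, zz, ct_cons_self])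
    · right; intro f hf
      rw [hw.mem_iff] at hr
      simp only [cnt_cons, if_true] at hr
      have h0 : r ≠ 0 := fun e => hr (Or.inl e)
      obtain ⟨i, rfl⟩ : ∃ i, r = i + 1 := ⟨r - 1, by omega⟩
      simp at hr hzz
      have ce : ct w (i+1) = ct w i - 2 := by unfold ct; push_cast; omega
      rw [e1] at hf
      have hv := h.van G E hw hl (i := i) hzz (Or.inr ce) (Or.inr rfl) f
      rw [← hl] at hv
      exact hv (by rw [show ct w i - 1 = ct w (i+1) + 1 by omega]; exact hf)
  · by_cases hr : w.count (r+1) < w.count r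
    · right; intro f hf
      rw [e2] at hf
      have hv := h.van G E hw hl (i := r) hr (Or.inl rfl) (Or.inl rfl) f
      rw [← hl] at hv
      exact hv hf
    · left
      have := hw.2.le (show r ≤ r + 1 by omega)
      refine root (r+1) r1 ?_
      rw [e2, zz, ct_cons_ne (by omega)]; congr 1; unfold ct; push_cast; omega
  · left
    rw [Finset.mem_erase] at ha
    refine root a ?_ (by rw [zz, zz, ct_cons_ne ha.1])
    by_cases e : a = r + 1
    · rw [e]; exact r1
    · exact (hw.add_cons a ha.1 e).2 ha.2
lemma main_ind (n : ℕ) : (∀ w, Std w → w.length ≤ n → Good q T w) ∧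
    (∀ w w', Std w → Std w' → w.length = n → w.Perm w' →
      MvN K T n (ϖ w) (ϖ w')) := by
  induction n with
  | zero =>
    have g0 : Good q T [] := by
      show KL q T []
      unfold KL
      have : AddR [] = {0} := by decide
      simp [this, zz, ct, JM, Lagrange.nodal]
    refine ⟨fun w hw hl => ?_, fun w w' hw hw' hl hp => ?_⟩
    · have := List.length_eq_zero_iff.1 (Nat.le_zero.1 hl); subst this; exact g0
    · have := List.length_eq_zero_iff.1 hl; subst this
      have := hp.symm.eq_nil; subst this
      exact h.mvn_refl hw g0
  | succ n ih =>
    refine ⟨fun w hw hl => ?_, fun w w' hw hw' hl hp => h.mvn_step ih.1 ih.2 hw hw' hl hp⟩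
    rcases Nat.lt_or_ge w.length (n+1) with h1 | h1
    · exact ih.1 w hw (by omega)
    · match w with
      | [] => simp at h1
      | r :: w =>
        have : w.length = n := by simp at hl h1; omega
        exact ⟨h.kl_step ih.1 ih.2 hw this, ih.1 w hw.2 this.le⟩
lemma good {w : List ℕ} (hw : Std w) : Good q T w := (h.main_ind w.length).1 w hw le_rfl
lemma eqv {w w' : List ℕ} (hw : Std w) (hw' : Std w') (hp : w.Perm w') :
    MvN K T w.length (ϖ w) (ϖ w') := (h.main_ind w.length).2 w w' hw hw' rfl hp
end HK
def PathsF (v : List ℕ) : ℕ → Finset (List ℕ)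
  | 0 => {v}
  | l+1 => (PathsF v l).biUnion fun w => (AddR w).image (· :: w)
lemma mem_PathsF_succ {v t : List ℕ} {l : ℕ} :
    t ∈ PathsF v (l+1) ↔ ∃ r w, t = r :: w ∧ w ∈ PathsF v l ∧ r ∈ AddR w := by
  simp only [PathsF, Finset.mem_biUnion, mem_image]
  constructor
  · rintro ⟨w, hw, r, hr, rfl⟩; exact ⟨r, w, rfl, hw, hr⟩
  · rintro ⟨r, w, rfl, hw, hr⟩; exact ⟨w, hw, r, hr, rfl⟩
lemma PathsF_std {v : List ℕ} (hv : Std v) {l : ℕ} {t : List ℕ} (ht : t ∈ PathsF v l) :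
    Std t ∧ t.length = v.length + l := by
  induction l generalizing t with
  | zero => simp [PathsF] at ht; subst ht; exact ⟨hv, rfl⟩
  | succ l ih =>
    obtain ⟨r, w, rfl, hw, hr⟩ := mem_PathsF_succ.1 ht
    exact ⟨⟨hr, (ih hw).1⟩, by simp [(ih hw).2]; omega⟩
lemma PathsF_mem_app {v s : List ℕ} (h : Std (s ++ v)) : s ++ v ∈ PathsF v s.length := by
  induction s with
  | nil => simp [PathsF]
  | cons r s ih => exact mem_PathsF_succ.2 ⟨r, s ++ v, rfl, ih h.2, h.1⟩
lemma PathsF_nil {t : List ℕ} (h : Std t) : t ∈ PathsF [] t.length := by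
  have := PathsF_mem_app (v := []) (s := t) (by simpa using h)
  simpa using this
lemma PathsF_app {v t : List ℕ} {l : ℕ} (ht : t ∈ PathsF v l) : ∃ s, t = s ++ v ∧ s.length = l := by
  induction l generalizing t with
  | zero => simp [PathsF] at ht; exact ⟨[], by simp [ht]⟩
  | succ l ih =>
    obtain ⟨r, w, rfl, hw, hr⟩ := mem_PathsF_succ.1 ht
    obtain ⟨s, rfl, hs⟩ := ih hw
    exact ⟨r :: s, rfl, by simp [hs]⟩
lemma sum_PathsF_succ {M : Type*} [AddCommMonoid M] (v : List ℕ) (l : ℕ) (f : List ℕ → M) :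
    ∑ t ∈ PathsF v (l+1), f t = ∑ w ∈ PathsF v l, ∑ r ∈ AddR w, f (r :: w) := by
  rw [PathsF, Finset.sum_biUnion]
  · refine sum_congr rfl fun w _ => Finset.sum_image ?_
    intro a _ b _ e; simpa using e
  · intro a _ b _ hab
    rw [Function.onFun, Finset.disjoint_left]
    simp only [mem_image]
    rintro _ ⟨r, _, rfl⟩ ⟨r', _, e⟩
    exact hab (by simp at e; exact e.2.symm)
def HAspan (K : Type) [Field K] [Algebra K B] (T : ℕ → B) (n : ℕ) : Submodule K B :=
  Submodule.span K {y | y ∈ HA K T (n+1) ∨ ∃ a b, a ∈ HA K T (n+1) ∧ b ∈ HA K T (n+1) ∧ y = a * T n * b}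
lemma HAspan_bi {n : ℕ} {a d y : B} (ha : a ∈ HA K T (n+1)) (hd : d ∈ HA K T (n+1))
    (hy : y ∈ HAspan K T n) : a * y * d ∈ HAspan K T n := by
  induction hy using Submodule.span_induction with
  | mem y hy =>
    apply Submodule.subset_span
    rcases hy with hy | ⟨b, c, hb, hc, rfl⟩
    · exact Or.inl (mul_mem (mul_mem ha hy) hd)
    · exact Or.inr ⟨a * b, c * d, mul_mem ha hb, mul_mem hc hd, by noncomm_ring⟩
  | zero => simp
  | add x y _ _ hx hy => rw [mul_add, add_mul]; exact add_mem hx hy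
  | smul c x _ hx => rw [mul_smul_comm, smul_mul_assoc]; exact Submodule.smul_mem _ _ hx
lemma HA_small {n : ℕ} (hn : n ≤ 1) {x : B} (hx : x ∈ HA K T n) : ∃ c : K, x = c • 1 := by
  refine HA_induction (P := fun x => ∃ c : K, x = c • (1:B)) (fun i hi => by omega)
    (fun r => ⟨r, Algebra.algebraMap_eq_smul_one r⟩) ?_ ?_ hx
  · rintro _ _ ⟨a, rfl⟩ ⟨b, rfl⟩; exact ⟨a + b, (add_smul _ _ _).symm⟩
  · rintro _ _ _ _ ⟨a, rfl⟩ ⟨b, rfl⟩; exact ⟨a * b, by simp [smul_smul, mul_comm]⟩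
lemma sum_scal {ι : Type*} {s : Finset ι} {f : ι → B} {p : B} (hf : ∀ i ∈ s, ∃ c : K, f i = c • p) :
    ∃ c : K, ∑ i ∈ s, f i = c • p := by
  choose! c hc using hf
  exact ⟨∑ i ∈ s, c i, by rw [sum_smul]; exact sum_congr rfl hc⟩
namespace HK
variable (h : HK q T)
include h
lemma HA_dec_go (n : ℕ) (key : ∀ y ∈ HA K T (n+1), T n * y * T n ∈ HAspan K T n) {x : B}
    (hx : x ∈ HA K T (n+2)) : x ∈ HAspan K T n := by
  refine HA_induction (P := fun x => x ∈ HAspan K T n) ?_ ?_ ?_ ?_ hx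
  · intro i hi
    apply Submodule.subset_span
    rcases Nat.lt_or_ge i n with h1 | h1
    · exact Or.inl (HA_T (by omega))
    · have : i = n := by omega
      subst this; exact Or.inr ⟨1, 1, one_mem _, one_mem _, by simp⟩
  · intro r; exact Submodule.subset_span (Or.inl (Subalgebra.algebraMap_mem _ r))
  · intro x y hx hy; exact add_mem hx hy
  · intro x y _ _ hx hy
    have hxy := Submodule.mul_mem_mul hx hy
    unfold HAspan at hxy
    rw [Submodule.span_mul_span] at hxy
    refine Submodule.span_le.2 ?_ hxy
    rintro _ ⟨x, hx, y, hy, rfl⟩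
    show x * y ∈ HAspan K T n
    rcases hx with hx | ⟨a, b, ha, hb, rfl⟩ <;> rcases hy with hy | ⟨c, d, hc, hd, rfl⟩
    · exact Submodule.subset_span (Or.inl (mul_mem hx hy))
    · exact Submodule.subset_span (Or.inr ⟨x * c, d, mul_mem hx hc, hd, by noncomm_ring⟩)
    · exact Submodule.subset_span (Or.inr ⟨a, b * y, ha, mul_mem hb hy, by noncomm_ring⟩)
    · have := HAspan_bi ha hd (key (b * c) (mul_mem hb hc))
      convert this using 1; noncomm_ring
lemma HA_dec {n : ℕ} {x : B} (hx : x ∈ HA K T (n+2)) : x ∈ HAspan K T n := by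
  induction n generalizing x with
  | zero => exact h.HA_dec_go 0 (fun y hy => by
      obtain ⟨c, rfl⟩ := HA_small le_rfl hy
      rw [mul_smul_comm, mul_one, smul_mul_assoc, h.quad]
      refine Submodule.smul_mem _ _ (add_mem (Submodule.smul_mem _ _ (Submodule.subset_span
        (Or.inr ⟨1, 1, one_mem _, one_mem _, by simp⟩))) (Submodule.smul_mem _ _ (Submodule.subset_span
          (Or.inl (one_mem _)))))) hx
  | succ m ih => exact h.HA_dec_go (m+1) (fun y hy => by
      have := ih hy
      clear hy
      induction this using Submodule.span_induction with
      | mem y hy' =>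
        rcases hy' with hy' | ⟨e, f, he, hf, rfl⟩
        · have hy : y ∈ HA K T (m+1+1) := HA_mono (by omega) hy'
          rw [(h.T_comm le_rfl hy').eq, mul_assoc, h.quad, mul_add, mul_smul_comm, mul_smul_comm, mul_one]
          exact add_mem (Submodule.smul_mem _ _ (Submodule.subset_span
            (Or.inr ⟨y, 1, hy, one_mem _, by simp⟩))) (Submodule.smul_mem _ _ (Submodule.subset_span
            (Or.inl hy)))
        · have c1 := (h.T_comm le_rfl he).eq
          have c2 := (h.T_comm le_rfl hf).eq
          apply Submodule.subset_span
          have mm : T m ∈ HA K T (m+1+1) := HA_T (by omega)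
          refine Or.inr ⟨e * T m, T m * f, mul_mem (HA_mono (by omega) he) mm,
            mul_mem mm (HA_mono (by omega) hf), ?_⟩
          calc T (m+1) * (e * T m * f) * T (m+1) = (T (m+1) * e) * T m * (f * T (m+1)) := by noncomm_ring
            _ = e * (T (m+1) * T m * T (m+1)) * f := by rw [c1, ← c2]; noncomm_ring
            _ = _ := by rw [← h.braid m]; noncomm_ring
      | zero => simp
      | add x y h1 h2 hx hy => rw [mul_add, add_mul]; exact add_mem hx hy
      | smul c x h1 hx => rw [mul_smul_comm, smul_mul_assoc]; exact Submodule.smul_mem _ _ hx) hx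
lemma paths_sum {v : List ℕ} (hv : Std v) (l : ℕ) : ∑ t ∈ PathsF v l, ϖ t = ϖ v := by
  induction l with
  | zero => simp [PathsF]
  | succ l ih =>
    rw [sum_PathsF_succ, ← ih]
    exact sum_congr rfl fun w hw => h.pp_sum (PathsF_std hv hw).1
lemma pp_id {w : List ℕ} (hw : Std w) : ϖ w * ϖ w = ϖ w := h.pp_idem hw (h.good hw)
lemma pp_orth {w w' : List ℕ} (hw : Std w) (hw' : Std w') (hl : w.length = w'.length)
    (hne : w ≠ w') : ϖ w * ϖ w' = 0 := by
  induction w generalizing w' with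
  | nil => exact absurd (List.length_eq_zero_iff.1 hl.symm).symm hne
  | cons r w ih =>
    match w' with
    | [] => simp at hl
    | r' :: w' =>
      by_cases e : w = w'
      · subst e; exact h.pp_ne hw hw' (h.good hw.2) (fun e => hne (by rw [e]))
      · rw [h.pp_cons', pp, mul_assoc, ← mul_assoc (ϖ w), ih hw.2 hw'.2 (by simpa using hl) e]
        simp
lemma adj {v : List ℕ} {j r : ℕ} (hs : Std (r :: j :: v)) :
    (r ≠ j ∧ Std (r :: v)) ∨ ((r = j ∨ r = j + 1) ∧
      ((r = j ∧ ct (j :: v) r = ct v j + 1) ∨ (r = j + 1 ∧ ct (j :: v) r = ct v j - 1))) := by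
  by_cases e : r = j
  · subst e; right; exact ⟨Or.inl rfl, Or.inl ⟨rfl, ct_cons_self⟩⟩
  by_cases e2 : r ∈ AddR v
  · exact Or.inl ⟨e, e2, hs.2.2⟩
  right
  by_cases e3 : r = j + 1
  · refine ⟨Or.inr e3, Or.inr ⟨e3, ?_⟩⟩
    subst e3
    rw [ct_cons_ne e]
    have := hs.2.2.le (show j ≤ j + 1 by omega)
    rw [hs.2.2.mem_iff] at e2
    simp at e2
    unfold ct; push_cast; omega
  · exact absurd ((hs.2.add_cons r e e3).1 hs.1) e2
lemma TPdec {v : List ℕ} {j r : ℕ} (hs : Std (r :: j :: v)) :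
    (r ≠ j ∧ Std (r :: v) ∧ T v.length * ϖ (r :: j :: v) =
      ϖ (j :: r :: v) * T v.length * ϖ (r :: j :: v) +
      ((q-1)*zz q v r/(zz q v r-zz q v j)) • ϖ (r :: j :: v)) ∨
    ((r = j ∨ r = j+1) ∧ T v.length * ϖ (r :: j :: v) = (if r = j then q else -1 : K) • ϖ (r :: j :: v)) := by
  rcases h.adj hs with ⟨h1, h2⟩ | ⟨h0, h1⟩
  · left; refine ⟨h1, h2, ?_⟩
    have := h.sw_TP hs.2 h2 (Ne.symm h1) (h.good hs.2)
    simp only at this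
    rw [this]; abel
  · right
    refine ⟨h0, ?_⟩
    have gs := h.good hs
    have y1 : ϖ (j :: v) * ϖ (r :: j :: v) = ϖ (r :: j :: v) := h.pp_sub hs.2 gs.2 r
    have y0 : ϖ v * ϖ (r :: j :: v) = ϖ (r :: j :: v) := by
      rw [← y1, ← mul_assoc, h.pp_sub hs.2.2 gs.2.2]
    have j1 : JM q T v.length * ϖ (r :: j :: v) = zz q v j • ϖ (r :: j :: v) := by
      rw [← y1, ← mul_assoc, h.pp_eig hs.2 gs.2.2.kl, smul_mul_assoc]
    have j2 : JM q T (v.length+1) * ϖ (r :: j :: v) = zz q (j :: v) r • ϖ (r :: j :: v) :=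
      h.pp_eig hs gs.2.kl
    have zne : zz q v j ≠ zz q (j :: v) r := fun e => by have := h.zinj e; omega
    have a1 := h.AL gs.2.2.kl zne y0 j1 j2 (fun s hs' e => by
      have := h.zinj e
      rcases lt_trichotomy s j with h1 | rfl | h1
      · have := hs.2.2.ct_sep hs.2.1 h1; omega
      · omega
      · have := hs.2.2.ct_sep hs' h1; omega)
    rw [a1]; congr 1
    have q0 := h.q0
    have q1 := h.q1
    have a0 : zz q v j ≠ 0 := zpow_ne_zero _ q0
    rcases h1 with ⟨rfl, e⟩ | ⟨rfl, e⟩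
    · have e' : zz q (r :: v) r = q * zz q v r := by
        rw [zz, e, zpow_add₀ q0, zpow_one, mul_comm]; rfl
      rw [e', if_pos rfl]
      have : q * zz q v r - zz q v r = (q-1) * zz q v r := by ring
      rw [this]; field_simp
    · have e' : zz q (j :: v) (j+1) = q⁻¹ * zz q v j := by
        rw [zz, e, zpow_sub₀ q0, zpow_one, div_eq_inv_mul]; rfl
      rw [e', if_neg (by omega)]
      have : q⁻¹ * zz q v j - zz q v j = -((q-1)*(q⁻¹ * zz q v j)) := by field_simp; ring
      rw [this, div_neg, div_self (by positivity)]
lemma PTP {t v' : List ℕ} {j r' : ℕ} (ht : Std t) (ht' : Std (r' :: j :: v'))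
    (hl : t.length = v'.length + 2) :
    ϖ t * T v'.length * ϖ (r' :: j :: v') = 0 ∨
      (t = r' :: j :: v' ∧ ∃ c : K, ϖ t * T v'.length * ϖ (r' :: j :: v') = c • ϖ t) ∨
      (r' ≠ j ∧ t = j :: r' :: v') := by
  have o : t ≠ r' :: j :: v' → ϖ t * ϖ (r' :: j :: v') = 0 :=
    h.pp_orth ht ht' (by simpa using hl)
  rcases h.TPdec ht' with ⟨h1, h2, h3⟩ | ⟨h0, h3⟩
  · by_cases e : t = j :: r' :: v'
    · exact Or.inr (Or.inr ⟨h1, e⟩)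
    have o2 : ϖ t * ϖ (j :: r' :: v') = 0 :=
      h.pp_orth ht (h2.sw ht'.2 h1) (by simpa using hl) e
    have : ϖ t * T v'.length * ϖ (r' :: j :: v') =
        ((q-1)*zz q v' r'/(zz q v' r'-zz q v' j)) • (ϖ t * ϖ (r' :: j :: v')) := by
      rw [mul_assoc, h3, mul_add, ← mul_assoc, ← mul_assoc, o2, mul_smul_comm]; simp
    by_cases e : t = r' :: j :: v'
    · right; left; exact ⟨e, (q-1)*zz q v' r'/(zz q v' r'-zz q v' j), by rw [this, e, h.pp_id ht']⟩
    · left; rw [this, o e, smul_zero]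
  · by_cases e : t = r' :: j :: v'
    · right; left; refine ⟨e, (if r' = j then q else -1 : K), ?_⟩
      rw [mul_assoc, h3, mul_smul_comm, e, h.pp_id ht']
    · left; rw [mul_assoc, h3, mul_smul_comm, o e, smul_zero]
lemma Cterm {m : ℕ} (ih : ∀ x ∈ HA K T (m+1), ∀ w w', Std w → Std w' → w.length = m+1 → w'.length = m+1 →
    ((¬ w.Perm w' → ϖ w * x * ϖ w' = 0) ∧ ∃ c : K, ϖ w * x * ϖ w = c • ϖ w))
    {a b : B} (ha : a ∈ HA K T (m+1)) (hb : b ∈ HA K T (m+1)) {r r' : ℕ} {w w' t t' : List ℕ}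
    (hw : Std (r :: w)) (hw' : Std (r' :: w')) (l1 : w.length = m+1) (l2 : w'.length = m+1)
    (st : Std t) (st' : Std t') (l3 : t.length = m+1) (l4 : t'.length = m+1) :
    (¬ (r :: w).Perm (r' :: w') →
      (ϖ (r :: w) * a * ϖ t) * T m * (ϖ t' * b * ϖ (r' :: w')) = 0) ∧
    (r :: w = r' :: w' → ∃ c : K,
      (ϖ (r :: w) * a * ϖ t) * T m * (ϖ t' * b * ϖ (r' :: w')) = c • ϖ (r :: w)) := by
  by_cases h1 : w.Perm t
  swap
  · have : ϖ (r :: w) * a * ϖ t = 0 := by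
      rw [h.pp_cons' w r, mul_assoc, mul_assoc, ← mul_assoc (ϖ w), (ih a ha w t hw.2 st l1 l3).1 h1, mul_zero]
    rw [this]; exact ⟨fun _ => by simp, fun _ => ⟨0, by simp⟩⟩
  by_cases h2 : t'.Perm w'
  swap
  · have : ϖ t' * b * ϖ (r' :: w') = 0 := by
      rw [pp, ← mul_assoc, (ih b hb t' w' st' hw'.2 l4 l2).1 h2, zero_mul]
    rw [this]; exact ⟨fun _ => by simp, fun _ => ⟨0, by simp⟩⟩
  have e1 : ϖ (r :: w) * a * ϖ t = ϖ w * a * ϖ (r :: t) := by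
    rw [h.pp_cons' t r, pp, mul_assoc (ϖ w), (h.aeval_comm l1.ge ha _).eq, l1, l3, ee_perm h1]
    noncomm_ring
  have e2 : ϖ t' * b * ϖ (r' :: w') = ϖ (r' :: t') * b * ϖ w' := by
    rw [h.pp_cons' w' r', pp, mul_assoc (ϖ t') _ b, (h.aeval_comm l4.ge hb _).eq, l2, l4, ee_perm h2]
    noncomm_ring
  have e3 : (ϖ (r :: w) * a * ϖ t) * T m * (ϖ t' * b * ϖ (r' :: w')) =
      ϖ w * a * (ϖ (r :: t) * T m * ϖ (r' :: t')) * b * ϖ w' := by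
    rw [e1, e2]; noncomm_ring
  rw [e3]
  have srt : Std (r :: t) := ⟨by rw [← AddR_perm h1]; exact hw.1, st⟩
  have srt' : Std (r' :: t') := ⟨by rw [AddR_perm h2]; exact hw'.1, st'⟩
  match t', l4 with
  | j :: v', l4 =>
  have l5 : v'.length = m := by simpa using l4
  rcases h.PTP srt srt' (by simp [l3, l5]) with h0 | ⟨h0, c, h3⟩ | ⟨h0, h3⟩
  · rw [l5] at h0; rw [h0]; exact ⟨fun _ => by simp, fun _ => ⟨0, by simp⟩⟩
  · rw [l5] at h3; rw [h3]
    obtain ⟨e5, e6⟩ := List.cons.inj h0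
    constructor
    · intro hn; exact absurd (by rw [e5]; exact ((h1.trans (e6 ▸ List.Perm.refl _)).trans h2).cons _) hn
    · intro e
      obtain ⟨e7, e8⟩ := List.cons.inj e
      have ptm : ϖ t ∈ HA K T (m+1) := l3 ▸ h.pp_mem t
      obtain ⟨c', hc'⟩ := (ih (a * ϖ t * b) (mul_mem (mul_mem ha ptm) hb) w w hw.2 hw.2 l1 l1).2
      refine ⟨c * c', ?_⟩
      have k1 := (h.aeval_comm (le_refl (m+1)) ha (ee q t r)).eq
      have k2 := (h.aeval_comm (le_refl (m+1)) (l1 ▸ h.pp_mem w) (ee q t r)).eq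
      rw [← e8, h.pp_cons' t r, h.pp_cons' w r, l3, l1, ee_perm h1, ← smul_smul, ← mul_smul_comm c', ← hc']
      generalize aeval (JM q T (m+1)) (ee q t r) = E at *
      rw [mul_smul_comm, smul_mul_assoc, smul_mul_assoc]
      congr 1
      calc _ = ϖ w * (a * E) * ϖ t * b * ϖ w := by noncomm_ring
        _ = (ϖ w * E) * a * ϖ t * b * ϖ w := by rw [← k1]; noncomm_ring
        _ = _ := by rw [← k2]; noncomm_ring
  · obtain ⟨e5, e6⟩ := List.cons.inj h3
    constructor
    · intro hn
      refine absurd ?_ hn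
      rw [e5]
      exact (h1.cons j).trans ((e6 ▸ List.Perm.swap _ _ _ : (j :: t).Perm (r' :: j :: v')).trans (h2.cons r'))
    · intro e
      exact absurd ((List.cons.inj e).1.symm.trans e5) h0
lemma Cthm (n : ℕ) : ∀ x ∈ HA K T n, ∀ w w', Std w → Std w' → w.length = n → w'.length = n →
    ((¬ w.Perm w' → ϖ w * x * ϖ w' = 0) ∧ ∃ c : K, ϖ w * x * ϖ w = c • ϖ w) := by
  induction n with
  | zero =>
    intro x hx w w' hw hw' hl hl'
    obtain ⟨c, rfl⟩ := HA_small (by omega) hx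
    have := List.length_eq_zero_iff.1 hl; subst this
    have := List.length_eq_zero_iff.1 hl'; subst this
    exact ⟨fun e => absurd (List.Perm.refl _) e, c, by simp [pp]⟩
  | succ n ih =>
    have key : ∀ a ∈ HA K T n, ∀ w w', Std w → Std w' → w.length = n+1 → w'.length = n+1 →
        ((¬ w.Perm w' → ϖ w * a * ϖ w' = 0) ∧
          ∃ c : K, ϖ w * a * ϖ w = c • ϖ w) := by
      intro a ha w w' hw hw' hl hl'
      match w, w' with
      | [], _ => simp at hl
      | _, [] => simp at hl'
      | r :: w, r' :: w' =>
        have l1 : w.length = n := by simpa using hl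
        have l2 : w'.length = n := by simpa using hl'
        obtain ⟨i1, c, i2⟩ := ih a ha w w' hw.2 hw'.2 l1 l2
        have cE : aeval (JM q T w.length) (ee q w r) * a = a * aeval (JM q T w.length) (ee q w r) :=
          (h.aeval_comm l1.ge ha _).eq
        constructor
        · intro hnp
          by_cases hp : w.Perm w'
          · have hne : r ≠ r' := fun e => hnp (by rw [e]; exact hp.cons _)
            have : aeval (JM q T w.length) (ee q w r) * ϖ (r' :: w') = 0 := by
              rw [hp.length_eq, ee_perm hp, aeval_eig (h.pp_eig hw' (h.good hw'.2).kl), ee,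
                Lagrange.eval_basis_of_ne hne hw'.1, zero_smul]
            rw [pp, mul_assoc, mul_assoc, ← mul_assoc _ a, cE, mul_assoc a, this]; simp
          · rw [h.pp_cons', pp, ← mul_assoc, mul_assoc _ _ a, mul_assoc _ _ (ϖ w'), i1 hp]; simp
        · refine ⟨c, ?_⟩
          rw [h.pp_cons' w r, mul_assoc _ _ a, mul_assoc, ← h.pp_cons' w r, pp, ← mul_assoc (_ * a), i2,
            smul_mul_assoc, mul_smul_comm]
          have := h.pp_e hw (h.good hw.2).kl
          rw [pp] at this; rw [this]
    match n, ih, key with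
    | 0, ih, key =>
      intro x hx w w' hw hw' hl hl'
      obtain ⟨c, rfl⟩ := HA_small (by omega) hx
      exact key _ (Subalgebra.smul_mem _ (one_mem _) _) w w' hw hw' hl hl'
    | m+1, ih, key =>
      intro x hx
      have := h.HA_dec hx
      clear hx
      induction this using Submodule.span_induction with
      | mem x hx' =>
        rcases hx' with hx' | ⟨a, b, ha, hb, rfl⟩
        · exact key x hx'
        have one : ∑ t ∈ PathsF [] (m+1), ϖ t = 1 := h.paths_sum (v := []) trivial _
        have exp : ∀ r w r' w', ϖ (r :: w) * (a * T m * b) * ϖ (r' :: w') =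
            ∑ t ∈ PathsF [] (m+1), ∑ t' ∈ PathsF [] (m+1),
              (ϖ (r :: w) * a * ϖ t) * T m * (ϖ t' * b * ϖ (r' :: w')) := by
          intro r w r' w'
          calc _ = (ϖ (r :: w) * a * ∑ t ∈ PathsF [] (m+1), ϖ t) * T m *
              ((∑ t' ∈ PathsF [] (m+1), ϖ t') * b * ϖ (r' :: w')) := by
                rw [one]; noncomm_ring
            _ = _ := by
                simp only [mul_sum, sum_mul]
                rw [sum_comm]
        intro w w' hw hw' hl hl'
        match w, w' with
        | [], _ => simp at hl
        | _, [] => simp at hl'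
        | r :: w, r' :: w' =>
        have l1 : w.length = m+1 := by simpa using hl
        have l2 : w'.length = m+1 := by simpa using hl'
        constructor
        · intro hnp
          rw [exp]
          refine sum_eq_zero fun t ht => sum_eq_zero fun t' ht' => ?_
          obtain ⟨s1, s2⟩ := PathsF_std (v := []) trivial ht
          obtain ⟨s1', s2'⟩ := PathsF_std (v := []) trivial ht'
          exact (h.Cterm ih ha hb hw hw' l1 l2 s1 s1' (by simpa using s2) (by simpa using s2')).1 hnp
        · rw [exp]
          refine sum_scal fun t ht => sum_scal fun t' ht' => ?_
          obtain ⟨s1, s2⟩ := PathsF_std (v := []) trivial ht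
          obtain ⟨s1', s2'⟩ := PathsF_std (v := []) trivial ht'
          exact (h.Cterm ih ha hb hw hw l1 l1 s1 s1' (by simpa using s2) (by simpa using s2')).2 rfl
      | zero => intro w w' _ _ _ _; exact ⟨fun _ => by simp, 0, by simp⟩
      | add x y h1 h2 hx hy =>
        intro w w' s s' l l'
        obtain ⟨a1, c1, b1⟩ := hx w w' s s' l l'
        obtain ⟨a2, c2, b2⟩ := hy w w' s s' l l'
        exact ⟨fun e => by rw [mul_add, add_mul, a1 e, a2 e, add_zero], c1 + c2, by
          rw [mul_add, add_mul, b1, b2, add_smul]⟩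
      | smul c x h1 hx =>
        intro w w' s s' l l'
        obtain ⟨a1, c1, b1⟩ := hx w w' s s' l l'
        exact ⟨fun e => by rw [mul_smul_comm, smul_mul_assoc, a1 e, smul_zero], c * c1, by
          rw [mul_smul_comm, smul_mul_assoc, b1, smul_smul]⟩
end HK
abbrev row (l : ℕ) : List ℕ := List.replicate l 0
lemma row_std (l : ℕ) : Std (row l) := by
  induction l with
  | zero => trivial
  | succ l ih => exact Std.cons_of_rem ih (Or.inl rfl)
lemma perm_row {l : ℕ} {t : List ℕ} (hp : (row l).Perm t) : t = row l := by
  have := List.perm_replicate.1 hp.symm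
  exact this
structure SY (q : K) (T : ℕ → B) (n : ℕ) (s : ℕ → B) : Prop where
  s0 : s 0 = 1
  s1 : s 1 = 1
  mem : ∀ l, s l ∈ HA K T (n+l)
  comm : ∀ l, ∀ x ∈ HA K T n, Commute (s l) x
  sT : ∀ l i, i + 2 ≤ l → s l * T (n+i) = q • s l
  Ts : ∀ l i, i + 2 ≤ l → T (n+i) * s l = q • s l
  far : ∀ l j, l ≤ j → Commute (s l) (T (n+j))
  rc : ∀ l, ∃ κ : K, q - κ ≠ 0 ∧ (q - κ) • s (l+2) = s (l+1) * T (n+l) * s (l+1) - κ • s (l+1)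
lemma SY.ss {n : ℕ} {s : ℕ → B} (S : SY q T n s) (l : ℕ) : ∀ k ≤ l, s l * s k = s l ∧ s k * s l = s l
  | 0, _ => by simp [S.s0]
  | 1, _ => by simp [S.s1]
  | k+2, hk => by
    obtain ⟨κ, h1, h2⟩ := S.rc k
    obtain ⟨a, b⟩ := SY.ss S l (k+1) (by omega)
    have e : s (k+2) = (q-κ)⁻¹ • (s (k+1) * T (n+k) * s (k+1) - κ • s (k+1)) := by
      rw [← h2, smul_smul, inv_mul_cancel₀ h1, one_smul]
    rw [e]
    constructor
    · rw [mul_smul_comm, mul_sub, ← mul_assoc, ← mul_assoc, a, S.sT l k hk, smul_mul_assoc, a, mul_smul_comm, a,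
        ← sub_smul, smul_smul, inv_mul_cancel₀ h1, one_smul]
    · rw [smul_mul_assoc, sub_mul, mul_assoc, mul_assoc, b, S.Ts l k hk, mul_smul_comm, b, smul_mul_assoc, b,
        ← sub_smul, smul_smul, inv_mul_cancel₀ h1, one_smul]
lemma HA_shift {n l : ℕ} {x : B} (hx : x ∈ HA K (fun i => T (n+i)) l) : x ∈ HA K T (n+l) :=
  HA_induction (P := fun x => x ∈ HA K T (n+l)) (fun i hi => HA_T (by omega))
    (fun r => Subalgebra.algebraMap_mem _ r) (fun _ _ => add_mem) (fun _ _ _ _ => mul_mem) hx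
lemma path_exists {v : List ℕ} (hv : Std v) : ∀ (k : ℕ) (w : List ℕ), Std w → (∀ r, v.count r ≤ w.count r) →
    w.length = v.length + k → ∃ t ∈ PathsF v k, w.Perm t := by
  intro k
  induction k with
  | zero =>
    intro w hw hc hl
    refine ⟨v, by simp [PathsF], ?_⟩
    exact ((List.subperm_ext_iff.2 fun r _ => hc r).perm_of_length_le (by omega)).symm
  | succ k ih =>
    intro w hw hc hl
    have ex : ∃ r, v.count r < w.count r := by
      by_contra hcon
      push Not at hcon
      have : w.Perm v := List.perm_iff_count.2 fun r => le_antisymm (hcon r) (hc r)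
      have := this.length_eq; omega
    have bd : ∀ r, v.count r < w.count r → r ≤ w.length := fun r hr =>
      (hw.lt r (List.count_pos_iff.1 (by omega))).le
    classical
    let R := Nat.findGreatest (fun r => v.count r < w.count r) w.length
    obtain ⟨r0, hr0⟩ := ex
    have hR : v.count R < w.count R := Nat.findGreatest_spec (P := fun r => v.count r < w.count r) (bd r0 hr0) hr0
    have hR1 : ¬ v.count (R+1) < w.count (R+1) := fun hh =>
      Nat.findGreatest_is_greatest (P := fun r => v.count r < w.count r) (Nat.lt_succ_self _) (bd _ hh) hh
    have := hv.le (show R ≤ R+1 by omega)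
    obtain ⟨w', s', p'⟩ := hw.corner (i := R) (by omega)
    obtain ⟨t, ht, pt⟩ := ih w' s'.2 (fun r => by
      have h1 := p'.count_eq r
      rw [cnt_cons] at h1
      have h2 := hc r
      split_ifs at h1 with e
      · subst e; omega
      · omega) (by have := p'.length_eq; simp at this; omega)
    exact ⟨R :: t, mem_PathsF_succ.2 ⟨R, t, rfl, ht, by rw [← AddR_perm pt]; exact s'.1⟩, p'.trans (pt.cons R)⟩
lemma PathsF_count {v : List ℕ} {k : ℕ} {w : List ℕ} (hw : w ∈ PathsF v k) (r : ℕ) : v.count r ≤ w.count r := by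
  obtain ⟨s, rfl, -⟩ := PathsF_app hw
  simp
namespace HK
variable (h : HK q T)
include h
lemma shift (n : ℕ) : HK q (fun i => T (n+i)) where
  q0 := h.q0
  qn := h.qn
  quad i := h.quad _
  braid i := h.braid _
  far i j hij := h.far _ _ (by omega)
lemma pp_pre {w s : List ℕ} (hw : Std (s ++ w)) : ϖ w * ϖ (s ++ w) = ϖ (s ++ w) ∧
    ϖ (s ++ w) * ϖ w = ϖ (s ++ w) := by
  induction s with
  | nil => exact ⟨h.pp_id hw, h.pp_id hw⟩
  | cons r s ih =>
    have hw2 : Std (s ++ w) := hw.2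
    have g := h.good hw2
    have a := h.pp_sub hw2 g r
    have b := h.pp_sub' hw2 g r
    rw [List.cons_append]
    exact ⟨by rw [← a, ← mul_assoc, (ih hw2).1], by rw [← b, mul_assoc, (ih hw2).2]⟩
lemma PT_sum {m : ℕ} {t : List ℕ} (ht : Std t) (hl : t.length = m+2) :
    ϖ t * T m = ∑ t' ∈ PathsF [] (m+2), ϖ t * T m * ϖ t' := by
  rw [← mul_sum, h.paths_sum (v := []) trivial]
  simp [pp]
lemma row_T {l i : ℕ} (hi : i + 2 ≤ l) : T i * ϖ (row l) = q • ϖ (row l) := by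
  obtain ⟨k, rfl⟩ : ∃ k, l = k + (i+2) := ⟨l - (i+2), by omega⟩
  have e : row (k + (i+2)) = row k ++ row (i+2) := List.replicate_add _ _ _
  have := h.pp_pre (s := row k) (w := row (i+2)) (by rw [← e]; exact row_std _)
  rw [← e] at this
  rw [← this.1, ← mul_assoc]
  have := h.TPdec (v := row i) (j := 0) (r := 0) (row_std (i+2))
  simp only [ne_eq, not_true_eq_false, false_and, false_or, if_true, List.length_replicate] at this
  have t2 : T i * ϖ (row (i+2)) = q • ϖ (row (i+2)) := this.2
  rw [t2, smul_mul_assoc]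
lemma row_T' {l i : ℕ} (hi : i + 2 ≤ l) : ϖ (row l) * T i = q • ϖ (row l) := by
  have one : ∑ t ∈ PathsF [] l, ϖ t = 1 := h.paths_sum (v := []) trivial _
  have hl : (row l).length = l := List.length_replicate
  have : ϖ (row l) * T i = ∑ t ∈ PathsF [] l, ϖ (row l) * T i * ϖ t := by
    rw [← mul_sum, one, mul_one]
  rw [this, sum_eq_single (row l)]
  · rw [mul_assoc, h.row_T hi, mul_smul_comm, h.pp_id (row_std l)]
  · intro t ht hne
    obtain ⟨a, b⟩ := PathsF_std (v := []) trivial ht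
    exact (h.Cthm l (T i) (HA_T hi) (row l) t (row_std l) a hl (by simpa using b)).1 fun hp => hne (perm_row hp)
  · intro hn
    exact absurd (by have := PathsF_nil (row_std l); rwa [hl] at this) hn
lemma row_rec (l : ℕ) : ∃ κ : K, q - κ ≠ 0 ∧ (q - κ) • ϖ (row (l+2)) =
    ϖ (row (l+1)) * T l * ϖ (row (l+1)) - κ • ϖ (row (l+1)) := by
  have hl : (row l).length = l := List.length_replicate
  have hl1 : (row (l+1)).length = l+1 := List.length_replicate
  have c0 : ∀ k, (row k).count 0 = k := fun k => by simp
  have c1 : ∀ k, (row k).count 1 = 0 := fun k => by simp [List.count_replicate]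
  have st : Std (1 :: row (l+1)) := Std.cons_of_rem (row_std _) (Or.inr (by simp [List.count_replicate]))
  have sm : ϖ (row (l+1)) = ϖ (row (l+2)) + ϖ (1 :: row (l+1)) := by
    rw [← h.pp_sum (row_std (l+1))]
    have : AddR (row (l+1)) = {0, 1} := by
      ext r
      rw [(row_std _).mem_iff]
      simp only [Finset.mem_insert, Finset.mem_singleton, List.count_replicate]
      rcases r with _ | _ | r <;> simp
    rw [this, Finset.sum_pair (by norm_num)]; rfl
  have aux : ∃ κ : K, q - κ ≠ 0 ∧ ϖ (1 :: row (l+1)) * T l * ϖ (1 :: row (l+1)) = κ • ϖ (1 :: row (l+1)) := by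
    rcases h.TPdec (v := row l) (j := 0) (r := 1) st with ⟨h1, h2, h3⟩ | ⟨h1, h2⟩
    · refine ⟨(q - 1) * zz q (row l) 1 / (zz q (row l) 1 - zz q (row l) 0), ?_, ?_⟩
      rotate_left
      · rw [hl] at h3
        have o : ϖ (1 :: row (l+1)) * ϖ (0 :: 1 :: row l) = 0 :=
          h.pp_orth st (h2.sw (row_std (l+1)) (by norm_num)) (by simp) (by simp)
        rw [mul_assoc]
        change _ * (T l * ϖ (1 :: 0 :: row l)) = _
        rw [h3, mul_add, ← mul_assoc, ← mul_assoc]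
        change ϖ (1 :: row (l+1)) * ϖ (0 :: 1 :: row l) * _ * _ + _ = _
        rw [o, mul_smul_comm]
        change 0 * _ * _ + _ • (ϖ (1 :: row (l+1)) * ϖ (1 :: row (l+1))) = _
        rw [h.pp_id st]; simp
      · obtain ⟨f1, f2, f3⟩ := h.sw_far (row_std (l+1)) h2 (by norm_num)
        have q1 := h.q1
        intro e
        have : zz q (row l) 1 - zz q (row l) 0 ≠ 0 := sub_ne_zero.2 (Ne.symm f1)
        field_simp at e
        apply f2
        linear_combination e
    · refine ⟨-1, ?_, ?_⟩
      · have := h.qq1; intro e; apply this; linear_combination e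
      · rw [hl] at h2
        have h2' : T l * ϖ (1 :: row (l+1)) = (-1 : K) • ϖ (1 :: row (l+1)) := h2
        rw [mul_assoc, h2', mul_smul_comm, h.pp_id st]
  obtain ⟨κ, k1, k2⟩ := aux
  refine ⟨κ, k1, ?_⟩
  have o1 : ϖ (row (l+2)) * ϖ (1 :: row (l+1)) = 0 :=
    h.pp_orth (row_std _) st (by simp) (by simp [row, List.replicate_succ])
  have o2 : ϖ (1 :: row (l+1)) * ϖ (row (l+2)) = 0 :=
    h.pp_orth st (row_std _) (by simp) (by simp [row, List.replicate_succ])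
  rw [sm, add_mul, add_mul, mul_add, mul_add, k2, h.row_T' le_rfl, mul_assoc _ (T l) (ϖ (row (l+2))), h.row_T le_rfl]
  simp only [smul_mul_assoc, mul_smul_comm, o1, o2, h.pp_id (row_std (l+2))]
  module
lemma SYrow (n : ℕ) : SY q T n (fun l => pp q (fun i => T (n+i)) (row l)) where
  s0 := rfl
  s1 := by
    have := (h.shift n).pp_sum (w := []) trivial
    have e : AddR [] = {0} := by ext r; simp [AddR]
    rw [e, Finset.sum_singleton] at this
    exact this
  mem l := HA_shift (by
    have := (h.shift n).pp_mem (row l)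
    simpa using this)
  comm l x hx := by
    have := (h.shift n).pp_mem (row l)
    exact (HA_comm (y := x) (fun i hi => (h.T_comm (by omega) hx).symm) this).symm
  sT l i hi := (h.shift n).row_T' hi
  Ts l i hi := (h.shift n).row_T hi
  far l j hj := by
    have := (h.shift n).pp_mem (row l)
    exact ((h.shift n).T_comm (m := j) (by simpa using hj) this).symm
  rc l := (h.shift n).row_rec l
end HK
structure RR (T : ℕ → B) (N : ℕ) (s p p' u u' : B) (c : K) : Prop where
  m : u ∈ HA K T N
  m' : u' ∈ HA K T N
  uu' : u * u' = p
  u'u : u' * u = p'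
  pu : p * u = u
  up : u * p' = u
  pu' : p' * u' = u'
  up' : u' * p = u'
  c0 : c ≠ 0
  su : s * u = s * p'
  us : u' * s = c • (p' * s)
lemma RR.trans {N : ℕ} {s p p' p'' u u' w w' : B} {c d : K} (h : RR T N s p p' u u' c)
    (g : RR T N s p' p'' w w' d) : RR T N s p p'' (u * w) (w' * u') (c * d) where
  m := mul_mem h.m g.m
  m' := mul_mem g.m' h.m'
  uu' := by rw [mul_assoc, ← mul_assoc w, g.uu', ← mul_assoc, h.up, h.uu']
  u'u := by rw [mul_assoc, ← mul_assoc u', h.u'u, g.pu, g.u'u]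
  pu := by rw [← mul_assoc, h.pu]
  up := by rw [mul_assoc, g.up]
  pu' := by rw [← mul_assoc, g.pu']
  up' := by rw [mul_assoc, h.up']
  c0 := mul_ne_zero h.c0 g.c0
  su := by rw [← mul_assoc, h.su, mul_assoc, g.pu, g.su]
  us := by rw [mul_assoc, h.us, mul_smul_comm, ← mul_assoc, g.up', g.us, smul_smul]
namespace HK
variable (h : HK q T)
include h
lemma sw_PT {v : List ℕ} {r r' : ℕ} (hr : Std (r :: v)) (hr' : Std (r' :: v)) (hne : r ≠ r') :
    ϖ (r' :: r :: v) * T v.length * ϖ (r :: r' :: v) =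
      ϖ (r' :: r :: v) * T v.length -
        ((q-1)*zz q v r'/(zz q v r'-zz q v r)) • ϖ (r' :: r :: v) := by
  have sy := hr.sw hr' hne
  have sx := hr'.sw hr hne.symm
  have e1 : ϖ (r' :: r :: v) * T v.length * ϖ (r' :: r :: v) =
      ((q-1)*zz q v r'/(zz q v r'-zz q v r)) • ϖ (r' :: r :: v) := by
    have := h.sw_TP hr hr' hne (h.good hr)
    simp only at this
    rw [eq_sub_iff_add_eq] at this
    rw [mul_assoc, ← this, mul_add, mul_smul_comm, h.pp_id sy, ← mul_assoc, ← mul_assoc,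
      h.sw_ne hr hr' hne (h.good hr.2)]; simp
  have e2 := h.PT_sum (m := v.length) sy rfl
  have mx : (r :: r' :: v) ∈ PathsF [] (v.length+2) := PathsF_nil sx
  have my : (r' :: r :: v) ∈ PathsF [] (v.length+2) := PathsF_nil sy
  rw [← Finset.sum_subset (s₁ := {r' :: r :: v, r :: r' :: v}), Finset.sum_pair, e1] at e2
  · exact (sub_eq_of_eq_add' e2).symm
  · simp [hne.symm]
  · intro t ht; simp at ht; rcases ht with rfl | rfl <;> assumption
  · intro t ht hn
    obtain ⟨a, b⟩ := PathsF_std (v := []) trivial ht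
    match t, a, b with
    | x :: j :: v', a, b =>
      have hl : v'.length = v.length := by simpa using b
      rcases h.PTP sy a (by simp [hl]) with h1 | ⟨h1, -⟩ | ⟨h1, h2⟩
      · rw [← hl]; exact h1
      · simp [h1] at hn
      · simp at h2
        obtain ⟨rfl, rfl, rfl⟩ := h2
        simp at hn
    | [x], a, b => simp at b
lemma RR_refl {w : List ℕ} (hw : Std w) (s : B) {N : ℕ} (hN : w.length = N) :
    RR T N s (ϖ w) (ϖ w) (ϖ w) (ϖ w) (1:K) := by
  have i := h.pp_id hw
  have m := h.pp_mem w
  rw [hN] at m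
  exact ⟨m, m, i, i, i, i, i, i, one_ne_zero, rfl, by rw [one_smul]⟩
lemma RR_cons {n l : ℕ} {s : ℕ → B} (S : SY q T n s) {w w' : List ℕ} {r : ℕ} (hw : Std (r :: w))
    (hw' : Std (r :: w')) (hl : w.length = n + l) (hp : w.Perm w') {u u' : B} {c : K}
    (H : RR T (n+l) (s l) (ϖ w) (ϖ w') u u' c) :
    ∃ U U', (U = u * aeval (JM q T (n+l)) (ee q w r) ∧ U' = aeval (JM q T (n+l)) (ee q w r) * u') ∧
      RR T (n+(l+1)) (s (l+1)) (ϖ (r :: w)) (ϖ (r :: w')) U U' c := by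
  refine ⟨_, _, ⟨rfl, rfl⟩, ?_⟩
  have hl' : w'.length = n + l := by rw [← hp.length_eq, hl]
  have mE : aeval (JM q T (n+l)) (ee q w r) ∈ HA K T (n+(l+1)) := h.aeval_mem (by omega) _
  have k1 := (h.aeval_comm le_rfl H.m (ee q w r)).eq
  have k2 := (h.aeval_comm le_rfl H.m' (ee q w r)).eq
  have e1 : ϖ (r :: w) = aeval (JM q T (n+l)) (ee q w r) * ϖ w := by rw [h.pp_cons', hl]
  have e2 : ϖ (r :: w') = aeval (JM q T (n+l)) (ee q w r) * ϖ w' := by rw [h.pp_cons', hl', ee_perm hp]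
  have i1 : aeval (JM q T (n+l)) (ee q w r) * ϖ (r :: w) = ϖ (r :: w) := by
    have := h.pp_e hw (h.good hw.2).kl
    rwa [hl] at this
  have i2 : aeval (JM q T (n+l)) (ee q w r) * ϖ (r :: w') = ϖ (r :: w') := by
    have := h.pp_e hw' (h.good hw'.2).kl
    rwa [hl', ← ee_perm hp] at this
  have a1 := S.ss (l+1) l (by omega)
  have mu := HA_mono (show n + l ≤ n + (l+1) by omega) H.m
  have mu' := HA_mono (show n + l ≤ n + (l+1) by omega) H.m'
  obtain ⟨-, -, uu', u'u, pu, up, pu', up', c0, su, us⟩ := H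
  rw [e1] at i1
  rw [e2] at i2
  have kp : aeval (JM q T (n+l)) (ee q w r) * ϖ w = ϖ w * aeval (JM q T (n+l)) (ee q w r) := by
    rw [← e1, pp, hl]
  have kp' : aeval (JM q T (n+l)) (ee q w r) * ϖ w' = ϖ w' * aeval (JM q T (n+l)) (ee q w r) := by
    rw [← e2, pp, hl', ee_perm hp]
  rw [e1, e2]
  generalize aeval (JM q T (n+l)) (ee q w r) = E at *
  generalize ϖ w = p at *
  generalize ϖ w' = p' at *
  have EEu : E * (E * u) = E * u := by rw [← pu, ← mul_assoc E p u, ← mul_assoc, i1]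
  have EEu' : E * (E * u') = E * u' := by rw [← pu', ← mul_assoc E p' u', ← mul_assoc, i2]
  have k1x : ∀ x, u * (E * x) = E * (u * x) := fun x => by rw [← mul_assoc, ← k1, mul_assoc]
  have k2x : ∀ x, u' * (E * x) = E * (u' * x) := fun x => by rw [← mul_assoc, ← k2, mul_assoc]
  have kpx : ∀ x, p * (E * x) = E * (p * x) := fun x => by rw [← mul_assoc, ← kp, mul_assoc]
  have kpx' : ∀ x, p' * (E * x) = E * (p' * x) := fun x => by rw [← mul_assoc, ← kp', mul_assoc]
  constructor
  · exact mul_mem mu mE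
  · exact mul_mem mE mu'
  · rw [mul_assoc, k1x, k1x, uu', i1]
  · rw [← k1, mul_assoc, k2x, u'u, i2]
  · rw [mul_assoc, ← k1, kpx, pu, EEu]
  · rw [mul_assoc, k1x, k1x, up, EEu, k1]
  · rw [mul_assoc, kpx', pu', EEu']
  · rw [mul_assoc, k2x, up', EEu']
  · exact c0
  · conv_lhs => rw [← a1.1]
    conv_rhs => rw [← a1.1]
    rw [mul_assoc, ← mul_assoc (s l) u, su, mul_assoc, mul_assoc, kp']
  · conv_lhs => rw [← a1.2]
    conv_rhs => rw [← a1.2]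
    rw [mul_assoc, ← mul_assoc u', us, smul_mul_assoc, mul_smul_comm]; simp only [mul_assoc]
lemma RR_sw {n l : ℕ} {s : ℕ → B} (S : SY q T n s) {v : List ℕ} {r r' : ℕ} (hr : Std (r :: v))
    (hr' : Std (r' :: v)) (hne : r ≠ r') (hl : v.length = n + l) :
    ∃ u u', ∃ c : K, RR T (n+(l+2)) (s (l+2)) (ϖ (r :: r' :: v)) (ϖ (r' :: r :: v)) u u' c := by
  obtain ⟨f1, f2, f3⟩ := h.sw_far hr hr' hne
  have g := h.good hr
  have g' := h.good hr'
  have s1 := h.sw_PTP hr hr' hne g g'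
  have s2 := h.sw_PTP hr' hr hne.symm g' g
  have k0 := h.kap f1 f2 f3
  have b1 := h.sw_PT hr hr' hne
  have b2 := h.sw_TP hr hr' hne g
  simp only at s1 s2 b2
  rw [mul_comm ((q-1)*zz q v r/(zz q v r-zz q v r'))] at s2
  have sy := hr.sw hr' hne
  have sx := hr'.sw hr hne.symm
  have iy := h.pp_id sy
  have ix := h.pp_id sx
  have my : ϖ (r' :: r :: v) ∈ HA K T (n+(l+2)) := by
    have := h.pp_mem (r' :: r :: v)
    rwa [show (r' :: r :: v).length = n+(l+2) by simp [hl]; omega] at this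
  have mx : ϖ (r :: r' :: v) ∈ HA K T (n+(l+2)) := by
    have := h.pp_mem (r :: r' :: v)
    rwa [show (r :: r' :: v).length = n+(l+2) by simp [hl]; omega] at this
  have mT : T (n+l) ∈ HA K T (n+(l+2)) := HA_T (by omega)
  have sT := S.sT (l+2) l le_rfl
  have Ts := S.Ts (l+2) l le_rfl
  rw [hl] at *
  have q1 := h.q1
  have a0 : q - (q-1)*zz q v r'/(zz q v r'-zz q v r) ≠ 0 := by
    intro e
    have : zz q v r' - zz q v r ≠ 0 := sub_ne_zero.2 (Ne.symm f1)
    field_simp at e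
    apply f2
    linear_combination e
  set k := q + (q-1)*zz q v r'/(zz q v r'-zz q v r) * ((q-1)*zz q v r/(zz q v r-zz q v r'))
  set a := (q-1)*zz q v r'/(zz q v r'-zz q v r)
  set P := ϖ (r' :: r :: v)
  set P' := ϖ (r :: r' :: v)
  refine ⟨(q-a)⁻¹ • (P' * T (n+l) * P), ((q-a) * k⁻¹) • (P * T (n+l) * P'), (q-a)*k⁻¹*(q-a),
    Subalgebra.smul_mem _ (mul_mem (mul_mem mx mT) my) _, Subalgebra.smul_mem _ (mul_mem (mul_mem my mT) mx) _,
    ?_, ?_, ?_, ?_, ?_, ?_, mul_ne_zero (mul_ne_zero a0 (inv_ne_zero k0)) a0, ?_, ?_⟩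
  · rw [smul_mul_smul_comm, s2, smul_smul]
    rw [show (q-a)⁻¹ * ((q-a)*k⁻¹) * k = 1 by field_simp, one_smul]
  · rw [smul_mul_smul_comm, s1, smul_smul]
    rw [show ((q-a)*k⁻¹) * (q-a)⁻¹ * k = 1 by field_simp, one_smul]
  · rw [mul_smul_comm, ← mul_assoc, ← mul_assoc, ix]
  · rw [smul_mul_assoc, mul_assoc, iy]
  · rw [mul_smul_comm, ← mul_assoc, ← mul_assoc, iy]
  · rw [smul_mul_assoc, mul_assoc, ix]
  · rw [mul_smul_comm, b2, mul_sub, ← mul_assoc, sT, mul_smul_comm, smul_mul_assoc, ← sub_smul, smul_smul,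
      inv_mul_cancel₀ a0, one_smul]
  · rw [smul_mul_assoc, b1, sub_mul (P * T (n+l)), mul_assoc P, Ts, mul_smul_comm, smul_mul_assoc, ← sub_smul, smul_smul]
lemma R1 {n : ℕ} {s : ℕ → B} (S : SY q T n s) {v : List ℕ} (hv : Std v) (hl : v.length = n) (l : ℕ) :
    ∀ t ∈ PathsF v l, ∀ t' ∈ PathsF v l, t.Perm t' → ∃ u u', ∃ c : K,
      RR T (n+l) (s l) (ϖ t) (ϖ t') u u' c := by
  induction l with
  | zero =>
    intro t ht t' ht' _
    simp [PathsF] at ht ht'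
    subst ht ht'
    exact ⟨_, _, _, h.RR_refl hv _ hl⟩
  | succ l ih =>
    have con : ∀ r w w', w ∈ PathsF v l → w' ∈ PathsF v l → w.Perm w' → Std (r :: w) → ∃ u u', ∃ c : K,
        RR T (n+(l+1)) (s (l+1)) (ϖ (r :: w)) (ϖ (r :: w')) u u' c := by
      intro r w w' hw hw' hp hs
      obtain ⟨u, u', c, H⟩ := ih w hw w' hw' hp
      obtain ⟨U, U', -, H'⟩ := h.RR_cons S hs ⟨by rw [← AddR_perm hp]; exact hs.1, (PathsF_std hv hw').1⟩
        (by rw [(PathsF_std hv hw).2, hl]) hp H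
      exact ⟨U, U', c, H'⟩
    intro t ht t' ht' hp
    have sst := (PathsF_std hv ht).1
    have sst' := (PathsF_std hv ht').1
    obtain ⟨r, w, rfl, hw, hr⟩ := mem_PathsF_succ.1 ht
    obtain ⟨r', w', rfl, hw', hr'⟩ := mem_PathsF_succ.1 ht'
    by_cases hne : r = r'
    · subst hne
      exact con r w w' hw hw' ((List.perm_cons r).1 hp) sst
    · obtain ⟨z, z1, z2, z3, z4⟩ := sst.two sst' hp hne
      have lw := (PathsF_std hv hw).2
      match l, lw, hw, hw', con with
      | 0, lw, hw, hw', _ =>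
        simp [PathsF] at hw hw'
        subst hw hw'
        have := List.perm_iff_count.1 hp r
        simp [cnt_cons, Ne.symm hne] at this
      | l+1, lw, hw, hw', con =>
      have lz := z3.length_eq
      obtain ⟨y, hy, py⟩ := path_exists hv l z z1.2 (fun x => by
          have a1 := z3.count_eq x
          have a2 := z4.count_eq x
          rw [cnt_cons] at a1 a2
          have b1 := PathsF_count hw x
          have b2 := PathsF_count hw' x
          split_ifs at a1 a2 <;> omega) (by simp at lz; omega)
      have sy1 : Std (r' :: y) := ⟨by rw [← AddR_perm py]; exact z1.1, (PathsF_std hv hy).1⟩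
      have sy2 : Std (r :: y) := ⟨by rw [← AddR_perm py]; exact z2.1, (PathsF_std hv hy).1⟩
      have m1 : r' :: y ∈ PathsF v (l+1) := mem_PathsF_succ.2 ⟨_, _, rfl, hy, sy1.1⟩
      have m2 : r :: y ∈ PathsF v (l+1) := mem_PathsF_succ.2 ⟨_, _, rfl, hy, sy2.1⟩
      obtain ⟨u1, u1', c1, H1⟩ := con r w (r' :: y) hw m1 (z3.trans (py.cons _)) sst
      obtain ⟨u3, u3', c3, H3⟩ := con r' (r :: y) w' m2 hw' (z4.trans (py.cons _)).symm (sy2.sw sy1 hne)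
      obtain ⟨u2, u2', c2, H2⟩ := h.RR_sw S sy2 sy1 hne (by rw [(PathsF_std hv hy).2, hl])
      exact ⟨_, _, _, (H1.trans H2).trans H3⟩
end HK
def HSt (v t : List ℕ) : Prop := ∀ i, t.count (i+1) ≤ v.count i
def Fil (v : List ℕ) (l : ℕ) (t0 : List ℕ) : Finset (List ℕ) := (PathsF v l).filter fun t => t0.Perm t
lemma mem_Fil {v t0 t : List ℕ} {l : ℕ} : t ∈ Fil v l t0 ↔ t ∈ PathsF v l ∧ t0.Perm t := mem_filter
namespace HK
variable (h : HK q T)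
include h
lemma MM {n : ℕ} {s : ℕ → B} (S : SY q T n s) {v : List ℕ} (hv : Std v) (hl : v.length = n) {l : ℕ}
    {t0 : List ℕ} (ht0 : t0 ∈ PathsF v l) {ρ : K} (hρ : ϖ t0 * s l * ϖ t0 = ρ • ϖ t0)
    {u u' : List ℕ → B} {c : List ℕ → K}
    (H : ∀ t ∈ Fil v l t0, RR T (n+l) (s l) (ϖ t0) (ϖ t) (u t) (u' t) (c t)) :
    s l * ϖ t0 = (ρ * ∑ t ∈ Fil v l t0, (c t)⁻¹) • (s l * ϖ t0) ∧
    ∀ t ∈ Fil v l t0, ϖ t * s l * ϖ t = ((c t)⁻¹ * ρ) • ϖ t := by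
  have ss : s l * s l = s l := (S.ss l l le_rfl).1
  have st0 := PathsF_std hv ht0
  have i0 := h.pp_id st0.1
  constructor
  · have e1 : s l * ϖ t0 = ∑ t ∈ PathsF v l, s l * ϖ t * s l * ϖ t0 := by
      simp only [← mul_sum, ← sum_mul]
      rw [h.paths_sum hv]
      have cv : s l * ϖ v = ϖ v * s l := (S.comm l _ (hl ▸ h.pp_mem v)).eq
      obtain ⟨x, rfl, -⟩ := PathsF_app ht0
      rw [cv, mul_assoc (ϖ v), ss, ← cv, mul_assoc, (h.pp_pre st0.1).1]
    have e2 : ∑ t ∈ PathsF v l, s l * ϖ t * s l * ϖ t0 =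
        ∑ t ∈ Fil v l t0, s l * ϖ t * s l * ϖ t0 := by
      refine (Finset.sum_subset (Finset.filter_subset _ _) fun t ht hn => ?_).symm
      have st := PathsF_std hv ht
      have := (h.Cthm (n+l) (s l) (S.mem l) t t0 st.1 st0.1 (by rw [st.2, hl]) (by rw [st0.2, hl])).1
        fun hp => hn (mem_Fil.2 ⟨ht, hp.symm⟩)
      rw [mul_assoc (s l), mul_assoc, this, mul_zero]
    conv_lhs => rw [e1, e2]
    rw [mul_sum, sum_smul]
    refine sum_congr rfl fun t ht => ?_
    have R := H t ht
    have e3 : s l * ϖ t * s l = (c t)⁻¹ • (s l * ϖ t0 * s l) := by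
      rw [eq_inv_smul_iff₀ R.c0]
      rw [← R.uu', ← mul_assoc, R.su, mul_assoc (s l * ϖ t) (u' t) (s l), R.us]
      rw [mul_smul_comm, mul_assoc (s l) (ϖ t) (_ * _), ← mul_assoc (ϖ t) (ϖ t),
        h.pp_id (PathsF_std hv (mem_Fil.1 ht).1).1, mul_assoc]
    rw [e3, smul_mul_assoc, mul_assoc (s l), mul_assoc (s l), hρ, mul_smul_comm, smul_smul, mul_comm]
  · intro t ht
    have R := H t ht
    have e : c t • (ϖ t * s l * ϖ t) = ρ • ϖ t := by
      calc c t • (ϖ t * s l * ϖ t) = (c t • (ϖ t * s l)) * (s l * ϖ t) := by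
            rw [smul_mul_assoc, mul_assoc (ϖ t) (s l) (s l * _), ← mul_assoc (s l), ss, mul_assoc]
        _ = u' t * s l * (s l * u t) := by rw [R.us, R.su]
        _ = u' t * (ϖ t0 * s l * ϖ t0) * u t := by
            rw [mul_assoc (u' t) (s l), ← mul_assoc (s l) (s l), ss]
            conv_lhs => rw [← R.up', ← R.pu]
            simp only [mul_assoc]
        _ = _ := by rw [hρ, mul_smul_comm, R.up', smul_mul_assoc, R.u'u]
    rw [mul_smul, ← e, inv_smul_smul₀ R.c0]
lemma rho {n : ℕ} {s : ℕ → B} (S : SY q T n s) {v : List ℕ} (hv : Std v) (hl : v.length = n) {l : ℕ}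
    {t : List ℕ} (ht : t ∈ PathsF v l) : ∃ ρ : K, ϖ t * s l * ϖ t = ρ • ϖ t := by
  have st := PathsF_std hv ht
  exact (h.Cthm (n+l) (s l) (S.mem l) t t st.1 st.1 (by rw [st.2, hl]) (by rw [st.2, hl])).2
lemma fam {n : ℕ} {s : ℕ → B} (S : SY q T n s) {v : List ℕ} (hv : Std v) (hl : v.length = n) {l : ℕ}
    {t0 : List ℕ} (ht0 : t0 ∈ PathsF v l) : ∃ (u u' : List ℕ → B) (c : List ℕ → K),
    ∀ t ∈ Fil v l t0, RR T (n+l) (s l) (ϖ t0) (ϖ t) (u t) (u' t) (c t) := by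
  have : ∀ t, ∃ (u u' : B) (c : K), t ∈ Fil v l t0 → RR T (n+l) (s l) (ϖ t0) (ϖ t) u u' c := by
    intro t
    by_cases ht : t ∈ Fil v l t0
    · obtain ⟨u, u', c, H⟩ := h.R1 S hv hl l t0 ht0 t (mem_Fil.1 ht).1 (mem_Fil.1 ht).2
      exact ⟨u, u', c, fun _ => H⟩
    · exact ⟨0, 0, 0, fun e => absurd e ht⟩
  choose u u' c H using this
  exact ⟨u, u', c, H⟩
lemma rho_ne {n : ℕ} {s : ℕ → B} (S : SY q T n s) {v : List ℕ} (hv : Std v) (hl : v.length = n) {l : ℕ}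
    {t : List ℕ} (ht : t ∈ PathsF v l) (hne : s l * ϖ t ≠ 0) {ρ : K}
    (hρ : ϖ t * s l * ϖ t = ρ • ϖ t) : ρ ≠ 0 := by
  obtain ⟨u, u', c, H⟩ := h.fam S hv hl ht
  have := (h.MM S hv hl ht hρ H).1
  rintro rfl
  rw [zero_mul, zero_smul] at this
  exact hne this
lemma trf {n : ℕ} {s : ℕ → B} (S : SY q T n s) {v : List ℕ} (hv : Std v) (hl : v.length = n) {l : ℕ}
    {t t' : List ℕ} (ht : t ∈ PathsF v l) (ht' : t' ∈ PathsF v l) (hp : t.Perm t')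
    (h0 : s l * ϖ t = 0) : s l * ϖ t' = 0 := by
  obtain ⟨u, u', c, R⟩ := h.R1 S hv hl l t ht t' ht' hp
  rw [← R.su, ← R.pu, ← mul_assoc, h0, zero_mul]
lemma trf' {t t' : List ℕ} (ht : Std t) (ht' : Std t') (hp : t.Perm t')
    (h0 : ϖ t = 0) : ϖ t' = 0 := by
  obtain ⟨u, u', -, -, h1, h2, h3, h4, -⟩ := h.eqv ht ht' hp
  rw [← h2, ← h3, h0]; simp
lemma Zsub {n : ℕ} {s : ℕ → B} (S : SY q T n s) {w : List ℕ} (r : ℕ) {l : ℕ}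
    (h0 : s l * ϖ w = 0) : s (l+1) * ϖ (r :: w) = 0 := by
  rw [← (S.ss (l+1) l (by omega)).1, pp, mul_assoc, ← mul_assoc (s l), h0]; simp
lemma Zthm {n : ℕ} {s : ℕ → B} (S : SY q T n s) {v : List ℕ} (hv : Std v) (hl : v.length = n) (l : ℕ) :
    ∀ t ∈ PathsF v l, ¬ HSt v t → s l * ϖ t = 0 := by
  induction l with
  | zero =>
    intro t ht hn
    simp [PathsF] at ht; subst ht
    exact absurd (fun i => hv.le (by omega)) hn
  | succ l ih =>
    intro t ht hn
    unfold HSt at hn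
    push Not at hn
    obtain ⟨i, hi⟩ := hn
    obtain ⟨st, lt⟩ := PathsF_std hv ht
    have remv : ∀ r, v.count r < t.count r → t.count (r+1) < t.count r → ∃ y ∈ PathsF v l,
        r :: y ∈ PathsF v (l+1) ∧ t.Perm (r :: y) ∧ Std (r :: y) := by
      intro r h1 h2
      obtain ⟨w', s', p'⟩ := st.corner h2
      have pl := p'.length_eq
      obtain ⟨y, hy, py⟩ := path_exists hv l w' s'.2 (fun x => by
        have a := p'.count_eq x
        have b := PathsF_count ht x
        rw [cnt_cons] at a
        split_ifs at a with e
        · subst e; omega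
        · omega) (by simp at pl; omega)
      have sy : Std (r :: y) := ⟨by rw [← AddR_perm py]; exact s'.1, (PathsF_std hv hy).1⟩
      exact ⟨y, hy, mem_PathsF_succ.2 ⟨r, y, rfl, hy, sy.1⟩, p'.trans (py.cons r), sy⟩
    by_cases hex : ∃ r, r ≠ i+1 ∧ v.count r < t.count r ∧ t.count (r+1) < t.count r
    · obtain ⟨r, h0, h1, h2⟩ := hex
      obtain ⟨y, hy, my, py, sy⟩ := remv r h1 h2
      refine h.trf S hv hl my ht py.symm (h.Zsub S r (ih y hy fun H => ?_))
      have := H i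
      have a := py.count_eq (i+1)
      rw [cnt_cons, if_neg h0] at a
      omega
    · push Not at hex
      have v1 := hv.le (show i ≤ i+1 by omega)
      have A : t.count (i+2) < t.count (i+1) := by
        by_contra hA
        have : ∀ k, t.count (i+1) ≤ t.count (i+2+k) := by
          intro k
          induction k with
          | zero => simpa using hA
          | succ k ihk =>
            have v2 := hv.le (show i ≤ i+2+k by omega)
            exact ihk.trans (hex (i+2+k) (by omega) (by omega))
        have h3 := this (t.length)
        have : t.count (i+2+t.length) = 0 := List.count_eq_zero.2 fun hm => by
          have := st.lt _ hm; omega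
        omega
      have ti := st.le (show i ≤ i+1 by omega)
      have Bq := hex i (by omega) (by omega)
      obtain ⟨y, hy, my, py, sy⟩ := remv (i+1) (by omega) A
      refine h.trf S hv hl my ht py.symm ?_
      by_cases hy2 : HSt v y
      swap
      · exact h.Zsub S _ (ih y hy hy2)
      have a1 := py.count_eq (i+1)
      have a2 := py.count_eq i
      rw [cnt_cons, if_pos rfl] at a1
      rw [cnt_cons, if_neg (by omega)] at a2
      have a3 := hy2 i
      obtain ⟨w', s', p'⟩ := (PathsF_std hv hy).1.corner (i := i) (by omega)
      have ly := (PathsF_std hv hy).2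
      have lw := p'.length_eq
      match l, ly, hy, my with
      | 0, ly, hy, my => simp [PathsF] at hy; subst hy; omega
      | l+1, ly, hy, my =>
      obtain ⟨z, hz, pz⟩ := path_exists hv l w' s'.2 (fun x => by
        have a := p'.count_eq x
        have b := PathsF_count hy x
        rw [cnt_cons] at a
        split_ifs at a with e
        · subst e; omega
        · omega) (by simp at lw; omega)
      have sz1 : Std (i :: z) := ⟨by rw [← AddR_perm pz]; exact s'.1, (PathsF_std hv hz).1⟩
      have pp1 := p'.trans (pz.cons i)
      have sz : Std ((i+1) :: i :: z) := ⟨by rw [← AddR_perm pp1]; exact sy.1, sz1⟩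
      have mz : (i+1) :: i :: z ∈ PathsF v (l+1+1) :=
        mem_PathsF_succ.2 ⟨_, _, rfl, mem_PathsF_succ.2 ⟨_, _, rfl, hz, sz1.1⟩, sz.1⟩
      refine h.trf S hv hl mz my (pp1.cons _).symm ?_
      have b1 := pp1.count_eq i
      have b2 := pp1.count_eq (i+1)
      rw [cnt_cons, if_pos rfl] at b1
      rw [cnt_cons, if_neg (by omega)] at b2
      rcases h.TPdec sz with ⟨c1, c2, -⟩ | ⟨c1, c2⟩
      · have := (c2.2.mem_iff (i+1)).1 c2.1
        simp at this; omega
      · rw [if_neg (by omega), (PathsF_std hv hz).2, hl] at c2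
        have c3 := congrArg (s (l+1+1) * ·) c2
        simp only [mul_smul_comm] at c3
        rw [← mul_assoc, S.sT (l+2) l le_rfl, smul_mul_assoc] at c3
        have : (1 + q) • (s (l+1+1) * ϖ ((i+1) :: i :: z)) = 0 := by
          rw [add_smul, one_smul, c3]; module
        exact (smul_eq_zero.1 this).resolve_left h.qq1
end HK
namespace HK
variable (h : HK q T)
include h
lemma ins {n : ℕ} {s : ℕ → B} (S : SY q T n s) {v : List ℕ} (hv : Std v) (hl : v.length = n) {l : ℕ}
    {t : List ℕ} (ht : t ∈ PathsF v l) :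
    ϖ t * s l = ∑ w ∈ PathsF v l, ϖ t * s l * ϖ w ∧
    s l * ϖ t = ∑ w ∈ PathsF v l, ϖ w * s l * ϖ t := by
  have st := PathsF_std hv ht
  have cv : s l * ϖ v = ϖ v * s l := (S.comm l _ (hl ▸ h.pp_mem v)).eq
  obtain ⟨x, rfl, -⟩ := PathsF_app ht
  simp only [← mul_sum, ← sum_mul]
  rw [h.paths_sum hv, ← cv, mul_assoc, mul_assoc, cv, ← mul_assoc, (h.pp_pre st.1).2, (h.pp_pre st.1).1]
  exact ⟨rfl, rfl⟩
lemma cross0 {n : ℕ} {s : ℕ → B} (S : SY q T n s) {v : List ℕ} (hv : Std v) (hl : v.length = n) {l : ℕ}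
    {vv z z' : List ℕ} {b b' a a' : ℕ} (hvv : vv ∈ PathsF v l) (hb : Std (b :: vv)) (hb' : Std (b' :: vv))
    (hne : b ≠ b') (ha : Std (a :: z)) (ha' : Std (a' :: z')) (hz : z ∈ PathsF v l) (hz' : z' ∈ PathsF v l)
    (H : ¬ (z' = z ∧ vv.Perm z ∧ a = b' ∧ a' = b)) :
    (ϖ (b' :: vv) * s (l+1) * ϖ (a :: z)) * T (n+l) *
      (ϖ (a' :: z') * s (l+1) * ϖ (b :: vv)) = 0 := by
  have lv := (PathsF_std hv hvv).2
  have lz := (PathsF_std hv hz).2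
  have lz' := (PathsF_std hv hz').2
  by_cases e1 : (b' :: vv).Perm (a :: z)
  swap
  · rw [(h.Cthm (n+(l+1)) _ (S.mem _) _ _ hb' ha (by simp; omega) (by simp; omega)).1 e1]; simp
  by_cases e2 : (a' :: z').Perm (b :: vv)
  swap
  · rw [(h.Cthm (n+(l+1)) _ (S.mem _) _ _ ha' hb (by simp; omega) (by simp; omega)).1 e2]; simp
  by_cases e3 : z' = z
  · subst e3
    exfalso; apply H
    have c1 := fun x => e1.count_eq x
    have c2 := fun x => e2.count_eq x
    simp only [cnt_cons] at c1 c2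
    have eab : a = b' := by
      by_contra hab
      have h1 := c1 b'; have h2 := c2 b'
      rw [if_pos rfl, if_neg hab] at h1
      rw [if_neg hne] at h2
      split_ifs at h2 <;> omega
    have ea : a' = b := by
      subst eab
      by_contra hab
      have h1 := c1 b; have h2 := c2 b
      rw [if_neg hab] at h2
      rw [if_pos rfl] at h2
      split_ifs at h1 <;> omega
    subst eab
    exact ⟨rfl, (List.perm_cons a).1 e1, rfl, ea⟩
  · have c := (h.T_comm (n := n+l) (m := n+l) le_rfl (by rw [← hl, ← lz]; exact h.pp_mem z)).eq
    rw [← h.pp_sub' ha.2 (h.good ha.2) a, ← h.pp_sub ha'.2 (h.good ha'.2) a']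
    have := h.pp_orth ha.2 ha'.2 (by omega) (Ne.symm e3)
    calc _ = (ϖ (b' :: vv) * s (l+1) * ϖ (a :: z)) * (ϖ z * T (n+l)) * ϖ z' *
      (ϖ (a' :: z') * s (l+1) * ϖ (b :: vv)) := by simp only [mul_assoc]
      _ = (ϖ (b' :: vv) * s (l+1) * ϖ (a :: z)) * T (n+l) * (ϖ z * ϖ z') *
      (ϖ (a' :: z') * s (l+1) * ϖ (b :: vv)) := by rw [← c]; simp only [mul_assoc]
      _ = _ := by rw [this]; simp
lemma cross1 {n : ℕ} {s : ℕ → B} (S : SY q T n s) {v : List ℕ} (hv : Std v) (hl : v.length = n) {l : ℕ}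
    {vv : List ℕ} {b b' : ℕ} (hvv : vv ∈ PathsF v l) (hb : Std (b :: vv)) (hb' : Std (b' :: vv))
    (hne : b ≠ b') : ϖ (b' :: vv) * (s (l+1) * T (n+l) * s (l+1)) * ϖ (b :: vv) =
    ∑ z ∈ Fil v l vv, (ϖ (b' :: vv) * s (l+1) * ϖ (b' :: z)) * T (n+l) *
      (ϖ (b :: z) * s (l+1) * ϖ (b :: vv)) := by
  have m1 : b' :: vv ∈ PathsF v (l+1) := mem_PathsF_succ.2 ⟨_, _, rfl, hvv, hb'.1⟩
  have m2 : b :: vv ∈ PathsF v (l+1) := mem_PathsF_succ.2 ⟨_, _, rfl, hvv, hb.1⟩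
  have e : ϖ (b' :: vv) * (s (l+1) * T (n+l) * s (l+1)) * ϖ (b :: vv) =
    (ϖ (b' :: vv) * s (l+1)) * T (n+l) * (s (l+1) * ϖ (b :: vv)) := by simp only [mul_assoc]
  conv_lhs => rw [e, (h.ins S hv hl m1).1, (h.ins S hv hl m2).2]
  simp only [sum_mul, mul_sum]
  rw [sum_comm]
  simp only [sum_PathsF_succ]
  rw [Fil, Finset.sum_filter]
  refine sum_congr rfl fun z hz => ?_
  have C0 := fun a a' z' (ha : a ∈ AddR z) (ha' : a' ∈ AddR z') (hz' : z' ∈ PathsF v l) =>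
    h.cross0 S hv hl (z := z) (z' := z') (a := a) (a' := a') hvv hb hb' hne
    ⟨ha, (PathsF_std hv hz).1⟩ ⟨ha', (PathsF_std hv hz').1⟩ hz hz'
  split_ifs with hp
  · rw [sum_eq_single b', sum_eq_single z, sum_eq_single b]
    · intro a' ha' hn
      exact C0 _ _ _ (AddR_perm hp ▸ hb'.1) ha' hz fun H => hn H.2.2.2
    · intro hn; exact absurd (AddR_perm hp ▸ hb.1) hn
    · intro z' hz' hn
      exact sum_eq_zero fun a' ha' => C0 _ _ _ (AddR_perm hp ▸ hb'.1) ha' hz' fun H => hn H.1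
    · intro hn; exact absurd hz hn
    · intro a ha hn
      exact sum_eq_zero fun z' hz' => sum_eq_zero fun a' ha' =>
        C0 _ _ _ ha ha' hz' fun H => hn H.2.2.1
    · intro hn; exact absurd (AddR_perm hp ▸ hb'.1) hn
  · exact sum_eq_zero fun a ha => sum_eq_zero fun z' hz' => sum_eq_zero fun a' ha' =>
        C0 _ _ _ ha ha' hz' fun H => hp H.2.1
lemma cross2 {n : ℕ} {s : ℕ → B} (S : SY q T n s) {v : List ℕ} (hv : Std v) (hl : v.length = n) {l : ℕ}
    {vv z : List ℕ} {b b' : ℕ} (hvv : vv ∈ PathsF v l) (hb : Std (b :: vv)) (hb' : Std (b' :: vv))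
    (hz : z ∈ Fil v l vv) {u u' : B} {c ρ ρ' : K}
    (R : RR T (n+l) (s l) (ϖ vv) (ϖ z) u u' c)
    (r1 : ϖ (b :: vv) * s (l+1) * ϖ (b :: vv) = ρ • ϖ (b :: vv))
    (r2 : ϖ (b' :: vv) * s (l+1) * ϖ (b' :: vv) = ρ' • ϖ (b' :: vv)) :
    (ϖ (b' :: vv) * s (l+1) * ϖ (b' :: z)) * T (n+l) *
      (ϖ (b :: z) * s (l+1) * ϖ (b :: vv)) =
      (ρ * ρ' * c⁻¹) • (ϖ (b' :: vv) * T (n+l) * ϖ (b :: vv)) := by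
  obtain ⟨hz, hp⟩ := mem_Fil.1 hz
  have lv := (PathsF_std hv hvv).2
  have sz := (PathsF_std hv hz).1
  obtain ⟨U, U', ⟨rfl, -⟩, R1⟩ := h.RR_cons S hb' (w' := z) ⟨AddR_perm hp ▸ hb'.1, sz⟩ (by omega) hp R
  obtain ⟨U, U', ⟨-, rfl⟩, R2⟩ := h.RR_cons S hb (w' := z) ⟨AddR_perm hp ▸ hb.1, sz⟩ (by omega) hp R
  have a1 : ϖ (b' :: vv) * s (l+1) * ϖ (b' :: z) =
      ρ' • (u * aeval (JM q T (n+l)) (ee q vv b')) := by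
    rw [mul_assoc, ← R1.su]
    have := R1.pu
    generalize u * aeval (JM q T (n+l)) (ee q vv b') = U at *
    conv_lhs => rw [← this]
    rw [← mul_assoc, ← mul_assoc, r2, smul_mul_assoc, this]
  have a2 : ϖ (b :: z) * s (l+1) * ϖ (b :: vv) =
      (c⁻¹ * ρ) • (aeval (JM q T (n+l)) (ee q vv b) * u') := by
    have := R2.us
    rw [mul_smul, eq_inv_smul_iff₀ R.c0, ← smul_mul_assoc, ← this]
    have := R2.up'
    generalize aeval (JM q T (n+l)) (ee q vv b) * u' = U at *
    conv_lhs => rw [← this]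
    rw [mul_assoc, mul_assoc, ← mul_assoc (ϖ _) (s _), r1, mul_smul_comm, this]
  rw [a1, a2, smul_mul_assoc, smul_mul_smul_comm]
  congr 1
  · ring
  rw [h.pp_cons' vv b, pp, show vv.length = n+l by omega]
  have k1 := (h.aeval_comm le_rfl R.m' (ee q vv b)).eq
  have k2 := (h.T_comm le_rfl R.m').eq
  have k3 := (h.aeval_comm le_rfl R.m' (ee q vv b')).eq
  have mv : ϖ vv ∈ HA K T (n+l) := by rw [← hl, ← lv]; exact h.pp_mem vv
  have k4 := (h.aeval_comm le_rfl mv (ee q vv b)).eq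
  have k5 := (h.T_comm le_rfl mv).eq
  have k6 := (h.aeval_comm le_rfl mv (ee q vv b')).eq
  rw [k1, ← mul_assoc, mul_assoc (u * _), k2, ← mul_assoc, mul_assoc u, k3, ← mul_assoc u, R.uu',
    k4, ← mul_assoc, mul_assoc (ϖ vv * _) (T _) (ϖ vv), k5, ← mul_assoc,
    mul_assoc (ϖ vv) _ (ϖ vv), k6, ← mul_assoc (ϖ vv), h.pp_id hb.2]
lemma NVsw {n : ℕ} {s : ℕ → B} (S : SY q T n s) {v : List ℕ} (hv : Std v) (hl : v.length = n) {l : ℕ}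
    {vv : List ℕ} {b b' : ℕ} (hvv : vv ∈ PathsF v l) (hb : Std (b :: vv)) (hb' : Std (b' :: vv))
    (hne : b ≠ b') (h0 : ϖ (b' :: b :: vv) ≠ 0) (n0 : s l * ϖ vv ≠ 0)
    (n1 : s (l+1) * ϖ (b :: vv) ≠ 0) (n2 : s (l+1) * ϖ (b' :: vv) ≠ 0) :
    s (l+2) * ϖ (b' :: b :: vv) ≠ 0 := by
  intro hs
  have lv := (PathsF_std hv hvv).2
  have m1 : b' :: vv ∈ PathsF v (l+1) := mem_PathsF_succ.2 ⟨_, _, rfl, hvv, hb'.1⟩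
  have m2 : b :: vv ∈ PathsF v (l+1) := mem_PathsF_succ.2 ⟨_, _, rfl, hvv, hb.1⟩
  obtain ⟨ρ, r1⟩ := h.rho S hv hl m2
  obtain ⟨ρ', r2⟩ := h.rho S hv hl m1
  obtain ⟨ρ0, r0⟩ := h.rho S hv hl hvv
  obtain ⟨u, u', c, H⟩ := h.fam S hv hl hvv
  have e1 := (h.MM S hv hl hvv r0 H).1
  have sum0 : ∑ t ∈ Fil v l vv, (c t)⁻¹ ≠ 0 := by
    intro e; rw [e, mul_zero, zero_smul] at e1; exact n0 e1
  have E := h.cross1 S hv hl hvv hb hb' hne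
  rw [sum_congr rfl fun z hz => h.cross2 S hv hl hvv hb hb' hz (H z hz) r1 r2,
    ← sum_smul, ← mul_sum] at E
  obtain ⟨κ, k0, hk⟩ := S.rc l
  have e2 : ϖ (b' :: vv) * s (l+1) * ϖ (b :: vv) = 0 :=
    (h.Cthm (n+(l+1)) _ (S.mem _) _ _ hb' hb (by simp; omega) (by simp; omega)).1 fun hp => by
      have := hp.count_eq b
      rw [cnt_cons, cnt_cons, if_neg hne.symm, if_pos rfl] at this; omega
  have sx := hb.sw hb' hne
  have e3 : ϖ (b :: b' :: vv) * T (n+l) * ϖ (b' :: b :: vv) = 0 := by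
    have e4 : (ϖ (b' :: vv) * s (l+2) * ϖ (b :: vv)) *
        aeval (JM q T (n+(l+1))) (ee q (b :: vv) b') = 0 := by
      have hs2 := hs
      rw [pp] at hs2
      have := congrArg (ϖ (b' :: vv) * ·) hs2
      rw [show (b::vv).length = n+(l+1) by simp; omega] at this
      simpa only [mul_assoc, mul_zero] using this
    have e5 : ϖ (b' :: vv) * ((q - κ) • s (l+2)) * ϖ (b :: vv) =
        (ρ * ρ' * ∑ i ∈ Fil v l vv, (c i)⁻¹) • (ϖ (b' :: vv) * T (n+l) * ϖ (b :: vv)) := by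
      rw [hk, mul_sub, sub_mul, E, mul_smul_comm, smul_mul_assoc, e2, smul_zero, sub_zero]
    rw [mul_smul_comm, smul_mul_assoc] at e5
    have e6 := congrArg (· * aeval (JM q T (n+(l+1))) (ee q (b :: vv) b')) e5
    simp only [smul_mul_assoc, e4, smul_zero] at e6
    have e7 := (smul_eq_zero.1 e6.symm).resolve_left (mul_ne_zero (mul_ne_zero
      (h.rho_ne S hv hl m2 n1 r1) (h.rho_ne S hv hl m1 n2 r2)) sum0)
    rw [h.pp_cons' (b' :: vv) b, show ϖ (b' :: b :: vv) =
      ϖ (b :: vv) * aeval (JM q T (b :: vv).length) (ee q (b :: vv) b') from rfl, show (b::vv).length = n+(l+1) by simp; omega, mul_assoc, mul_assoc]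
    rw [mul_assoc, mul_assoc] at e7
    rw [e7]; simp
  have P := h.sw_PTP hb hb' hne (h.good hb) (h.good hb')
  simp only at P
  rw [show vv.length = n+l by omega, e3, mul_zero] at P
  obtain ⟨f1, f2, f3⟩ := h.sw_far hb hb' hne
  exact h0 ((smul_eq_zero.1 P.symm).resolve_left (h.kap f1 f2 f3))
lemma sfix {n : ℕ} {s : ℕ → B} (S : SY q T n s) {l : ℕ} {x : B} (H : ∀ i, i + 2 ≤ l → T (n+i) * x = q • x) :
    s l * x = x := by
  suffices ∀ k ≤ l, s k * x = x from this l le_rfl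
  intro k
  induction k using Nat.strong_induction_on with
  | _ k ih =>
    match k with
    | 0 => intro _; rw [S.s0, one_mul]
    | 1 => intro _; rw [S.s1, one_mul]
    | k+2 =>
      intro hk
      obtain ⟨κ, k0, e⟩ := S.rc k
      have i1 := ih (k+1) (by omega) (by omega)
      have := congrArg (· * x) e
      simp only [sub_mul, smul_mul_assoc] at this
      rw [mul_assoc, mul_assoc, i1, H k hk, mul_smul_comm, i1, ← sub_smul] at this
      exact smul_right_injective _ k0 this
lemma NV {n : ℕ} {s : ℕ → B} (S : SY q T n s) {v : List ℕ} (hv : Std v) (hl : v.length = n) (l : ℕ) :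
    ∀ t ∈ PathsF v l, HSt v t → ϖ t ≠ 0 → s l * ϖ t ≠ 0 := by
  induction l using Nat.strong_induction_on with
  | _ l ih =>
    match l, ih with
    | 0, ih => intro t ht hs h0; rwa [S.s0, one_mul]
    | 1, ih => intro t ht hs h0; rwa [S.s1, one_mul]
    | l+2, ih =>
    intro t ht hs h0
    obtain ⟨st, lt⟩ := PathsF_std hv ht
    have sub : ∀ {r : ℕ} {w : List ℕ}, HSt v (r :: w) → HSt v w := fun {r w} H i => by
      have := H i; rw [cnt_cons] at this; omega
    have sub0 : ∀ {r : ℕ} {w : List ℕ}, ϖ (r :: w) ≠ 0 → ϖ w ≠ 0 := fun {r w} H e => H (by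
      rw [pp, e, zero_mul])
    obtain ⟨r, w, rfl, hw, hr⟩ := mem_PathsF_succ.1 ht
    by_cases hex : ∃ r', r' ≠ r ∧ v.count r' < (r :: w).count r'
    · obtain ⟨r', hne, hc⟩ := hex
      have hcor : (r :: w).count (r'+1) < (r :: w).count r' := lt_of_le_of_lt (hs r') hc
      obtain ⟨w', s', p'⟩ := st.corner hcor
      obtain ⟨z, z1, z2, z3, z4⟩ := Std.two st s' p' hne.symm
      have pall := z3.cons r
      obtain ⟨vv, hvv, pv⟩ := path_exists hv l z z1.2 (fun x => by
        have a := z3.count_eq x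
        have b := PathsF_count hw x
        rw [cnt_cons] at a
        split_ifs at a with e
        · subst e
          rw [cnt_cons, if_neg hne.symm] at hc; omega
        · omega) (by have := pall.length_eq; simp at this lt; omega)
      have b1 : Std (r :: vv) := ⟨AddR_perm pv ▸ z2.1, (PathsF_std hv hvv).1⟩
      have b2 : Std (r' :: vv) := ⟨AddR_perm pv ▸ z1.1, (PathsF_std hv hvv).1⟩
      have sx := b2.sw b1 hne
      have sy := b1.sw b2 hne.symm
      have m1 : r :: vv ∈ PathsF v (l+1) := mem_PathsF_succ.2 ⟨_, _, rfl, hvv, b1.1⟩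
      have m2 : r' :: vv ∈ PathsF v (l+1) := mem_PathsF_succ.2 ⟨_, _, rfl, hvv, b2.1⟩
      have my : r' :: r :: vv ∈ PathsF v (l+2) := mem_PathsF_succ.2 ⟨_, _, rfl, m1, sy.1⟩
      have pa : (r :: w).Perm (r' :: r :: vv) :=
        pall.trans ((List.Perm.swap r' r z).trans ((pv.cons r).cons r'))
      have hs' : HSt v (r' :: r :: vv) := fun i => pa.count_eq (i+1) ▸ hs i
      have hs'' : HSt v (r :: r' :: vv) := fun i => (List.Perm.swap r' r vv).count_eq (i+1) ▸ hs' i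
      have y0 : ϖ (r' :: r :: vv) ≠ 0 := fun e => h0 (h.trf' sy st pa.symm e)
      have x0 : ϖ (r :: r' :: vv) ≠ 0 := fun e => h0 (h.trf' sx st ((List.Perm.swap r' r vv).trans pa.symm) e)
      intro e
      exact h.NVsw S hv hl hvv b1 b2 hne.symm y0 (ih l (by omega) vv hvv (sub (sub hs')) (sub0 (sub0 y0)))
        (ih (l+1) (by omega) _ m1 (sub hs') (sub0 y0)) (ih (l+1) (by omega) _ m2 (sub hs'') (sub0 x0))
        (h.trf S hv hl ht my pa e)
    · push Not at hex
      rw [h.sfix S ?_]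
      · exact h0
      intro i hi
      have all : ∀ k, ∀ x ∈ PathsF v k, (∀ r', r' ≠ r → x.count r' ≤ v.count r') → ∀ i, i + 2 ≤ k →
          T (n+i) * ϖ x = q • ϖ x := by
        intro k
        induction k with
        | zero => intro x _ _ i hi; omega
        | succ k ihk =>
          intro x hx hc i hi
          obtain ⟨a, y, rfl, hy, ha⟩ := mem_PathsF_succ.1 hx
          have hcy : ∀ r', r' ≠ r → y.count r' ≤ v.count r' := fun r' h' => by
            have := hc r' h'; rw [cnt_cons] at this; omega
          have ear : a = r := by
            by_contra hn
            have h1 := hc a hn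
            have h2 := PathsF_count hy a
            rw [cnt_cons, if_pos rfl] at h1; omega
          rcases Nat.lt_or_ge (i+2) (k+1) with hik | hik
          · rw [pp, ← mul_assoc, ihk y hy hcy i (by omega), smul_mul_assoc]
          · obtain ⟨k, rfl⟩ : ∃ j, k = j + 1 := ⟨k-1, by omega⟩
            obtain ⟨a', y', rfl, hy', ha'⟩ := mem_PathsF_succ.1 hy
            have ear' : a' = r := by
              by_contra hn
              have h1 := hcy a' hn
              have h2 := PathsF_count hy' a'
              rw [cnt_cons, if_pos rfl] at h1; omega
            have ly := (PathsF_std hv hy').2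
            rcases h.TPdec (PathsF_std hv hx).1 with ⟨c1, -⟩ | ⟨-, c2⟩
            · exact absurd (ear.trans ear'.symm) c1
            · rw [if_pos (ear.trans ear'.symm)] at c2
              rwa [show n + i = y'.length by omega]
      exact all (l+2) _ ht hex i hi
lemma pieri {n : ℕ} {s : ℕ → B} (S : SY q T n s) {v : List ℕ} (hv : Std v) (hl : v.length = n) {l : ℕ}
    {ρ : List ℕ → K} (hρ : ∀ t ∈ PathsF v l, ϖ t * s l * ϖ t = ρ t • ϖ t)
    {t0 : List ℕ} (ht0 : t0 ∈ PathsF v l) (h0 : ϖ t0 ≠ 0) :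
    ∑ t ∈ Fil v l t0, ρ t = (open Classical in if HSt v t0 then 1 else 0) := by
  obtain ⟨u, u', c, H⟩ := h.fam S hv hl ht0
  have M := h.MM S hv hl ht0 (hρ _ ht0) H
  have e : ∀ t ∈ Fil v l t0, ρ t = ρ t0 * (c t)⁻¹ := fun t ht => by
    obtain ⟨m, p⟩ := mem_Fil.1 ht
    have := (hρ t m).symm.trans (M.2 t ht)
    rw [mul_comm]
    by_contra hn
    rw [← sub_eq_zero, ← sub_smul] at this
    exact h0 (h.trf' (PathsF_std hv m).1 (PathsF_std hv ht0).1 p.symm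
      ((smul_eq_zero.1 this).resolve_left (sub_ne_zero.2 hn)))
  rw [sum_congr rfl e, ← mul_sum]
  split_ifs with hs
  · have n0 := h.NV S hv hl l t0 ht0 hs h0
    by_contra hn
    have e2 := M.1
    rw [← sub_eq_zero, ← one_smul K (s l * ϖ t0), smul_smul, mul_one, ← sub_smul] at e2
    exact n0 ((smul_eq_zero.1 e2).resolve_left (sub_ne_zero.2 (Ne.symm hn)))
  · have z := h.Zthm S hv hl l t0 ht0 hs
    have := hρ t0 ht0
    rw [mul_assoc, z, mul_zero] at this
    rw [(smul_eq_zero.1 this.symm).resolve_right h0, zero_mul]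
end HK
def muHom (K : Type) [Field K] [Algebra K B] {I : Type} [Fintype I] [DecidableEq I] (e : I → I → B)
    (hm : ∀ a b c d, e a b * e c d = if b = c then e a d else 0) (h1 : ∑ a, e a a = 1) :
    Matrix I I K →ₐ[K] B :=
  AlgHom.ofLinearMap
    { toFun := fun M => ∑ i, ∑ j, M i j • e i j
      map_add' := fun M N => by simp [add_smul, Finset.sum_add_distrib]
      map_smul' := fun c M => by simp [mul_smul, smul_sum] }
    (by simp [Matrix.one_apply, ite_smul, h1])
    (by
      intro M N
      simp only [LinearMap.coe_mk, AddHom.coe_mk, sum_mul, mul_sum, smul_mul_smul_comm, hm,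
        Matrix.mul_apply, sum_smul, smul_ite, smul_zero]
      simp only [Finset.sum_ite_eq', Finset.mem_univ, if_true]
      rw [sum_comm]
      conv_rhs => rw [sum_comm]
      exact sum_congr rfl fun j _ => sum_comm)
lemma muHom_apply {I : Type} [Fintype I] [DecidableEq I] {e : I → I → B}
    (hm : ∀ a b c d, e a b * e c d = if b = c then e a d else 0) (h1 : ∑ a, e a a = 1) (M : Matrix I I K) :
    muHom K e hm h1 M = ∑ i, ∑ j, M i j • e i j := rfl
structure MUF (E : ℕ → ι → ι → B) : Prop where
  mul : ∀ k a b c d, E k a b * E k c d = if b = c then E k a d else 0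
  one : ∀ k, ∑ a, E k a a = 1
  comm : ∀ k l, k ≠ l → ∀ a b c d, Commute (E k a b) (E l c d)
abbrev Ix (ι : Type) (n : ℕ) : Type := Fin n → ι
abbrev sn {n : ℕ} (i : Ix ι n) (a : ι) : Ix ι (n+1) := Fin.snoc (α := fun _ => ι) i a
abbrev ini {n : ℕ} (i : Ix ι (n+1)) : Ix ι n := Fin.init (α := fun _ => ι) i
lemma ix_sum {M : Type*} [AddCommMonoid M] {n : ℕ} (f : Ix ι (n+1) → M) :
    ∑ i, f i = ∑ i : Ix ι n, ∑ a : ι, f (sn i a) := by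
  rw [← Fintype.sum_prod_type' (f := fun i a => f (sn i a))]
  refine Fintype.sum_equiv ⟨fun i => (ini i, i (Fin.last n)), fun p => sn p.1 p.2, fun i => ?_, fun p => ?_⟩
    _ _ fun i => ?_ <;> simp [sn, ini]
def eU (E : ℕ → ι → ι → B) : ∀ n, Ix ι n → Ix ι n → B
  | 0, _, _ => 1
  | n+1, i, j => eU E n (ini i) (ini j) * E n (i (Fin.last n)) (j (Fin.last n))
@[simp] lemma eU_sn (E : ℕ → ι → ι → B) {n : ℕ} (i j : Ix ι n) (a b : ι) :
    eU E (n+1) (sn i a) (sn j b) = eU E n i j * E n a b := by simp [eU, sn, ini]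
namespace MUF
variable {E : ℕ → ι → ι → B} (H : MUF E)
include H
lemma shift (n : ℕ) : MUF fun i => E (n+i) :=
  ⟨fun k => H.mul _, fun k => H.one _, fun k l h => H.comm _ _ (by omega)⟩
lemma eU_comm {n k : ℕ} (hk : n ≤ k) (i j : Ix ι n) (a b : ι) : Commute (eU E n i j) (E k a b) := by
  induction n with
  | zero => exact Commute.one_left _
  | succ n ih => exact (ih (by omega) _ _).mul_left (H.comm _ _ (by omega) _ _ _ _)
lemma eU_mul : ∀ n (a b c d : Ix ι n), eU E n a b * eU E n c d = if b = c then eU E n a d else 0 := by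
  intro n
  induction n with
  | zero => intro a b c d; rw [if_pos (Subsingleton.elim b c)]; simp [eU]
  | succ n ih =>
    intro a b c d
    simp only [eU]
    rw [mul_assoc, ← mul_assoc (E n _ _), ← (H.eU_comm le_rfl _ _ _ _).eq, mul_assoc, ← mul_assoc (eU E n _ _),
      ih, H.mul]
    have : b = c ↔ ini b = ini c ∧ b (Fin.last n) = c (Fin.last n) :=
      ⟨fun h => h ▸ ⟨rfl, rfl⟩, fun h => by
        rw [← Fin.snoc_init_self (α := fun _ => ι) b, ← Fin.snoc_init_self (α := fun _ => ι) c]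
        exact congrArg₂ _ h.1 h.2⟩
    rw [if_congr this rfl rfl, ite_and]
    split_ifs <;> simp
lemma eU_one : ∀ n, ∑ a, eU E n a a = 1 := by
  intro n
  induction n with
  | zero => simp [eU]
  | succ n ih =>
    rw [ix_sum]
    simp only [eU_sn, ← mul_sum, H.one, mul_one, ih]
def op (K : Type) [Field K] [Algebra K B] (n : ℕ) : Matrix (Ix ι n) (Ix ι n) K →ₐ[K] B :=
  muHom K (eU E n) (H.eU_mul n) (H.eU_one n)
lemma op_apply {n : ℕ} (M : Matrix (Ix ι n) (Ix ι n) K) : H.op K n M = ∑ i, ∑ j, M i j • eU E n i j := rfl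
lemma op_succ {n : ℕ} (M : Matrix (Ix ι (n+1)) (Ix ι (n+1)) K) :
    H.op K (n+1) M = ∑ c, ∑ d, H.op K n (Matrix.of fun i j => M (sn i c) (sn j d)) * E n c d := by
  simp only [op_apply, ix_sum, eU_sn, sum_mul, Matrix.of_apply, smul_mul_assoc]
  rw [sum_comm]
  refine sum_congr rfl fun c _ => ?_
  rw [sum_comm (s := (Finset.univ : Finset ι))]
  exact sum_congr rfl fun i _ => sum_comm
def Loc (K : Type) [Field K] [Algebra K B] (n : ℕ) : Subalgebra K B := (H.op K n).range
lemma mem_Loc {n : ℕ} {x : B} : x ∈ H.Loc K n ↔ ∃ M : Matrix (Ix ι n) (Ix ι n) K, H.op K n M = x := Iff.rfl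
lemma op_mem {n : ℕ} (M : Matrix (Ix ι n) (Ix ι n) K) : H.op K n M ∈ H.Loc K n := ⟨M, rfl⟩
lemma blk {n : ℕ} {x : B} : x ∈ H.Loc K (n+1) ↔ ∃ y : ι → ι → B, (∀ c d, y c d ∈ H.Loc K n) ∧
    x = ∑ c, ∑ d, y c d * E n c d := by
  constructor
  · rintro ⟨M, rfl⟩
    exact ⟨fun c d => H.op K n (Matrix.of fun i j => M (sn i c) (sn j d)), fun c d => H.op_mem _, H.op_succ M⟩
  · rintro ⟨y, hy, rfl⟩
    simp only [mem_Loc] at hy ⊢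
    choose M hM using hy
    refine ⟨Matrix.of fun i j => M (i (Fin.last n)) (j (Fin.last n)) (ini i) (ini j), ?_⟩
    rw [H.op_succ]
    refine sum_congr rfl fun c _ => sum_congr rfl fun d _ => ?_
    rw [← hM c d]; congr 2; ext i j; simp [sn, ini]
lemma Loc_comm {n k : ℕ} (hk : n ≤ k) {x : B} (hx : x ∈ H.Loc K n) (a b : ι) : Commute x (E k a b) := by
  obtain ⟨M, rfl⟩ := H.mem_Loc.1 hx
  exact Commute.sum_left _ _ _ fun i _ => Commute.sum_left _ _ _ fun j _ =>
    (H.eU_comm hk _ _ _ _).smul_left _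
lemma Loc_succ {n : ℕ} : H.Loc K n ≤ H.Loc K (n+1) := fun x hx =>
  H.blk.2 ⟨fun c d => if c = d then x else 0, fun c d => by dsimp only; split_ifs; exacts [hx, zero_mem _], by
    simp [ite_mul, ← mul_sum, H.one]⟩
lemma Loc_mono {m n : ℕ} (h : m ≤ n) : H.Loc K m ≤ H.Loc K n := by
  induction h with
  | refl => exact le_rfl
  | step _ ih => exact ih.trans H.Loc_succ
lemma E_mem {k n : ℕ} (hk : k < n) (a b : ι) : E k a b ∈ H.Loc K n := by
  refine H.Loc_mono (Nat.succ_le_of_lt hk) (H.blk.2 ⟨fun c d => if c = a then if d = b then 1 else 0 else 0,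
    fun c d => ?_, ?_⟩)
  · dsimp only; split_ifs; exacts [one_mem _, zero_mem _, zero_mem _]
  · simp [ite_mul]
def tr (K : Type) [Field K] [Algebra K B] (n : ℕ) (x : B) : K :=
  Matrix.trace (Function.invFun (H.op K n) x)
section
variable [Nontrivial B] [Nonempty ι]
lemma op_inj (n : ℕ) : Function.Injective (H.op K n) := RingHom.injective (H.op K n).toRingHom
lemma tr_op {n : ℕ} (M : Matrix (Ix ι n) (Ix ι n) K) : H.tr K n (H.op K n M) = M.trace := by
  rw [tr, Function.leftInverse_invFun (H.op_inj n)]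
lemma tr_comm {n : ℕ} {x y : B} (hx : x ∈ H.Loc K n) (hy : y ∈ H.Loc K n) :
    H.tr K n (x * y) = H.tr K n (y * x) := by
  obtain ⟨M, rfl⟩ := H.mem_Loc.1 hx; obtain ⟨N, rfl⟩ := H.mem_Loc.1 hy
  simp only [← map_mul, tr_op]
  exact Matrix.trace_mul_comm _ _
lemma tr_add {n : ℕ} {x y : B} (hx : x ∈ H.Loc K n) (hy : y ∈ H.Loc K n) :
    H.tr K n (x + y) = H.tr K n x + H.tr K n y := by
  obtain ⟨M, rfl⟩ := H.mem_Loc.1 hx; obtain ⟨N, rfl⟩ := H.mem_Loc.1 hy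
  simp only [← map_add, tr_op, Matrix.trace_add]
lemma tr_smul {n : ℕ} (c : K) {x : B} (hx : x ∈ H.Loc K n) : H.tr K n (c • x) = c * H.tr K n x := by
  obtain ⟨M, rfl⟩ := H.mem_Loc.1 hx
  simp only [← map_smul, tr_op, Matrix.trace_smul, smul_eq_mul]
lemma tr_zero {n : ℕ} : H.tr K n (0 : B) = 0 := by
  rw [← map_zero (H.op K n), tr_op, Matrix.trace_zero]
lemma tr_sum {n : ℕ} {J : Type*} {s : Finset J} {f : J → B} (hf : ∀ i ∈ s, f i ∈ H.Loc K n) :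
    H.tr K n (∑ i ∈ s, f i) = ∑ i ∈ s, H.tr K n (f i) := by
  classical
  induction s using Finset.induction_on with
  | empty => simp [H.tr_zero]
  | insert a s ha ih =>
    rw [Finset.sum_insert ha, Finset.sum_insert ha, H.tr_add (hf _ (by simp))
      (sum_mem fun i hi => hf i (by simp [hi])), ih fun i hi => hf i (by simp [hi])]
lemma tr_blk {n : ℕ} {y : ι → ι → B} (hy : ∀ c d, y c d ∈ H.Loc K n) :
    H.tr K (n+1) (∑ c, ∑ d, y c d * E n c d) = ∑ c, H.tr K n (y c c) := by
  choose M hM using hy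
  have := H.op_succ (Matrix.of fun i j => M (i (Fin.last n)) (j (Fin.last n)) (ini i) (ini j))
  have e : ∀ c d, H.op K n (M c d) = y c d := hM
  simp only [Matrix.of_apply, sn, ini, Fin.snoc_last, Fin.init_snoc] at this
  have e2 : ∀ c d, (Matrix.of fun i j => M c d i j) = M c d := fun _ _ => rfl
  simp only [e2, e] at this
  rw [← this, tr_op, Matrix.trace, ix_sum, sum_comm]
  refine sum_congr rfl fun c _ => ?_
  rw [← e, tr_op]; simp [Matrix.trace, sn, ini]
lemma tr_one0 : H.tr K 0 (1 : B) = 1 := by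
  rw [← map_one (H.op K 0), tr_op]; simp
lemma Loc0 {x : B} (hx : x ∈ H.Loc K 0) : ∃ c : K, x = c • 1 := by
  obtain ⟨M, rfl⟩ := H.mem_Loc.1 hx
  exact ⟨M default default, by simp [H.op_apply, eU]⟩
lemma tr_mul {n l : ℕ} {x y : B} (hx : x ∈ H.Loc K n) (hy : y ∈ (H.shift n).Loc K l) :
    x * y ∈ H.Loc K (n+l) ∧ H.tr K (n+l) (x * y) = H.tr K n x * (H.shift n).tr K l y := by
  induction l generalizing y with
  | zero =>
    obtain ⟨c, rfl⟩ := (H.shift n).Loc0 hy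
    rw [mul_smul_comm, mul_one]
    show _ ∈ H.Loc K n ∧ H.tr K n _ = _
    rw [H.tr_smul _ hx, (H.shift n).tr_smul _ (one_mem _), tr_one0, mul_one, mul_comm]
    exact ⟨Subalgebra.smul_mem _ hx _, rfl⟩
  | succ l ih =>
    obtain ⟨z, hz, rfl⟩ := (H.shift n).blk.1 hy
    have e : x * ∑ c, ∑ d, z c d * E (n+l) c d = ∑ c, ∑ d, (x * z c d) * E (n+l) c d := by
      simp only [mul_sum, mul_assoc]
    rw [e, (H.shift n).tr_blk hz, show n + (l+1) = (n+l)+1 from rfl, H.tr_blk fun c d => (ih (hz c d)).1,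
      mul_sum]
    exact ⟨H.blk.2 ⟨_, fun c d => (ih (hz c d)).1, rfl⟩, sum_congr rfl fun c _ => (ih (hz c c)).2⟩
lemma tr_idem [CharZero K] {n : ℕ} {x : B} (hx : x ∈ H.Loc K n) (hi : x * x = x) :
    (∃ k : ℕ, H.tr K n x = k) ∧ (H.tr K n x = 0 → x = 0) := by
  obtain ⟨M, rfl⟩ := H.mem_Loc.1 hx
  simp only [← map_mul] at hi ⊢
  have hM : M * M = M := H.op_inj n hi
  have hi : IsIdempotentElem (Matrix.toLin' M) := by
    rw [IsIdempotentElem, Module.End.mul_eq_comp, ← Matrix.toLin'_mul, hM]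
  rw [tr_op, ← Matrix.trace_toLin'_eq]
  refine ⟨⟨_, (LinearMap.IsIdempotentElem.isProj_range _ hi).trace⟩, fun h0 => ?_⟩
  have := (LinearMap.IsIdempotentElem.trace_eq_zero_iff hi).1 h0
  rw [(Matrix.toLin' (R := K)).map_eq_zero_iff.1 this, map_zero]
end
end MUF
lemma tr_cmp {B' : Type} [Ring B'] [Algebra K B'] [Nontrivial B] [Nontrivial B'] [Nonempty ι]
    {E : ℕ → ι → ι → B} {E' : ℕ → ι → ι → B'} (H : MUF E) (H' : MUF E')
    (HP : MUF fun k a b => (E k a b, E' k a b)) {n : ℕ} {x : B × B'} (hx : x ∈ HP.Loc K n) :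
    x.1 ∈ H.Loc K n ∧ x.2 ∈ H'.Loc K n ∧ H.tr K n x.1 = H'.tr K n x.2 := by
  obtain ⟨M, rfl⟩ := HP.mem_Loc.1 hx
  have e : ∀ i j, eU (fun k a b => (E k a b, E' k a b)) n i j = (eU E n i j, eU E' n i j) := by
    clear hx M
    induction n with
    | zero => intro i j; rfl
    | succ n ih => intro i j; simp only [eU, ih, Prod.mk_mul_mk]
  have e1 : (HP.op K n M).1 = H.op K n M := by simp [MUF.op_apply, e, Prod.fst_sum]
  have e2 : (HP.op K n M).2 = H'.op K n M := by simp [MUF.op_apply, e, Prod.snd_sum]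
  simp only [e1, e2, MUF.tr_op]
  exact ⟨H.op_mem _, H'.op_mem _, trivial⟩
abbrev gd (μ : List ℕ) (i : ℕ) : ℕ := μ.getD i 0
def Pt (μ : List ℕ) : Prop := ∀ i, gd μ (i+1) ≤ gd μ i
lemma Pt_cons {a : ℕ} {μ : List ℕ} : Pt (a :: μ) ↔ gd μ 0 ≤ a ∧ Pt μ :=
  ⟨fun h => ⟨by simpa using h 0, fun i => by simpa using h (i+1)⟩,
    fun h i => by cases i with
      | zero => simpa using h.1
      | succ i => simpa using h.2 i⟩
def hs (b l : ℕ) : List ℕ → Finset (List ℕ)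
  | [] => if l ≤ b then {[l]} else ∅
  | m :: μ => (Finset.range (l+1)).biUnion fun j =>
      if m + j ≤ b then (hs m (l-j) μ).image (List.cons (m+j)) else ∅
lemma mem_hs {μ : List ℕ} : ∀ {b l : ℕ} {t : List ℕ}, t ∈ hs b l μ ↔ t.length = μ.length + 1 ∧ t.sum = μ.sum + l ∧
    gd t 0 ≤ b ∧ ∀ i, gd μ i ≤ gd t i ∧ gd t (i+1) ≤ gd μ i := by
  induction μ with
  | nil =>
    intro b l t
    simp only [hs]
    constructor
    · intro h
      split_ifs at h with hb
      · rw [Finset.mem_singleton.1 h]; simp [hb]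
      · simp at h
    · rintro ⟨h1, h2, h3, h4⟩
      obtain ⟨a, rfl⟩ := List.length_eq_one_iff.1 h1
      simp at h2 h3
      subst h2; simp [h3]
  | cons m μ ih =>
    intro b l t
    simp only [hs, Finset.mem_biUnion, mem_range]
    constructor
    · rintro ⟨j, hj, h⟩
      split_ifs at h with hb
      · obtain ⟨u, hu, rfl⟩ := mem_image.1 h
        obtain ⟨h1, h2, h3, h4⟩ := ih.1 hu
        refine ⟨by simp [h1], by simp [h2]; omega, by simpa using hb, fun i => ?_⟩
        cases i with
        | zero => simpa using h3
        | succ i => simpa using h4 i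
      · simp at h
    · rintro ⟨h1, h2, h3, h4⟩
      cases t with
      | nil => simp at h1
      | cons a t =>
        have h40 := h4 0
        simp at h1 h2 h3 h40
        have hsum : μ.sum ≤ t.sum := by
          have : ∀ (μ t : List ℕ), (∀ i, gd μ i ≤ gd t i) → μ.sum ≤ t.sum := by
            intro μ
            induction μ with
            | nil => intro t _; simp
            | cons x μ ih =>
              intro t h
              cases t with
              | nil =>
                have := ih [] fun i => by simpa using h (i+1)
                have := h 0
                simp at *; omega
              | cons y t =>
                have := ih t fun i => by simpa using h (i+1)
                have := h 0
                simp at *; omega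
          exact this _ _ fun i => by simpa using (h4 (i+1)).1
        refine ⟨a - m, by omega, ?_⟩
        rw [if_pos (by omega), mem_image]
        refine ⟨t, ih.2 ⟨h1, by omega, h40.2, fun i => by simpa using h4 (i+1)⟩, by congr 1; omega⟩
lemma hs_sum {M : Type*} [AddCommMonoid M] (f : List ℕ → M) (b l m : ℕ) (μ : List ℕ) :
    ∑ t ∈ hs b l (m :: μ), f t =
      ∑ j ∈ Finset.range (l+1), if m + j ≤ b then ∑ t ∈ hs m (l-j) μ, f ((m+j) :: t) else 0 := by
  rw [hs, Finset.sum_biUnion]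
  · refine sum_congr rfl fun j _ => ?_
    split_ifs
    · rw [Finset.sum_image fun x _ y _ h => List.cons_injective h]
    · simp
  · intro i _ j _ hij
    rw [Function.onFun, Finset.disjoint_left]
    intro t h1 h2
    apply hij
    split_ifs at h1 h2 <;> simp at h1 h2
    obtain ⟨x, _, rfl⟩ := h1
    obtain ⟨y, _, h⟩ := h2
    have := (List.cons.inj h).1
    omega
lemma Pt_hs {b l : ℕ} {μ t : List ℕ} (h : t ∈ hs b l μ) : Pt t := fun i =>
  ((mem_hs.1 h).2.2.2 i).2.trans ((mem_hs.1 h).2.2.2 i).1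
structure PS (d : List ℕ → ℝ) (h : ℕ → ℝ) : Prop where
  nonneg : ∀ μ, 0 ≤ d μ
  nil : d [] = 1
  pieri : ∀ μ, Pt μ → ∀ l b, l + μ.sum ≤ b → h l * d μ = ∑ t ∈ hs b l μ, d t
lemma sum_gd : ∀ (μ : List ℕ), ∑ i ∈ Finset.range μ.length, gd μ i = μ.sum
  | [] => rfl
  | a :: μ => by rw [List.length_cons, Finset.sum_range_succ']; simpa [add_comm] using sum_gd μ
lemma count_len : ∀ (μ w : List ℕ), (∀ i, w.count i = gd μ i) → w.length = μ.sum := by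
  intro μ w h
  have := Multiset.sum_count_eq_card (s := Finset.range μ.length) (m := (w : Multiset ℕ)) fun a ha => by
    rw [Multiset.mem_coe, ← List.count_pos_iff, h] at ha
    rw [mem_range]
    by_contra hc
    rw [gd, List.getD_eq_default _ _ (by omega)] at ha
    exact ha.false
  rw [← sum_gd, ← Multiset.coe_card, ← this]
  exact sum_congr rfl fun i _ => by rw [Multiset.coe_count, h]
lemma exists_std {μ : List ℕ} (h : Pt μ) : ∃ w, Std w ∧ ∀ i, w.count i = gd μ i := by
  induction μ using List.reverseRecOn with
  | nil => exact ⟨[], trivial, by simp⟩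
  | append_singleton μ a ih =>
    have e1 : ∀ i, i < μ.length → gd (μ ++ [a]) i = gd μ i := fun i hi => by
      rw [gd, List.getD_append _ _ _ _ hi]
    have e2 : ∀ i, μ.length ≤ i → gd (μ ++ [a]) i = if i = μ.length then a else 0 := fun i hi => by
      simp only [gd, List.getD_append_right _ _ _ _ hi]
      split_ifs with e
      · simp [e]
      · rw [List.getD_eq_default]; simp; omega
    have e3 : ∀ i, μ.length ≤ i → gd μ i = 0 := fun i hi => List.getD_eq_default _ _ hi
    obtain ⟨w, hw, hc⟩ := ih fun i => by
      by_cases hi : i + 1 < μ.length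
      · rw [← e1 _ hi, ← e1 i (by omega)]; exact h i
      · rw [e3 _ (by omega)]; omega
    have : ∀ c ≤ a, ∃ w, Std w ∧ ∀ i, w.count i = if i = μ.length then c else gd μ i := by
      intro c
      induction c with
      | zero =>
        intro _
        refine ⟨w, hw, fun i => ?_⟩
        split_ifs with e
        · rw [hc, e3 _ e.ge]
        · exact hc i
      | succ c ihc =>
        intro hle
        obtain ⟨w, hw, hc⟩ := ihc (by omega)
        refine ⟨μ.length :: w, hw.cons_of_rem ?_, fun i => ?_⟩
        · rcases Nat.eq_zero_or_pos μ.length with h0 | h0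
          · exact Or.inl h0
          · right
            rw [hc, hc, if_pos rfl, if_neg (by omega), ← e1 _ (by omega)]
            have := h (μ.length - 1)
            rw [Nat.sub_add_cancel h0, e2 _ le_rfl, if_pos rfl] at this
            omega
        · rw [cnt_cons, hc]
          by_cases e : i = μ.length
          · simp [e]
          · simp [e, Ne.symm e]
    obtain ⟨w, hw, hc⟩ := this a le_rfl
    refine ⟨w, hw, fun i => ?_⟩
    rw [hc]
    by_cases hi : i < μ.length
    · rw [if_neg hi.ne, e1 _ hi]
    · rw [e2 _ (by omega)]
      split_ifs
      · rfl
      · exact e3 _ (by omega)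
lemma gd_lam (t : List ℕ) (k i : ℕ) : gd ((List.range k).map t.count) i = if i < k then t.count i else 0 := by
  split_ifs with h
  · simp [gd, List.getD_eq_getElem?_getD, h]
  · rw [gd, List.getD_eq_default]; simp; omega
lemma gd_ext {μ ν : List ℕ} (hl : μ.length = ν.length) (h : ∀ i, gd μ i = gd ν i) : μ = ν := by
  refine List.ext_getElem hl fun i h1 h2 => ?_
  have := h i
  rwa [gd, gd, List.getD_eq_getElem _ _ h1, List.getD_eq_getElem _ _ h2] at this
lemma JM_map {B' : Type} [Ring B'] [Algebra K B'] (φ : B →ₐ[K] B') (n : ℕ) :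
    JM q (fun i => φ (T i)) n = φ (JM q T n) := by
  induction n with
  | zero => simp [JM]
  | succ n ih => simp [JM, ih]
lemma pp_map {B' : Type} [Ring B'] [Algebra K B'] (φ : B →ₐ[K] B') (w : List ℕ) :
    pp q (fun i => φ (T i)) w = φ (ϖ w) := by
  induction w with
  | nil => simp [pp]
  | cons r w ih => simp only [pp, ih, JM_map, map_mul, Polynomial.aeval_algHom_apply]
def TF (r : ι → ι → ι → ι → K) (E : ℕ → ι → ι → B) (T : ℕ → B) : Prop :=
  ∀ k, T k = ∑ a, ∑ b, ∑ c, ∑ d, r a b c d • (E k a c * E (k+1) b d)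
structure TS (q : K) (r : ι → ι → ι → ι → K) (E : ℕ → ι → ι → B) (T : ℕ → B) : Prop where
  hk : HK q T
  mu : MUF E
  tf : TF r E T
lemma TF_mem {r : ι → ι → ι → ι → K} {E : ℕ → ι → ι → B} (H : MUF E) (h : TF r E T) {n : ℕ} {x : B} (hx : x ∈ HA K T n) :
    x ∈ H.Loc K n := by
  revert x
  show HA K T n ≤ H.Loc K n
  rw [HA, Algebra.adjoin_le_iff]
  rintro _ ⟨i, hi, rfl⟩
  rw [h i]
  exact sum_mem fun a _ => sum_mem fun b _ => sum_mem fun c _ => sum_mem fun d _ => Subalgebra.smul_mem _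
      (mul_mem (H.E_mem (by omega) _ _) (H.E_mem (by omega) _ _)) _
namespace TS
variable {r : ι → ι → ι → ι → K} {E : ℕ → ι → ι → B} (S : TS q r E T)
include S
lemma pp_loc (w : List ℕ) : ϖ w ∈ S.mu.Loc K w.length := TF_mem S.mu S.tf (S.hk.pp_mem w)
def dd (w : List ℕ) : K := S.mu.tr K w.length (ϖ w)
variable [Nontrivial B] [Nonempty ι]
lemma shift_tr (n : ℕ) (w : List ℕ) : pp q (fun i => T (n+i)) w ∈ (S.mu.shift n).Loc K w.length ∧
    (S.mu.shift n).tr K w.length (pp q (fun i => T (n+i)) w) = S.dd w := by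
  have HP : MUF fun k a b => (E k a b, E (n+k) a b) := ⟨fun k a b c d => by
      rw [Prod.mk_mul_mk, S.mu.mul, S.mu.mul]; split_ifs <;> rfl,
    fun k => by rw [← Prod.mk_one_one, ← S.mu.one k]; ext <;> simp [Prod.fst_sum, Prod.snd_sum, S.mu.one],
    fun k l hkl a b c d => (S.mu.comm k l hkl _ _ _ _).prod (S.mu.comm _ _ (by omega) _ _ _ _)⟩
  have tp : TF r (fun k a b => (E k a b, E (n+k) a b)) (fun k => (T k, T (n+k))) := fun k => by
    ext
    · simp [Prod.fst_sum]; exact S.tf k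
    · simp [Prod.snd_sum]; exact S.tf (n+k)
  have hk2 := S.hk.shift n
  have hP : HK q (fun k => ((T k, T (n+k)) : B × B)) := ⟨S.hk.q0, S.hk.qn,
    fun i => Prod.ext (S.hk.quad i) (hk2.quad i), fun i => Prod.ext (S.hk.braid i) (hk2.braid i),
    fun i j hij => (S.hk.far i j hij).prod (hk2.far i j hij)⟩
  have := tr_cmp S.mu (S.mu.shift n) HP (TF_mem HP tp (hP.pp_mem w))
  have e1 := pp_map (q := q) (T := fun k => ((T k, T (n+k)) : B × B)) (AlgHom.fst K B B) w
  have e2 := pp_map (q := q) (T := fun k => ((T k, T (n+k)) : B × B)) (AlgHom.snd K B B) w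
  simp only [AlgHom.fst_apply, AlgHom.snd_apply] at e1 e2
  rw [← e1, ← e2] at this
  exact ⟨this.2.1, this.2.2.symm⟩
lemma dd_perm {w w' : List ℕ} (hw : Std w) (hw' : Std w') (hp : w.Perm w') : S.dd w = S.dd w' := by
  obtain ⟨u, u', hu, hu', e, e', _⟩ := S.hk.eqv hw hw' hp
  rw [dd, dd, ← hp.length_eq, ← e, ← e']
  exact S.mu.tr_comm (TF_mem S.mu S.tf hu) (TF_mem S.mu S.tf hu')
lemma dd_zero [CharZero K] {w : List ℕ} (hw : Std w) : S.dd w = 0 ↔ ϖ w = 0 :=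
  ⟨(S.mu.tr_idem (S.pp_loc w) (S.hk.pp_id hw)).2, fun h => by rw [dd, h, S.mu.tr_zero]⟩
lemma dd_nat [CharZero K] {w : List ℕ} (hw : Std w) : ∃ k : ℕ, S.dd w = k :=
  (S.mu.tr_idem (S.pp_loc w) (S.hk.pp_id hw)).1
lemma pieri0 {v : List ℕ} (hv : Std v) (l : ℕ) {s : B} (hs : s = pp q (fun i => T (v.length+i)) (row l)) :
    S.dd v * S.dd (row l) = ∑ t ∈ PathsF v l, S.mu.tr K (v.length+l) (ϖ t * s * ϖ t) := by
  have h1 := S.shift_tr v.length (row l)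
  rw [← hs, List.length_replicate] at h1
  obtain ⟨m, e⟩ := S.mu.tr_mul (S.pp_loc v) h1.1
  have ms : s ∈ HA K T (v.length+l) := hs ▸ (S.hk.SYrow v.length).mem l
  rw [← h1.2, dd, ← e, ← S.hk.paths_sum hv l, sum_mul]
  have lp : ∀ t ∈ PathsF v l, ϖ t ∈ S.mu.Loc K (v.length+l) := fun t ht => by
    rw [← (PathsF_std hv ht).2]; exact S.pp_loc t
  have ls := TF_mem S.mu S.tf ms
  rw [S.mu.tr_sum fun t ht => mul_mem (lp t ht) ls]
  refine sum_congr rfl fun t ht => ?_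
  rw [S.mu.tr_comm (mul_mem (lp t ht) ls) (lp t ht), ← mul_assoc, S.hk.pp_id (PathsF_std hv ht).1]
open Classical in
def dp (μ : List ℕ) : K := if h : Pt μ then S.dd (exists_std h).choose else 0
lemma dp_eq {μ w : List ℕ} (hw : Std w) (hc : ∀ i, w.count i = gd μ i) : S.dp μ = S.dd w := by
  have h : Pt μ := fun i => by rw [← hc, ← hc]; exact hw.le (by omega)
  rw [dp, dif_pos h]
  have := (exists_std h).choose_spec
  exact S.dd_perm this.1 hw (List.perm_iff_count.2 fun i => by rw [this.2, hc])
lemma pieri1 [CharZero K] {μ : List ℕ} (hμ : Pt μ) {l b : ℕ} (hb : l + μ.sum ≤ b) :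
    S.dd (row l) * S.dp μ = ∑ t ∈ hs b l μ, S.dp t := by
  classical
  obtain ⟨v, hv, hc⟩ := exists_std hμ
  have hlen := count_len μ v hc
  rw [S.dp_eq hv hc, mul_comm, S.pieri0 hv l rfl]
  have SY := S.hk.SYrow v.length
  set s := pp q (fun i => T (v.length+i)) (row l) with hs_def
  rw [← Finset.sum_filter_add_sum_filter_not _ (HSt v), add_eq_left.2]
  swap
  · refine sum_eq_zero fun t ht => ?_
    rw [mem_filter] at ht
    rw [mul_assoc, S.hk.Zthm SY hv rfl l t ht.1 ht.2, mul_zero, S.mu.tr_zero]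
  have Fm : ∀ t ∈ (PathsF v l).filter (HSt v), ∀ i, gd ((List.range (μ.length+1)).map t.count) i = t.count i := by
    intro t ht i
    rw [gd_lam]
    split_ifs with hi
    · rfl
    · obtain ⟨j, rfl⟩ : ∃ j, i = j + 1 := ⟨i-1, by omega⟩
      have := (mem_filter.1 ht).2 j
      rw [hc, gd, List.getD_eq_default _ _ (by omega)] at this
      omega
  rw [← Finset.sum_fiberwise_of_maps_to (g := fun t => (List.range (μ.length+1)).map t.count) (t := hs b l μ)]
  swap
  · intro t ht
    have ht' := mem_filter.1 ht
    have e := count_len _ t fun i => (Fm t ht i).symm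
    have e2 := (PathsF_std hv ht'.1).2
    refine mem_hs.2 ⟨by simp, by omega, ?_, fun i => ?_⟩
    · rw [Fm t ht]
      have := List.count_le_length (l := t) (a := 0)
      omega
    · rw [Fm t ht, Fm t ht, ← hc]
      exact ⟨PathsF_count ht'.1 i, ht'.2 i⟩
  refine sum_congr rfl fun u hu => ?_
  obtain ⟨h1, h2, h3, h4⟩ := mem_hs.1 hu
  obtain ⟨w, hw, hwc⟩ := exists_std (Pt_hs hu)
  obtain ⟨t0, ht0, hp⟩ := path_exists hv l w hw (fun i => by rw [hc, hwc]; exact (h4 i).1)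
    (by rw [count_len u w hwc, hlen, h2])
  have hS := PathsF_std hv ht0
  have hc0 : ∀ i, t0.count i = gd u i := fun i => by rw [← hp.count_eq, hwc]
  have hH : HSt v t0 := fun i => by rw [hc0, hc]; exact (h4 i).2
  have eF : ((PathsF v l).filter (HSt v)).filter (fun t => (List.range (μ.length+1)).map t.count = u) = Fil v l t0 := by
    ext t
    rw [mem_filter, mem_Fil]
    constructor
    · rintro ⟨ht, e⟩
      refine ⟨(mem_filter.1 ht).1, List.perm_iff_count.2 fun i => ?_⟩
      rw [hc0, ← e, Fm t ht]
    · rintro ⟨ht, e⟩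
      have hm : t ∈ (PathsF v l).filter (HSt v) :=
        mem_filter.2 ⟨ht, fun i => by rw [← e.count_eq]; exact hH i⟩
      exact ⟨hm, gd_ext (by simp [h1]) fun i => by rw [Fm t hm, ← hc0, e.count_eq]⟩
  rw [eF, S.dp_eq hS.1 hc0]
  have hr : ∀ t ∈ PathsF v l, ∃ ρ : K, ϖ t * s * ϖ t = ρ • ϖ t := fun t ht => S.hk.rho SY hv rfl ht
  choose! ρ hρ using hr
  have key : ∀ t ∈ Fil v l t0, S.mu.tr K (v.length+l) (ϖ t * s * ϖ t) = ρ t * S.dd t0 := fun t ht => by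
    rw [mem_Fil] at ht
    have := PathsF_std hv ht.1
    rw [hρ t ht.1, ← this.2, S.mu.tr_smul _ (S.pp_loc t), S.dd_perm hS.1 this.1 ht.2, dd]
  rw [sum_congr rfl key, ← sum_mul]
  by_cases h0 : ϖ t0 = 0
  · rw [(S.dd_zero hS.1).2 h0, mul_zero]
  · rw [S.hk.pieri SY hv rfl hρ ht0 h0, if_pos hH, one_mul]
lemma dp_nat [CharZero K] (μ : List ℕ) : ∃ k : ℕ, S.dp μ = k := by
  rw [dp]
  split_ifs with h
  · exact S.dd_nat (exists_std h).choose_spec.1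
  · exact ⟨0, by simp⟩
def dN [CharZero K] (μ : List ℕ) : ℕ := (S.dp_nat μ).choose
def hN [CharZero K] (l : ℕ) : ℕ := (S.dd_nat (row_std l)).choose
lemma dN_spec [CharZero K] (μ : List ℕ) : S.dp μ = (S.dN μ : ℕ) := (S.dp_nat μ).choose_spec
lemma hN_spec [CharZero K] (l : ℕ) : S.dd (row l) = (S.hN l : ℕ) := (S.dd_nat (row_std l)).choose_spec
lemma ps [CharZero K] : PS (fun μ => (S.dN μ : ℝ)) (fun l => (S.hN l : ℝ)) where
  nonneg μ := by positivity
  nil := by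
    have : S.dp [] = 1 := by rw [S.dp_eq (w := []) trivial (by simp), dd]; exact S.mu.tr_one0
    rw [dN_spec] at this
    exact_mod_cast this
  pieri μ hμ l b hb := by
    have := S.pieri1 hμ hb
    simp only [dN_spec, hN_spec] at this
    exact_mod_cast this
end TS
lemma HK.neg (h : HK q T) : HK q (fun i => (q-1) • 1 - T i) where
  q0 := h.q0
  qn := h.qn
  quad i := by
    have := h.quad i
    simp only [sub_mul, mul_sub, smul_mul_assoc, mul_smul_comm, one_mul, mul_one, this]
    module
  braid i := by
    have := h.quad i
    have h2 := h.quad (i+1)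
    have h3 := h.braid i
    simp only [sub_mul, mul_sub, smul_mul_assoc, mul_smul_comm, one_mul, mul_one, this, h2, h3]
    module
  far i j hij := ((Commute.one_left _).smul_left _).sub_left
    (((Commute.one_right _).smul_right _).sub_right (h.far i j hij))
def col : ℕ → List ℕ
  | 0 => []
  | l+1 => l :: col l
lemma col_len (l : ℕ) : (col l).length = l := by
  induction l with
  | zero => rfl
  | succ l ih => simp [col, ih]
lemma col_count (l i : ℕ) : (col l).count i = if i < l then 1 else 0 := by
  induction l with
  | zero => simp [col]
  | succ l ih =>
    rw [col, cnt_cons, ih]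
    split_ifs <;> omega
lemma col_std (l : ℕ) : Std (col l) := by
  induction l with
  | zero => trivial
  | succ l ih =>
    refine ih.cons_of_rem ?_
    rw [col_count, col_count, if_neg (by omega)]
    split_ifs <;> omega
lemma col_split (k l : ℕ) (hk : k ≤ l) : ∃ s, col l = s ++ col k := by
  induction hk with
  | refl => exact ⟨[], rfl⟩
  | step _ ih => obtain ⟨s, e⟩ := ih; exact ⟨_ :: s, by rw [col, e]; rfl⟩
lemma HK.col_T (h : HK q T) {l i : ℕ} (hi : i + 2 ≤ l) : T i * ϖ (col l) = -ϖ (col l) := by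
  obtain ⟨s, e⟩ := col_split (i+2) l hi
  have := h.pp_pre (s := s) (w := col (i+2)) (by rw [← e]; exact col_std _)
  rw [← e] at this
  have t2 : T i * ϖ (col (i+2)) = - ϖ (col (i+2)) := by
    rcases h.TPdec (v := col i) (j := i) (r := i+1) (col_std (i+2)) with ⟨_, h2, _⟩ | ⟨_, h2⟩
    · have h2 := (h2.2.mem_iff _).1 h2.1
      simp only [col_count] at h2
      simp at h2
    · rw [col_len, if_neg (by omega), neg_smul, one_smul] at h2
      exact h2
  rw [← this.1, ← mul_assoc, t2, neg_mul]
lemma hs_col {M : Type*} [AddCommMonoid M] (f : List ℕ → M) (i c : ℕ) :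
    ∑ t ∈ hs 1 c (List.replicate i 1), f t = if c ≤ 1 then f (List.replicate i 1 ++ [c]) else 0 := by
  induction i generalizing c f with
  | zero => simp only [List.replicate_zero, hs]; split_ifs <;> simp
  | succ i ih =>
    rw [List.replicate_succ, hs_sum, sum_eq_single 0]
    · rw [if_pos (by omega), ih]; rfl
    · intro j _ hj; rw [if_neg (by omega)]
    · simp
namespace TS
variable {r : ι → ι → ι → ι → K} {E : ℕ → ι → ι → B} (S : TS q r E T)
include S
lemma neg : TS q (fun a b c d => (if a = c then if b = d then q - 1 else 0 else 0) - r a b c d) E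
    (fun i => (q-1) • 1 - T i) where
  hk := S.hk.neg
  mu := S.mu
  tf k := by
    have e : (1 : B) = ∑ a, ∑ b, E k a a * E (k+1) b b := by
      simp only [← mul_sum, S.mu.one, mul_one]
    show (q-1) • (1:B) - T k = _
    rw [S.tf k, e]
    simp [sub_smul, ite_smul, Finset.sum_sub_distrib, smul_sum]
variable [Nontrivial B] [Nonempty ι]
lemma dd_col (l : ℕ) : S.dd (col l) = S.neg.dd (row l) := by
  have hk := S.hk
  have hk' := hk.neg
  have a1 : pp q (fun i => (q-1) • 1 - T i) (row l) * ϖ (col l) = ϖ (col l) := by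
    have := hk'.sfix (hk'.SYrow 0) (l := l) (x := ϖ (col l)) fun i hi => by
      rw [zero_add, sub_mul, hk.col_T hi, smul_mul_assoc, one_mul]; module
    simpa using this
  set p' := pp q (fun i => (q-1) • 1 - T i) (row l) with hp'
  have hT : ∀ i, i + 2 ≤ l → T i * p' = -p' := fun i hi => by
    have := hk'.row_T hi
    rw [← hp', sub_mul, smul_mul_assoc, one_mul] at this
    linear_combination (norm := module) -this
  have hJ : ∀ k, k < l → JM q T k * p' = (q ^ (-(k:ℤ))) • p' := by
    intro k
    induction k with
    | zero => intro _; simp [JM]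
    | succ k ih =>
      intro hk1
      rw [JM, smul_mul_assoc, mul_assoc, hT k (by omega), mul_assoc, mul_neg, ih (by omega), mul_neg,
        mul_smul_comm, hT k (by omega), smul_neg, smul_neg, smul_neg, neg_neg, smul_smul]
      congr 1
      rw [← zpow_neg_one, ← zpow_add₀ hk.q0]
      congr 1; push_cast; ring
  have a2 : ∀ k ≤ l, ϖ (col k) * p' = p' := by
    intro k
    induction k with
    | zero => intro _; simp [col, pp]
    | succ k ih =>
      intro hk1
      refine hk.pp_of_eig (col_std (k+1)) (ih (by omega)) ?_
      rw [col_len, hJ k (by omega), zz, ct, col_count, if_neg (by omega)]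
      simp
  have m1 := S.pp_loc (col l)
  have m2 := S.neg.pp_loc (row l)
  rw [col_len] at m1
  rw [List.length_replicate, ← hp'] at m2
  rw [dd, dd, ← hp', col_len, List.length_replicate]
  conv_lhs => rw [← a1]
  conv_rhs => rw [← a2 l le_rfl]
  exact S.mu.tr_comm m2 m1
lemma box {v : List ℕ} (hv : Std v) : S.dd v * S.dd [0] = ∑ a ∈ AddR v, S.dd (a :: v) := by
  have e := S.pieri0 hv 1 rfl
  rw [sum_PathsF_succ, PathsF, Finset.sum_singleton] at e
  refine e.trans (sum_congr rfl fun a ha => ?_)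
  have s1 := (S.hk.SYrow v.length).s1
  rw [s1, mul_one, S.hk.pp_id (show Std (a :: v) from ⟨ha, hv⟩)]
  rfl
variable [CharZero K]
def dw (w : List ℕ) : ℕ := open Classical in if h : Std w then (S.dd_nat h).choose else 0
lemma dw_spec {w : List ℕ} (hw : Std w) : S.dd w = (S.dw w : ℕ) := by
  rw [dw, dif_pos hw]; exact (S.dd_nat hw).choose_spec
lemma stair_step (c : ℕ) : ∀ (w f : List ℕ) (X : Finset ℕ), Std w → Std f → X.card = c → (∀ a ∈ X, a ∈ AddR w) →
    (∀ i, f.count i = w.count i + if i ∈ X then 1 else 0) → c.factorial * S.dw f ≤ S.dw [0] ^ c * S.dw w := by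
  induction c with
  | zero =>
    intro w f X hw hf hX _ hc
    rw [Finset.card_eq_zero] at hX
    subst hX
    have : S.dw w = S.dw f := by
      have := S.dd_perm hw hf (List.perm_iff_count.2 fun i => by simp [hc i])
      rw [S.dw_spec hw, S.dw_spec hf] at this
      exact_mod_cast this
    simp [this]
  | succ c ih =>
    intro w f X hw hf hX hA hc
    have b := S.box hw
    have hz : Std [0] := row_std 1
    have b : S.dw w * S.dw [0] = ∑ a ∈ AddR w, S.dw (a :: w) := by
      rw [S.dw_spec hw, S.dw_spec hz,
        sum_congr rfl fun a ha => S.dw_spec (show Std (a :: w) from ⟨ha, hw⟩)] at b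
      exact_mod_cast b
    have h1 : ∀ a ∈ X, c.factorial * S.dw f ≤ S.dw [0] ^ c * S.dw (a :: w) := fun a ha => by
      have hs : Std (a :: w) := ⟨hA a ha, hw⟩
      refine ih (a :: w) f (X.erase a) hs hf (by rw [Finset.card_erase_of_mem ha, hX]; rfl) (fun b hb => ?_) fun i => ?_
      · rw [Finset.mem_erase] at hb
        have := (hw.mem_iff b).1 (hA b hb.2)
        rw [hs.mem_iff, cnt_cons, cnt_cons, if_neg (Ne.symm hb.1)]
        rcases this with h | h
        · exact Or.inl h
        · right; omega
      · rw [hc, cnt_cons]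
        by_cases e : a = i
        · subst e; simp [ha]
        · simp [e, Ne.symm e]
    calc (c+1).factorial * S.dw f = ∑ a ∈ X, c.factorial * S.dw f := by
          rw [Finset.sum_const, hX, Nat.factorial_succ, smul_eq_mul, mul_assoc]
      _ ≤ ∑ a ∈ X, S.dw [0] ^ c * S.dw (a :: w) := Finset.sum_le_sum h1
      _ ≤ ∑ a ∈ AddR w, S.dw [0] ^ c * S.dw (a :: w) :=
          Finset.sum_le_sum_of_subset_of_nonneg hA fun _ _ _ => Nat.zero_le _
      _ = _ := by rw [← mul_sum, ← b]; ring
lemma van : ∃ κ, Pt κ ∧ S.dN κ = 0 := by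
  by_contra hcon
  push Not at hcon
  have gs : ∀ k i, gd ((List.range k).map fun i => k - i) i = k - i := fun k i => by
    by_cases h : i < k
    · simp [gd, List.getD_eq_getElem?_getD, h]
    · rw [gd, List.getD_eq_default]
      · omega
      · simp; omega
  have pt : ∀ k, Pt ((List.range k).map fun i => k - i) := fun k i => by rw [gs, gs]; omega
  choose w hw hc using fun k => exists_std (pt k)
  have pos : ∀ k, 0 < S.dw (w k) := fun k => by
    have := S.dp_eq (hw k) (hc k)
    rw [dN_spec, S.dw_spec (hw k)] at this
    have : S.dN ((List.range k).map fun i => k - i) = S.dw (w k) := by exact_mod_cast this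
    rw [← this]; exact Nat.pos_of_ne_zero (hcon _ (pt k))
  have step : ∀ k, (k+1).factorial * S.dw (w (k+1)) ≤ S.dw [0] ^ (k+1) * S.dw (w k) := fun k => by
    refine S.stair_step (k+1) (w k) (w (k+1)) (Finset.range (k+1)) (hw _) (hw _) (by simp) (fun a ha => ?_) fun i => ?_
    · rw [(hw k).mem_iff, hc, hc, gs, gs]
      have := mem_range.1 ha
      omega
    · rw [hc, hc, gs, gs]
      simp only [mem_range]
      split_ifs <;> omega
  obtain ⟨k0, hk0⟩ := Filter.eventually_atTop.1 (Nat.eventually_pow_lt_factorial_sub (S.dw [0]) 0)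
  have dec : ∀ j, S.dw (w (k0+j)) + j ≤ S.dw (w k0) := by
    intro j
    induction j with
    | zero => simp
    | succ j ih =>
      have h1 := step (k0+j)
      have h2 := hk0 (k0+j+1) (by omega)
      rw [Nat.sub_zero] at h2
      have : S.dw (w (k0+j+1)) < S.dw (w (k0+j)) := by
        by_contra hle
        push Not at hle
        have := Nat.mul_lt_mul_of_lt_of_le h2 hle (pos _)
        omega
      have e : k0 + (j+1) = k0+j+1 := rfl
      rw [e]; omega
  have := dec (S.dw (w k0) + 1)
  omega
lemma dp_trail {μ : List ℕ} (hμ : Pt μ) : S.dp (μ ++ [0]) = S.dp μ := by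
  obtain ⟨w, hw, hc⟩ := exists_std hμ
  rw [S.dp_eq hw hc]
  refine S.dp_eq hw fun i => ?_
  rw [hc]
  by_cases h : i < μ.length
  · rw [gd, gd, List.getD_append _ _ _ _ h]
  · rw [gd, gd, List.getD_append_right _ _ _ _ (by omega), List.getD_eq_default _ _ (by omega)]
    cases i - μ.length <;> simp
lemma pieri_col (j k : ℕ) : S.dd (row (j+1)) * S.dp (List.replicate (k+1) 1) =
    S.dp ((j+2) :: List.replicate k 1) + S.dp ((j+1) :: List.replicate (k+1) 1) := by
  have pc : ∀ k, Pt (List.replicate k 1) := fun k => by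
    induction k with
    | zero => intro i; simp [gd]
    | succ k ih =>
      rw [List.replicate_succ, Pt_cons]
      refine ⟨?_, ih⟩
      cases k <;> simp [gd, List.replicate_succ]
  have pk : Pt ((j+2) :: List.replicate k 1) := by
    rw [Pt_cons]
    refine ⟨?_, pc k⟩
    cases k <;> simp [gd, List.replicate_succ]
  rw [S.pieri1 (pc (k+1)) (le_refl _), List.replicate_succ, hs_sum, Finset.sum_range_succ, Finset.sum_range_succ,
    sum_eq_zero]
  · rw [if_pos (by simp; omega), if_pos (by simp; omega), hs_col, hs_col, if_pos (by omega), if_pos (by omega), zero_add,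
      add_comm, add_comm 1 (j+1), Nat.sub_self, ← List.cons_append, S.dp_trail pk, add_comm 1 j,
      Nat.add_sub_cancel_left, ← List.replicate_succ']
    rfl
  · intro c hc
    rw [mem_range] at hc
    rw [hs_col, if_neg (by omega : ¬ (j+1-c ≤ 1)), ite_self]
lemma dp_one (l : ℕ) : S.dp [l] = S.dd (row l) :=
  S.dp_eq (row_std l) fun i => by
    cases i with
    | zero => simp [gd, row]
    | succ i => simp [gd, row, List.count_replicate]
lemma dp_col (l : ℕ) : S.dp (List.replicate l 1) = S.neg.dd (row l) := by
  rw [← S.dd_col]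
  refine S.dp_eq (col_std l) fun i => ?_
  rw [col_count, gd, List.getD_eq_getElem?_getD, List.getElem?_replicate]
  split_ifs <;> rfl
lemma koszul (L : ℕ) : ∑ i ∈ Finset.range (L+2), (-1:ℝ)^i * S.neg.hN i * S.hN (L+1-i) = 0 := by
  have key : ∑ i ∈ Finset.range (L+2), (-1:K)^i * S.neg.dd (row i) * S.dd (row (L+1-i)) = 0 := by
    have part : ∀ m ≤ L, ∑ i ∈ Finset.range (m+1), (-1:K)^i * S.neg.dd (row i) * S.dd (row (L+1-i)) =
        (-1)^m * S.dp ((L+1-m) :: List.replicate m 1) := by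
      intro m
      induction m with
      | zero =>
        intro _
        rw [Finset.sum_range_one, List.replicate_zero, Nat.sub_zero, S.dp_one, ← S.dp_col]
        have : S.dp (List.replicate 0 1) = 1 := by
          rw [List.replicate_zero]
          have := S.ps.nil
          rw [dN_spec]; exact_mod_cast this
        rw [this]; ring
      | succ m ih =>
        intro hm
        rw [Finset.sum_range_succ, ih (by omega), ← S.dp_col]
        have := S.pieri_col (L - m - 1) m
        rw [show L - m - 1 + 1 = L + 1 - (m+1) by omega, show L - m - 1 + 2 = L + 1 - m by omega] at this
        rw [mul_assoc, mul_comm (S.dp _), this]; ring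
    rw [Finset.sum_range_succ, part L le_rfl, ← S.dp_col (L+1), show L + 1 - L = 1 by omega, Nat.sub_self,
      ← List.replicate_succ]
    have : S.dd (row 0) = 1 := by
      rw [← S.dp_one, dN_spec]
      have h0 := S.dp_trail (μ := []) (fun i => by simp [gd])
      have := S.ps.nil
      rw [List.nil_append, dN_spec, dN_spec] at h0
      rw [h0]; exact_mod_cast this
    rw [this]; ring
  simp only [hN_spec] at key
  have : ∑ i ∈ Finset.range (L+2), (-1:ℤ)^i * S.neg.hN i * S.hN (L+1-i) = 0 := by exact_mod_cast key
  exact_mod_cast this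
end TS
lemma sum4 {M : Type*} [AddCommMonoid M] (f : ι → ι → ι → ι → M) :
    ∑ a, ∑ b, ∑ c, ∑ d, f a b c d = ∑ c, ∑ d, ∑ a, ∑ b, f a b c d := by
  simp only [← Fintype.sum_prod_type']
  exact Fintype.sum_equiv ⟨fun x => (x.2.2.1, x.2.2.2, x.1, x.2.1), fun x => (x.2.2.1, x.2.2.2, x.1, x.2.1),
    fun _ => rfl, fun _ => rfl⟩ _ _ fun _ => rfl
def mon {A : Type} [Ring A] (e : ι → A) : ∀ l, Ix ι l → A
  | 0, _ => 1
  | l+1, i => mon e l (ini i) * e (i (Fin.last l))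
lemma mon_sn {A : Type} [Ring A] (e : ι → A) {l : ℕ} (i : Ix ι l) (a : ι) :
    mon e (l+1) (sn i a) = mon e l i * e a := by simp [mon, sn, ini]
lemma span_mon {A : Type} [Ring A] [Algebra K A] (e : ι → A) (l : ℕ) :
    Submodule.span K (Set.range e) ^ l = Submodule.span K (Set.range (mon e l)) := by
  induction l with
  | zero =>
    rw [pow_zero, Submodule.one_eq_span]
    congr 1
    ext x; simp [mon, eq_comm]
  | succ l ih =>
    rw [pow_succ, ih, Submodule.span_mul_span]
    congr 1
    ext x
    constructor
    · rintro ⟨_, ⟨i, rfl⟩, _, ⟨a, rfl⟩, rfl⟩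
      exact ⟨sn i a, mon_sn e i a⟩
    · rintro ⟨i, rfl⟩
      exact ⟨_, ⟨ini i, rfl⟩, _, ⟨i (Fin.last l), rfl⟩, rfl⟩
namespace TS
variable {r : ι → ι → ι → ι → K} {E : ℕ → ι → ι → B} (S : TS q r E T)
include S
lemma T_right (k : ℕ) (o c d : ι) : T k * (E k c o * E (k+1) d o) = ∑ a, ∑ b, r a b c d • (E k a o * E (k+1) b o) := by
  have H := S.mu
  rw [S.tf k]
  have : ∀ a b c' d', E k a c' * E (k+1) b d' * (E k c o * E (k+1) d o) =
      if c' = c then if d' = d then E k a o * E (k+1) b o else 0 else 0 := fun a b c' d' => by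
    rw [mul_assoc, ← mul_assoc (E (k+1) _ _), (H.comm (k+1) k (by omega) b d' c o).eq, mul_assoc, ← mul_assoc,
      H.mul, H.mul]
    split_ifs <;> simp
  simp only [sum_mul, smul_mul_assoc, this, smul_ite, smul_zero]
  simp
lemma T_left (k : ℕ) (o a b : ι) : E k o a * E (k+1) o b * T k = ∑ c, ∑ d, r a b c d • (E k o c * E (k+1) o d) := by
  have H := S.mu
  rw [S.tf k]
  have : ∀ a' b' c d, E k o a * E (k+1) o b * (E k a' c * E (k+1) b' d) =
      if a' = a then if b' = b then E k o c * E (k+1) o d else 0 else 0 := fun a' b' c d => by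
    rw [mul_assoc, ← mul_assoc (E (k+1) _ _), (H.comm (k+1) k (by omega) o b a' c).eq, mul_assoc, ← mul_assoc,
      H.mul, H.mul]
    simp only [eq_comm (a := a), eq_comm (a := b)]
    split_ifs <;> simp
  simp only [mul_sum, mul_smul_comm, this, smul_ite, smul_zero]
  rw [sum_eq_single a (fun x _ hx => by simp [hx]) (by simp)]
  rw [sum_eq_single b (fun x _ hx => by simp [hx]) (by simp)]
  simp
lemma fixP {C : Type} [Ring C] [Algebra K C] (g : B →ₐ[K] C) (x : C) (l : ℕ)
    (h : ∀ k, k + 2 ≤ l → x * g (T k) = q • x) : x * g (ϖ (row l)) = x := by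
  induction l with
  | zero => simp [row, pp]
  | succ l ih =>
    rcases l with _ | l
    · have := (S.hk.SYrow 0).s1
      simp only [zero_add] at this
      rw [this]; simp
    · obtain ⟨κ, hκ, e⟩ := S.hk.row_rec l
      have ih := ih fun k hk => h k (by omega)
      have := congrArg (fun y => x * g y) e
      simp only [map_smul, map_sub, map_mul, mul_sub, mul_smul_comm] at this
      rw [← mul_assoc, ← mul_assoc, ih, h l le_rfl, smul_mul_assoc, ih, ← sub_smul] at this
      exact smul_right_injective _ hκ this
variable {A : Type} [Ring A] [Algebra K A] {e : ι → A}
def om (S : TS q r E T) (e : ι → A) (o : ι) (k : ℕ) : A ⊗[K] B := ∑ a, e a ⊗ₜ[K] E k o a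
def Om (S : TS q r E T) (e : ι → A) (o : ι) (l : ℕ) : A ⊗[K] B :=
  ∑ i : Ix ι l, mon e l i ⊗ₜ[K] eU E l (fun _ => o) i
lemma Om_succ (o : ι) (l : ℕ) : S.Om e o (l+1) = S.Om e o l * S.om e o l := by
  have : (fun _ => o : Ix ι (l+1)) = sn (fun _ => o) o := by
    funext i; refine Fin.lastCases ?_ (fun j => ?_) i <;> simp [sn]
  simp only [Om, om, ix_sum, this, mon_sn, eU_sn, Finset.sum_mul_sum, Algebra.TensorProduct.tmul_mul_tmul]
lemma om_T (he : ∀ c d, ∑ a, ∑ b, r a b c d • (e a * e b) = q • (e c * e d)) (o : ι) (k : ℕ) :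
    S.om e o k * S.om e o (k+1) * ((1:A) ⊗ₜ[K] T k) = q • (S.om e o k * S.om e o (k+1)) := by
  rw [om, om, Finset.sum_mul_sum]
  simp only [Algebra.TensorProduct.tmul_mul_tmul, sum_mul, mul_one, S.T_left,
    tmul_sum, tmul_smul]
  have : ∀ c d, q • ((e c * e d) ⊗ₜ[K] (E k o c * E (k+1) o d)) =
      ∑ a, ∑ b, r a b c d • ((e a * e b) ⊗ₜ[K] (E k o c * E (k+1) o d)) := fun c d => by
    rw [smul_tmul', ← he]; simp only [sum_tmul, smul_tmul']
  simp only [smul_sum, this]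
  exact sum4 fun a b c d => r a b c d • ((e a * e b) ⊗ₜ[K] (E k o c * E (k+1) o d))
lemma Om_T (he : ∀ c d, ∑ a, ∑ b, r a b c d • (e a * e b) = q • (e c * e d)) (o : ι) {k l : ℕ} (hk : k + 2 ≤ l) :
    S.Om e o l * ((1:A) ⊗ₜ[K] T k) = q • S.Om e o l := by
  obtain ⟨j, rfl⟩ := Nat.exists_eq_add_of_le hk
  clear hk
  induction j with
  | zero =>
    rw [add_zero, S.Om_succ, S.Om_succ, mul_assoc, mul_assoc, ← mul_assoc (S.om e o k), S.om_T he, mul_smul_comm, mul_assoc]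
  | succ j ih =>
    rw [← add_assoc, S.Om_succ, mul_assoc]
    have : Commute (S.om e o (k+2+j)) ((1:A) ⊗ₜ[K] T k) := by
      refine Commute.sum_left _ _ _ fun a _ => ?_
      have : Commute (E (k+2+j) o a) (T k) := by
        rw [S.tf k]
        exact Commute.sum_right _ _ _ fun _ _ => Commute.sum_right _ _ _ fun _ _ => Commute.sum_right _ _ _ fun _ _ =>
          Commute.sum_right _ _ _ fun _ _ => ((S.mu.comm _ _ (by omega) _ _ _ _).mul_right
            (S.mu.comm _ _ (by omega) _ _ _ _)).smul_right _
      rw [Commute, SemiconjBy, Algebra.TensorProduct.tmul_mul_tmul, Algebra.TensorProduct.tmul_mul_tmul, this.eq,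
        mul_one, one_mul]
    rw [this.eq, ← mul_assoc, ih, smul_mul_assoc]
variable [Nontrivial B] [Nonempty ι]
lemma mon_P (he : ∀ c d, ∑ a, ∑ b, r a b c d • (e a * e b) = q • (e c * e d)) (l : ℕ)
    {M : Matrix (Ix ι l) (Ix ι l) K} (hM : S.mu.op K l M = ϖ (row l)) (j : Ix ι l) :
    ∑ i, M i j • mon e l i = mon e l j := by
  obtain ⟨o⟩ := ‹Nonempty ι›
  have h1 := S.fixP (Algebra.TensorProduct.includeRight : B →ₐ[K] A ⊗[K] B) (S.Om e o l) l
    fun k hk => S.Om_T he o hk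
  rw [← hM] at h1
  have h2 := congrArg (fun y => y * ((1:A) ⊗ₜ[K] eU E l j (fun _ => o))) h1
  simp only [Algebra.TensorProduct.includeRight_apply, mul_assoc, Algebra.TensorProduct.tmul_mul_tmul, one_mul] at h2
  simp only [Om, MUF.op_apply, sum_mul, Algebra.TensorProduct.tmul_mul_tmul, smul_mul_assoc, S.mu.eU_mul,
    mul_one, smul_ite, smul_zero, Finset.sum_ite_eq', Finset.sum_ite_eq, Finset.mem_univ, if_true, mul_sum, mul_smul_comm,
    mul_ite, mul_zero, ← sum_smul] at h2
  have hne : eU E l (fun _ => o) (fun _ => o) ≠ 0 := fun h0 => by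
    have : S.mu.op K l (Matrix.single (fun _ => o) (fun _ => o) 1) = S.mu.op K l 0 := by
      rw [map_zero, MUF.op_apply, ← h0]
      simp [Matrix.single_apply, ite_and]
    have := congrFun (congrFun (S.mu.op_inj l this) fun _ => o) fun _ => o
    simp at this
  obtain ⟨f, hf⟩ := Module.Projective.exists_dual_eq_one K hne
  rw [sum_eq_single (a := j) (f := fun x => mon e l x ⊗ₜ[K] ite _ _ _) (fun x _ hx => by rw [if_neg hx, tmul_zero])
    (by simp), if_pos rfl] at h2
  have h3 := congrArg (fun y => TensorProduct.rid K A (TensorProduct.map LinearMap.id f y)) h2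
  simpa [hf, TensorProduct.tmul_smul] using h3
def Ac (S : TS q r E T) (o a : ι) : Module.End K (ℕ → B) where
  toFun f := fun l => match l with
    | 0 => 0
    | l+1 => ϖ (row (l+1)) * (E l a o * f l)
  map_add' f g := by funext l; cases l <;> simp [mul_add]
  map_smul' c f := by funext l; cases l <;> simp
lemma Ac_rel (o c d : ι) : ∑ a, ∑ b, r a b c d • (S.Ac o b * S.Ac o a) = q • (S.Ac o d * S.Ac o c) := by
  have key : ∀ a b, ∀ (f : ℕ → B) l, (S.Ac o b * S.Ac o a) f (l+2) =
      ϖ (row (l+2)) * (E l a o * E (l+1) b o) * f l := fun a b f l => by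
    show ϖ (row (l+2)) * (E (l+1) b o * (ϖ (row (l+1)) * (E l a o * f l))) = _
    have h1 := S.mu.Loc_comm (k := l+1) (by simp) (S.pp_loc (row (l+1))) b o
    have h2 : ϖ (row (l+2)) * ϖ (row (l+1)) = ϖ (row (l+2)) := by
      simpa using ((S.hk.SYrow 0).ss (l+2) (l+1) (by omega)).1
    rw [← mul_assoc (E (l+1) b o), ← h1.eq, mul_assoc, ← mul_assoc, h2, ← mul_assoc (E (l+1) b o),
      (S.mu.comm (l+1) l (by omega) b o a o).eq, mul_assoc, mul_assoc, mul_assoc]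
  ext f l
  rcases l with _ | _ | l
  · simp [Ac]
  · simp [Ac]
  · simp only [LinearMap.sum_apply, Finset.sum_apply, LinearMap.smul_apply, Pi.smul_apply, key]
    have : q • ϖ (row (l+2)) = ϖ (row (l+2)) * T l := (S.hk.row_T' le_rfl).symm
    rw [← smul_mul_assoc, ← smul_mul_assoc, this, mul_assoc _ (T l), S.T_right]
    simp only [mul_sum, sum_mul, mul_smul_comm, smul_mul_assoc]
lemma finrank_mon [CharZero K] (he : ∀ c d, ∑ a, ∑ b, r a b c d • (e a * e b) = q • (e c * e d))
    (hU : ∀ (C : Type) [Ring C] [Algebra K C] (g : ι → C),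
      (∀ c d, ∑ a, ∑ b, r a b c d • (g a * g b) = q • (g c * g d)) → ∃ φ : A →ₐ[K] C, ∀ a, φ (e a) = g a) (l : ℕ) :
    Module.finrank K (Submodule.span K (Set.range (mon e l)) : Submodule K A) = S.hN l := by
  obtain ⟨o⟩ := id ‹Nonempty ι›
  obtain ⟨φ, hφ⟩ := hU (Module.End K (ℕ → B))ᵐᵒᵖ (fun a => MulOpposite.op (S.Ac o a)) fun c d => by
    simp only [← MulOpposite.op_mul, ← MulOpposite.op_smul]
    rw [← S.Ac_rel]
    have : ∀ (f : ι → Module.End K (ℕ → B)), MulOpposite.op (∑ a, f a) = ∑ a, MulOpposite.op (f a) :=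
      fun f => map_sum MulOpposite.opAddEquiv f _
    simp only [this]
  have hψ : ∀ l (i : Ix ι l), (φ (mon e l i)).unop (Pi.single 0 1) l = ϖ (row l) * eU E l i (fun _ => o) := by
    intro l
    induction l with
    | zero => intro i; simp [mon, eU, row, pp]
    | succ l ih =>
      intro i
      rw [mon, map_mul, MulOpposite.unop_mul, hφ, MulOpposite.unop_op, Module.End.mul_apply]
      show ϖ (row (l+1)) * (E l _ o * _) = _
      have h1 := S.mu.Loc_comm (k := l) (by simp) (S.pp_loc (row l)) (i (Fin.last l)) o
      have h2 : ϖ (row (l+1)) * ϖ (row l) = ϖ (row (l+1)) := by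
        simpa using ((S.hk.SYrow 0).ss (l+1) l (by omega)).1
      rw [ih, ← mul_assoc (E l _ o), ← h1.eq, mul_assoc, ← mul_assoc, h2, ← (S.mu.eU_comm le_rfl _ _ _ _).eq]
      rfl
  have hm := S.pp_loc (row l)
  rw [List.length_replicate] at hm
  obtain ⟨M, hM⟩ := S.mu.mem_Loc.1 hm
  have hP := S.mon_P he l hM
  have hker : LinearMap.ker (Fintype.linearCombination K (mon e l)) = LinearMap.ker (Matrix.toLin' M) := by
    ext f
    rw [LinearMap.mem_ker, LinearMap.mem_ker, Fintype.linearCombination_apply]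
    constructor
    · intro h0
      have h1 := congrArg (fun x => (φ x).unop (Pi.single 0 1) l) h0
      simp only [map_sum, map_smul, map_zero, MulOpposite.unop_zero, LinearMap.zero_apply, Pi.zero_apply] at h1
      have uns : ∀ (g : Ix ι l → (Module.End K (ℕ → B))ᵐᵒᵖ), (∑ a, g a).unop = ∑ a, (g a).unop :=
        fun g => map_sum MulOpposite.opAddEquiv.symm g _
      simp only [uns, LinearMap.sum_apply, Finset.sum_apply, MulOpposite.unop_smul, LinearMap.smul_apply,
        Pi.smul_apply, hψ] at h1
      have h2 : S.mu.op K l (M * Matrix.of fun i j => if j = (fun _ => o) then f i else 0) = S.mu.op K l 0 := by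
        rw [map_mul, hM, map_zero, ← h1, MUF.op_apply, mul_sum]
        refine sum_congr rfl fun i _ => ?_
        simp [ite_smul]
      have h3 := S.mu.op_inj l h2
      funext i
      have := congrFun (congrFun h3 i) fun _ => o
      simpa [Matrix.mul_apply, Matrix.mulVec, dotProduct] using this
    · intro h0
      have : ∀ i, ∑ j, M i j * f j = 0 := fun i => congrFun h0 i
      have e1 : ∑ j, f j • mon e l j = ∑ j, f j • ∑ i, M i j • mon e l i :=
        sum_congr rfl fun j _ => by rw [hP]
      rw [e1]
      simp only [smul_sum]
      rw [sum_comm]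
      refine sum_eq_zero fun i _ => ?_
      simp only [smul_smul, ← sum_smul, mul_comm (f _), this, zero_smul]
  have hMM : M * M = M := S.mu.op_inj l (by rw [map_mul, hM, S.hk.pp_id (row_std l)])
  have hi : IsIdempotentElem (Matrix.toLin' M) := by
    rw [IsIdempotentElem, Module.End.mul_eq_comp, ← Matrix.toLin'_mul, hMM]
  have t1 := (LinearMap.IsIdempotentElem.isProj_range _ hi).trace
  have t2 : S.dd (row l) = M.trace := by
    rw [dd, List.length_replicate, ← hM, S.mu.tr_op]
  rw [Matrix.trace_toLin'_eq, ← t2, S.hN_spec] at t1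
  have t1 : S.hN l = Module.finrank K (LinearMap.range (Matrix.toLin' M)) := by exact_mod_cast t1
  rw [t1, ← Fintype.range_linearCombination]
  have r1 := LinearMap.finrank_range_add_finrank_ker (Fintype.linearCombination K (mon e l))
  have r2 := LinearMap.finrank_range_add_finrank_ker (Matrix.toLin' M)
  rw [hker] at r1
  omega
end TS
def EE (K : Type) [Field K] (ι : Type) [DecidableEq ι] (k : ℕ) (a c : ι) : Module.End K ((ℕ → ι) → K) where
  toFun f σ := if σ k = a then f (Function.update σ k c) else 0
  map_add' f g := by funext σ; simp only [Pi.add_apply]; split_ifs <;> simp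
  map_smul' x f := by funext σ; simp only [Pi.smul_apply, RingHom.id_apply]; split_ifs <;> simp
lemma EE_mu : MUF (EE K ι) where
  mul k a b c d := by
    ext f σ
    simp only [EE, Module.End.mul_apply, LinearMap.coe_mk, AddHom.coe_mk, Function.update_self, Function.update_idem]
    split_ifs <;> simp [*]
  one k := by
    ext f σ
    simp [EE, LinearMap.sum_apply, Finset.sum_apply]
  comm k l hkl a b c d := by
    refine LinearMap.ext fun f => funext fun σ => ?_
    simp only [EE, Module.End.mul_apply, LinearMap.coe_mk, AddHom.coe_mk, Function.update_of_ne hkl,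
      Function.update_of_ne hkl.symm]
    rw [Function.update_comm hkl]
    split_ifs <;> rfl
section
variable {I J : Type} [Fintype I] [DecidableEq I] [Fintype J] [DecidableEq J]
def pU (e : I → I → B) (f : J → J → B) (x y : I × J) : B := e x.1 y.1 * f x.2 y.2
lemma pU_mul {e : I → I → B} {f : J → J → B} (he : ∀ a b c d, e a b * e c d = if b = c then e a d else 0)
    (hf : ∀ a b c d, f a b * f c d = if b = c then f a d else 0) (hc : ∀ a b c d, Commute (e a b) (f c d)) :
    ∀ a b c d, pU e f a b * pU e f c d = if b = c then pU e f a d else 0 := by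
  rintro ⟨a, a'⟩ ⟨b, b'⟩ ⟨c, c'⟩ ⟨d, d'⟩
  simp only [pU, Prod.mk.injEq]
  rw [mul_assoc, ← mul_assoc (f _ _), ← (hc _ _ _ _).eq, mul_assoc, ← mul_assoc (e _ _), he, hf, ite_and]
  split_ifs <;> simp
lemma pU_one {e : I → I → B} {f : J → J → B} (he : ∑ a, e a a = 1) (hf : ∑ a, f a a = 1) :
    ∑ a, pU e f a a = 1 := by
  simp only [pU, Fintype.sum_prod_type, ← mul_sum, hf, mul_one, he]
end
def rR {V : Type} [AddCommGroup V] [Module K V] (R : V ⊗[K] V →ₗ[K] V ⊗[K] V) (b : Module.Basis ι K V) (x y c d : ι) : K :=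
  (b.tensorProduct b).repr (R (b c ⊗ₜ[K] b d)) (x, y)
section
variable {V : Type} [AddCommGroup V] [Module K V] (R : V ⊗[K] V →ₗ[K] V ⊗[K] V) (b : Module.Basis ι K V)
lemma rR_apply (c d : ι) : R (b c ⊗ₜ[K] b d) = ∑ x, ∑ y, rR R b x y c d • (b x ⊗ₜ[K] b y) := by
  rw [← (b.tensorProduct b).sum_repr (R (b c ⊗ₜ[K] b d)), Fintype.sum_prod_type]
  simp [rR]
def TT (k : ℕ) : Module.End K ((ℕ → ι) → K) :=
  ∑ x, ∑ y, ∑ c, ∑ d, rR R b x y c d • (EE K ι k x c * EE K ι (k+1) y d)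
def Ph2 (K ι : Type) [Field K] [Fintype ι] [DecidableEq ι] (k : ℕ) :
    Matrix (ι × ι) (ι × ι) K →ₐ[K] Module.End K ((ℕ → ι) → K) :=
  muHom K (pU (EE K ι k) (EE K ι (k+1)))
    (pU_mul (EE_mu.mul k) (EE_mu.mul (k+1)) (EE_mu.comm k (k+1) (by omega))) (pU_one (EE_mu.one _) (EE_mu.one _))
def Ph3 (K ι : Type) [Field K] [Fintype ι] [DecidableEq ι] (k : ℕ) :
    Matrix ((ι × ι) × ι) ((ι × ι) × ι) K →ₐ[K] Module.End K ((ℕ → ι) → K) :=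
  muHom K (pU (pU (EE K ι k) (EE K ι (k+1))) (EE K ι (k+2)))
    (pU_mul (pU_mul (EE_mu.mul k) (EE_mu.mul (k+1)) (EE_mu.comm k (k+1) (by omega))) (EE_mu.mul _)
      fun a b c d => (EE_mu.comm _ _ (by omega) _ _ _ _).mul_left (EE_mu.comm _ _ (by omega) _ _ _ _))
    (pU_one (pU_one (EE_mu.one _) (EE_mu.one _)) (EE_mu.one _))
lemma Ph2_R (k : ℕ) : Ph2 K ι k (LinearMap.toMatrixAlgEquiv (b.tensorProduct b) R) = TT R b k := by
  simp only [Ph2, muHom_apply, Fintype.sum_prod_type, LinearMap.toMatrixAlgEquiv_apply, Module.Basis.tensorProduct_apply,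
    pU, TT, rR]
lemma Ph3_R1 (k : ℕ) : Ph3 K ι k (LinearMap.toMatrixAlgEquiv ((b.tensorProduct b).tensorProduct b)
    (TensorProduct.map R LinearMap.id)) = TT R b k := by
  have : ∀ x y z c d f, LinearMap.toMatrixAlgEquiv ((b.tensorProduct b).tensorProduct b)
    (TensorProduct.map R LinearMap.id) ((x, y), z) ((c, d), f) = if f = z then rR R b x y c d else 0 := by
    intro x y z c d f
    simp [LinearMap.toMatrixAlgEquiv_apply, Module.Basis.tensorProduct_apply, rR, Finsupp.single_apply]
  simp only [Ph3, muHom_apply, Fintype.sum_prod_type, this, pU, ite_smul, zero_smul, Finset.sum_ite_eq',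
    Finset.mem_univ, if_true]
  rw [← mul_one (TT R b k), ← EE_mu.one (k+2), TT, mul_sum]
  simp only [sum_mul, smul_mul_assoc]
  rw [sum_comm]
  conv_rhs => rw [sum_comm]
  rw [sum_comm]
  refine sum_congr rfl fun x _ => ?_
  rw [sum_comm]
lemma Ph3_R2 (k : ℕ) : Ph3 K ι k (LinearMap.toMatrixAlgEquiv ((b.tensorProduct b).tensorProduct b)
    ((TensorProduct.assoc K V V V).symm.toLinearMap ∘ₗ
        TensorProduct.map LinearMap.id R ∘ₗ (TensorProduct.assoc K V V V).toLinearMap)) = TT R b (k+1) := by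
  have : ∀ x y z c d f, LinearMap.toMatrixAlgEquiv ((b.tensorProduct b).tensorProduct b)
    ((TensorProduct.assoc K V V V).symm.toLinearMap ∘ₗ
        TensorProduct.map LinearMap.id R ∘ₗ (TensorProduct.assoc K V V V).toLinearMap) ((x, y), z) ((c, d), f)
       = if c = x then rR R b y z d f else 0 := by
    intro x y z c d f
    simp only [LinearMap.toMatrixAlgEquiv_apply, Module.Basis.tensorProduct_apply, LinearMap.comp_apply,
      LinearEquiv.coe_coe, assoc_tmul, map_tmul, LinearMap.id_apply, rR_apply, tmul_sum, tmul_smul, map_sum, map_smul,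
      assoc_symm_tmul, Finsupp.finset_sum_apply, Finsupp.smul_apply, Module.Basis.tensorProduct_repr_tmul_apply,
      Module.Basis.repr_self, Finsupp.single_apply, smul_eq_mul]
    simp [mul_ite, ite_mul]
  simp only [Ph3, muHom_apply, Fintype.sum_prod_type, this, pU, ite_smul, zero_smul]
  rw [← one_mul (TT R b (k+1)), ← EE_mu.one k, TT]
  rw [sum_mul]
  simp only [mul_sum, mul_smul_comm]
  have e1 : ∀ x y z : ι, (∑ c, ∑ d, ∑ f, if c = x then rR R b y z d f • (EE K ι k x c * EE K ι (k+1) y d *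
      EE K ι (k+2) z f) else 0) = ∑ d, ∑ f, rR R b y z d f • (EE K ι k x x * EE K ι (k+1) y d *
      EE K ι (k+2) z f) := fun x y z => by
    rw [sum_eq_single x (fun c _ hc => by simp [hc]) (by simp)]
    simp
  simp only [e1]
  simp only [mul_assoc]
lemma lambda_setup [CharZero K] [Nonempty ι] (hq0 : q ≠ 0) (hq : ∀ n : ℕ, 1 < n → q ^ n ≠ 1)
    (hR : IsHeckeSymmetry K V q R) : ∃ S : TS q (rR R b) (EE K ι) (TT R b),
      (∀ l, Module.finrank K (lambdaGrade K V R l) = S.neg.hN l) ∧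
      ∃ P : ι → ι → ι → ι → K,
        (∀ a c a' c', ∑ x, ∑ y, P a c x y * rR R b a' x c' y = if a = a' then if c = c' then 1 else 0 else 0) ∧
        (∀ x y x' y', ∑ a, ∑ c, rR R b a x c y * P a c x' y' = if x = x' then if y = y' then 1 else 0 else 0) := by
  obtain ⟨-, hbr, hqd, Rs, hRs, hsh⟩ := hR
  have S : TS q (rR R b) (EE K ι) (TT R b) := by
    refine ⟨⟨hq0, fun n hn => ?_, fun k => ?_, fun k => ?_, fun i j hij => ?_⟩, EE_mu, fun k => rfl⟩
    · rcases hn.lt_or_eq with h | rfl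
      · exact hq n h
      · intro h; exact hq 2 (by omega) (by rw [pow_one] at h; rw [h]; simp)
    · have h1 : R * R = (q - 1) • R + q • 1 := by
        have h0 : (R + 1) * (R - q • 1) = 0 := hqd
        rw [add_mul, mul_sub, mul_sub, mul_smul_comm, mul_one, one_mul, one_mul] at h0
        linear_combination (norm := module) h0
      have := congrArg (fun x => Ph2 K ι k (LinearMap.toMatrixAlgEquiv (b.tensorProduct b) x)) h1
      simpa only [map_mul, map_add, map_smul, map_one, Ph2_R] using this
    · have h1 : ∀ R1 R2 : Module.End K (V ⊗[K] V ⊗[K] V), R1 ∘ₗ R2 ∘ₗ R1 = R2 ∘ₗ R1 ∘ₗ R2 →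
          (R1 * R2) * R1 = (R2 * R1) * R2 := fun R1 R2 h => by rw [mul_assoc, mul_assoc]; exact h
      have h1 := congrArg (fun x => Ph3 K ι k (LinearMap.toMatrixAlgEquiv ((b.tensorProduct b).tensorProduct b) x))
        (h1 _ _ hbr)
      simpa only [map_mul, Ph3_R1, Ph3_R2] using h1
    · refine Commute.sum_left _ _ _ fun _ _ => Commute.sum_left _ _ _ fun _ _ => Commute.sum_left _ _ _ fun _ _ =>
        Commute.sum_left _ _ _ fun _ _ => Commute.smul_left ?_ _
      refine Commute.sum_right _ _ _ fun _ _ => Commute.sum_right _ _ _ fun _ _ => Commute.sum_right _ _ _ fun _ _ =>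
        Commute.sum_right _ _ _ fun _ _ => Commute.smul_right ?_ _
      exact ((EE_mu.comm _ _ (by omega) _ _ _ _).mul_right (EE_mu.comm _ _ (by omega) _ _ _ _)).mul_left
        ((EE_mu.comm _ _ (by omega) _ _ _ _).mul_right (EE_mu.comm _ _ (by omega) _ _ _ _))
  refine ⟨S, fun l => ?_, ?_⟩
  · let mk := RingQuot.mkAlgHom K (lambdaRel K V R)
    let e : ι → RingQuot (lambdaRel K V R) := fun a => mk (TensorAlgebra.ι K (b a))
    have hgr : lambdaGrade K V R l = Submodule.span K (Set.range (mon e l)) := by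
      rw [← span_mon]
      show Submodule.map mk.toLinearMap _ = _
      rw [Submodule.map_pow]
      congr 1
      rw [LinearMap.range_eq_map, ← b.span_eq, Submodule.map_span, Submodule.map_span, ← Set.range_comp, ← Set.range_comp]
      rfl
    rw [hgr]
    have conv : ∀ {C : Type} [Ring C] [Algebra K C] (g : ι → C) (c d : ι),
        ((∑ x, ∑ y, ((if x = c then if y = d then q - 1 else 0 else 0) - rR R b x y c d) • (g x * g y) = q • (g c * g d)) ↔
          ∑ x, ∑ y, rR R b x y c d • (g x * g y) + g c * g d = 0) := by
      intro C _ _ g c d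
      simp only [sub_smul, Finset.sum_sub_distrib, ite_smul, zero_smul, Finset.sum_ite_eq', Finset.mem_univ, if_true]
      rw [sum_eq_single c (fun x _ hx => by simp [hx]) (by simp)]
      simp only [if_true, Finset.sum_ite_eq', Finset.mem_univ]
      constructor <;> intro h <;> linear_combination (norm := module) -h
    have m2 : ∀ c d, mulTwo K V ((R + (LinearMap.id : V ⊗[K] V →ₗ[K] V ⊗[K] V)) (b c ⊗ₜ[K] b d)) =
        ∑ x, ∑ y, rR R b x y c d • (TensorAlgebra.ι K (b x) * TensorAlgebra.ι K (b y)) +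
          TensorAlgebra.ι K (b c) * TensorAlgebra.ι K (b d) := by
      intro c d
      rw [LinearMap.add_apply, rR_apply]
      simp [mulTwo]
    have key := S.neg.finrank_mon (A := RingQuot (lambdaRel K V R)) (e := e)
    refine key ?_ ?_ l
    · intro c d
      have h1 := RingQuot.mkAlgHom_rel K (s := lambdaRel K V R) ⟨rfl, b c ⊗ₜ[K] b d, rfl⟩
      rw [m2] at h1
      exact (conv e c d).2 (by simpa only [map_add, map_sum, map_smul, map_mul, map_zero] using h1)
    · intro C _ _ g hg
      let f := TensorAlgebra.lift K (b.constr K g)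
      have hf : ∀ a, f (TensorAlgebra.ι K (b a)) = g a := fun a => by simp [f]
      have h0 : f.toLinearMap ∘ₗ mulTwo K V ∘ₗ (R + LinearMap.id) = 0 := by
        refine (b.tensorProduct b).ext fun ⟨c, d⟩ => ?_
        rw [Module.Basis.tensorProduct_apply, LinearMap.comp_apply, LinearMap.comp_apply, m2]
        simp only [AlgHom.toLinearMap_apply, map_add, map_sum, map_smul, map_mul, hf]
        exact (conv g c d).1 (hg c d)
      refine ⟨RingQuot.liftAlgHom K ⟨f, fun x y hxy => ?_⟩, fun a => ?_⟩
      · obtain ⟨rfl, u, rfl⟩ := hxy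
        rw [map_zero]; exact LinearMap.congr_fun h0 u
      · exact (RingQuot.liftAlgHom_mkAlgHom_apply K _ _ _).trans (hf a)
  · let D := b.dualBasis
    let g := (LinearEquiv.ofBijective Rs hRs).symm.toLinearMap
    have co : ∀ z x y, (b.tensorProduct D).repr z (x, y) =
        b.repr (dualTensorHom K V V (TensorProduct.comm K V (Module.Dual K V) z) (b y)) x := by
      intro z x y
      induction z using TensorProduct.induction_on with
      | zero => simp
      | add z w hz hw => simp only [map_add, Finsupp.add_apply, LinearMap.add_apply, hz, hw]
      | tmul v ξ => simp [D, Module.Basis.dualBasis_repr]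
    have hN : ∀ x y a c, LinearMap.toMatrix (D.tensorProduct b) (b.tensorProduct D) Rs (x, y) (a, c) = rR R b a x c y := by
      intro x y a c
      rw [LinearMap.toMatrix_apply, co, Module.Basis.tensorProduct_apply, hsh, rR_apply]
      simp [D, Finsupp.single_apply]
    have g1 : g ∘ₗ Rs = LinearMap.id := LinearMap.ext fun x => (LinearEquiv.ofBijective Rs hRs).symm_apply_apply x
    have g2 : Rs ∘ₗ g = LinearMap.id := LinearMap.ext fun x => (LinearEquiv.ofBijective Rs hRs).apply_symm_apply x
    refine ⟨fun a c x y => LinearMap.toMatrix (b.tensorProduct D) (D.tensorProduct b) g (a, c) (x, y), ?_, ?_⟩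
    · intro a c a' c'
      have := congrArg (LinearMap.toMatrix (D.tensorProduct b) (D.tensorProduct b)) g1
      rw [LinearMap.toMatrix_comp _ (b.tensorProduct D), LinearMap.toMatrix_id] at this
      have := congrFun (congrFun this (a, c)) (a', c')
      simpa only [Matrix.mul_apply, Fintype.sum_prod_type, hN, Matrix.one_apply, Prod.mk.injEq, ite_and] using this
    · intro x y x' y'
      have := congrArg (LinearMap.toMatrix (b.tensorProduct D) (b.tensorProduct D)) g2
      rw [LinearMap.toMatrix_comp _ (D.tensorProduct b), LinearMap.toMatrix_id] at this
      have := congrFun (congrFun this (x, y)) (x', y')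
      simpa only [Matrix.mul_apply, Fintype.sum_prod_type, hN, Matrix.one_apply, Prod.mk.injEq, ite_and] using this
end
def pt (E : ℕ → ι → ι → B) (k : ℕ) (w : ι → ι → K) : B →ₗ[K] B :=
  ∑ b, ∑ d, w b d • ∑ e, (LinearMap.mulLeft K (E k e b)) ∘ₗ (LinearMap.mulRight K (E k d e))
abbrev CE (E : ℕ → ι → ι → B) (k : ℕ) (y : B) : Prop := ∀ a b, Commute y (E k a b)
lemma pt_apply (E : ℕ → ι → ι → B) (k : ℕ) (w : ι → ι → K) (x : B) :
    pt E k w x = ∑ b, ∑ d, w b d • ∑ e, E k e b * x * E k d e := by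
  simp [pt, LinearMap.sum_apply, mul_assoc]
lemma pt_left (E : ℕ → ι → ι → B) {k : ℕ} (w : ι → ι → K) {y : B} (hy : CE E k y) (x : B) :
    pt E k w (y * x) = y * pt E k w x := by
  simp only [pt_apply, mul_sum, mul_smul_comm]
  refine sum_congr rfl fun b _ => sum_congr rfl fun d _ => ?_
  congr 1
  refine sum_congr rfl fun e _ => ?_
  rw [← mul_assoc, ← (hy e b).eq]; noncomm_ring
lemma pt_right (E : ℕ → ι → ι → B) {k : ℕ} (w : ι → ι → K) {y : B} (hy : CE E k y) (x : B) :
    pt E k w (x * y) = pt E k w x * y := by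
  simp only [pt_apply, sum_mul, smul_mul_assoc]
  refine sum_congr rfl fun b _ => sum_congr rfl fun d _ => ?_
  congr 1
  refine sum_congr rfl fun e _ => ?_
  rw [mul_assoc, mul_assoc, mul_assoc, (hy d e).eq]; noncomm_ring
namespace MUF
variable {E : ℕ → ι → ι → B} (H : MUF E)
include H
lemma pt_E (k : ℕ) (w : ι → ι → K) (b d : ι) : pt E k w (E k b d) = w b d • 1 := by
  simp only [pt_apply, H.mul, ite_mul, zero_mul, mul_ite, mul_zero]
  rw [sum_eq_single b (fun b' _ hb => by simp [hb]) (by simp),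
    sum_eq_single d (fun b' _ hb => by simp [hb.symm]) (by simp)]
  simp [H.one]
lemma pt_one (k : ℕ) (w : ι → ι → K) : pt E k w 1 = (∑ b, w b b) • 1 := by
  rw [← H.one k, map_sum]; simp only [H.pt_E, H.one, sum_smul]
lemma pt_comm (k : ℕ) (w : ι → ι → K) (x : B) : CE E k (pt E k w x) := by
  intro a c
  have h1 : ∀ b d, (∑ e, E k e b * x * E k d e) * E k a c = E k a c * ∑ e, E k e b * x * E k d e := by
    intro b d
    simp only [sum_mul, mul_sum, mul_assoc, H.mul, mul_ite, mul_zero]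
    simp only [← mul_assoc, H.mul, ite_mul, zero_mul]
    simp
  show pt E k w x * E k a c = E k a c * pt E k w x
  simp only [pt_apply, sum_mul, mul_sum, smul_mul_assoc, mul_smul_comm]
  refine sum_congr rfl fun b _ => sum_congr rfl fun d _ => ?_
  congr 1
  simpa only [sum_mul, mul_sum] using h1 b d
lemma pt_far {k l : ℕ} (hkl : k ≠ l) (w : ι → ι → K) {x : B} (hx : CE E l x) : CE E l (pt E k w x) := by
  intro a c
  have hc : ∀ a b, CE E k (E l a b) := fun a b c d => H.comm l k hkl.symm a b c d
  show _ = _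
  rw [← pt_left E w (hc a c), ← pt_right E w (hc a c), (hx a c).eq]
lemma pt_Loc {n : ℕ} (w : ι → ι → K) {x : B} (hx : x ∈ H.Loc K (n+1)) : pt E n w x ∈ H.Loc K n := by
  obtain ⟨y, hy, rfl⟩ := H.blk.1 hx
  simp only [map_sum]
  refine Subalgebra.sum_mem _ fun c _ => Subalgebra.sum_mem _ fun d _ => ?_
  rw [pt_left E w (fun a b => H.Loc_comm le_rfl (hy c d) a b), H.pt_E, mul_smul_comm, mul_one]
  exact Subalgebra.smul_mem _ (hy c d) _
end MUF
structure HP (r P : ι → ι → ι → ι → K) : Prop where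
  i1 : ∀ a c a' c', ∑ x, ∑ y, P a c x y * r a' x c' y = if a = a' then if c = c' then 1 else 0 else 0
  i2 : ∀ x y x' y', ∑ a, ∑ c, r a x c y * P a c x' y' = if x = x' then if y = y' then 1 else 0 else 0
def kp (P : ι → ι → ι → ι → K) (a c : ι) : K := ∑ b, P a c b b
def Cm (P : ι → ι → ι → ι → K) (b d : ι) : K := ∑ a, P a a b d
def dl (P : ι → ι → ι → ι → K) : K := ∑ b, Cm P b b
def sg (q : K) (P : ι → ι → ι → ι → K) : K := q⁻¹ * (1 - (q-1) * dl P)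
lemma dl_eq (P : ι → ι → ι → ι → K) : dl P = ∑ a, kp P a a := by
  simp only [dl, Cm, kp]; exact sum_comm
namespace TS
variable {r P : ι → ι → ι → ι → K} {E : ℕ → ι → ι → B} (S : TS q r E T) (hP : HP r P)
include S
lemma T_ce {k l : ℕ} (h1 : l ≠ k) (h2 : l ≠ k + 1) : CE E l (T k) := by
  intro x y
  rw [S.tf k]
  refine Commute.sum_left _ _ _ fun a _ => Commute.sum_left _ _ _ fun b _ => Commute.sum_left _ _ _ fun c _ =>
    Commute.sum_left _ _ _ fun d _ => ?_
  exact ((S.mu.comm k l h1.symm a c x y).mul_left (S.mu.comm (k+1) l h2.symm b d x y)).smul_left _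
lemma HA_ce {n k : ℕ} (hk : n ≤ k) {x : B} (hx : x ∈ HA K T n) : CE E k x :=
  fun a b => S.mu.Loc_comm hk (TF_mem S.mu S.tf hx) a b
include hP
lemma ptC_T (k : ℕ) : pt E (k+1) (Cm P) (T k) = 1 := by
  rw [S.tf k]
  simp only [map_sum, map_smul]
  have h1 : ∀ a b c d, pt E (k+1) (Cm P) (E k a c * E (k+1) b d) = Cm P b d • E k a c := fun a b c d => by
    rw [pt_left E _ (fun x y => S.mu.comm k (k+1) (by omega) a c x y), S.mu.pt_E, mul_smul_comm, mul_one]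
  simp only [h1, smul_smul]
  calc _ = ∑ a, ∑ c, (∑ x, ∑ b, ∑ d, P x x b d * r a b c d) • E k a c := by
        refine sum_congr rfl fun a _ => ?_
        rw [sum_comm]
        refine sum_congr rfl fun c _ => ?_
        simp only [← sum_smul]
        congr 1
        simp only [Cm, mul_sum]
        rw [sum_comm]
        conv_rhs => rw [sum_comm]
        rw [sum_comm]
        refine sum_congr rfl fun b _ => ?_
        rw [sum_comm]
        exact sum_congr rfl fun x _ => sum_congr rfl fun d _ => mul_comm _ _
    _ = 1 := by
        simp only [hP.i1]
        simp [← S.mu.one k, ite_smul]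
lemma ptk_T (k : ℕ) : pt E k (kp P) (T k) = 1 := by
  rw [S.tf k]
  simp only [map_sum, map_smul]
  have h1 : ∀ a b c d, pt E k (kp P) (E k a c * E (k+1) b d) = kp P a c • E (k+1) b d := fun a b c d => by
    rw [pt_right E _ (fun x y => S.mu.comm (k+1) k (by omega) b d x y), S.mu.pt_E, smul_mul_assoc, one_mul]
  simp only [h1, smul_smul]
  calc _ = ∑ b, ∑ d, (∑ x, ∑ a, ∑ c, r a b c d * P a c x x) • E (k+1) b d := by
        rw [sum_comm]
        refine sum_congr rfl fun b _ => ?_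
        calc _ = ∑ a, ∑ d, ∑ c, (r a b c d * kp P a c) • E (k+1) b d :=
              sum_congr rfl fun a _ => sum_comm
          _ = ∑ d, ∑ a, ∑ c, (r a b c d * kp P a c) • E (k+1) b d := sum_comm
          _ = _ := by
              refine sum_congr rfl fun d _ => ?_
              simp only [← sum_smul]
              congr 1
              simp only [kp, mul_sum]
              conv_rhs => rw [sum_comm]
              exact sum_congr rfl fun a _ => sum_comm
    _ = 1 := by
        simp only [hP.i2]
        simp [← S.mu.one (k+1), ite_smul]
lemma cmp {n : ℕ} {X : ι → ι → B} {p : B} (hX : ∀ a c, CE E n (X a c)) (hp : CE E n p)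
    (h : ∑ a, ∑ b, ∑ c, ∑ d, r a b c d • (X a c * E n b d) = p) (a c : ι) : X a c = kp P a c • p := by
  have h1 := congrArg (pt E n (P a c)) h
  have h2 := pt_left E (P a c) hp 1
  rw [mul_one, S.mu.pt_one, mul_smul_comm, mul_one] at h2
  rw [h2] at h1
  simp only [kp]
  rw [← h1]
  simp only [map_sum, map_smul]
  have h3 : ∀ a' b c' d, pt E n (P a c) (X a' c' * E n b d) = P a c b d • X a' c' := fun a' b c' d => by
    rw [pt_left E _ (hX a' c'), S.mu.pt_E, mul_smul_comm, mul_one]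
  simp only [h3, smul_smul]
  calc X a c = ∑ a', ∑ c', (∑ b, ∑ d, P a c b d * r a' b c' d) • X a' c' := by
        simp only [hP.i1]
        rw [sum_eq_single a (fun x _ hx => by simp [hx.symm]) (by simp)]
        simp [ite_smul]
    _ = _ := by
        refine sum_congr rfl fun a' _ => ?_
        simp only [sum_smul]
        rw [sum_comm]
        refine sum_congr rfl fun b _ => sum_congr rfl fun d _ => ?_
        simp only [mul_comm]
lemma Ck [Nontrivial B] (b y : ι) : ∑ d, Cm P b d * kp P d y = if b = y then sg q P else 0 := by
  obtain ⟨q0, -, quad, braid, -⟩ := S.hk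
  have q0' := S.hk.q0
  let Ti : ℕ → B := fun k => q⁻¹ • (T k - (q-1) • 1)
  have i1 : ∀ k, T k * Ti k = 1 := fun k => by
    simp only [Ti, mul_smul_comm, mul_sub, S.hk.quad, mul_one]
    rw [add_sub_cancel_left, smul_smul, inv_mul_cancel₀ q0', one_smul]
  have i2 : ∀ k, Ti k * T k = 1 := fun k => by
    simp only [Ti, smul_mul_assoc, sub_mul, S.hk.quad, one_mul]
    rw [add_sub_cancel_left, smul_smul, inv_mul_cancel₀ q0', one_smul]
  have ceTi : ∀ {k l}, l ≠ k → l ≠ k+1 → CE E l (Ti k) := fun h1 h2 a c => by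
    simp only [Ti]
    exact ((S.T_ce h1 h2 a c).sub_left ((Commute.one_left _).smul_left _)).smul_left _
  have c10 : ∀ a c, CE E 0 (E 1 a c) := fun a c x y => S.mu.comm 1 0 (by omega) a c x y
  have hX := S.cmp hP (n := 2) (X := fun d y => pt E 0 (kp P) (T 0 * E 1 d y * Ti 0)) (p := 1)
    (fun a c => S.mu.pt_far (by omega) _ fun x y => ((S.T_ce (by omega) (by omega) x y).mul_left
      (S.mu.comm 1 2 (by omega) a c x y)).mul_left (ceTi (by omega) (by omega) x y))
    (fun a c => Commute.one_left _) (by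
      have e1 : ∀ a b c d, pt E 0 (kp P) (T 0 * E 1 a c * Ti 0) * E 2 b d = pt E 0 (kp P) (T 0 * (E 1 a c * E 2 b d) * Ti 0) := by
        intro a b c d
        rw [← pt_right E _ (fun x y => S.mu.comm 2 0 (by omega) b d x y)]
        congr 1
        rw [mul_assoc, (ceTi (k := 0) (l := 2) (by omega) (by omega) b d).eq]; noncomm_ring
      simp only [e1, ← map_smul, ← map_sum]
      have e2 : T 0 * T 1 * Ti 0 = Ti 1 * T 0 * T 1 := by
        have := S.hk.braid 0
        calc T 0 * T 1 * Ti 0 = (Ti 1 * T 1) * T 0 * T 1 * Ti 0 := by rw [i2, one_mul]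
          _ = Ti 1 * (T 1 * T 0 * T 1) * Ti 0 := by noncomm_ring
          _ = Ti 1 * T 0 * T 1 * (T 0 * Ti 0) := by rw [← this]; noncomm_ring
          _ = _ := by rw [i1, mul_one]
      have e3 : ∑ a, ∑ b, ∑ c, ∑ d, r a b c d • (T 0 * (E 1 a c * E 2 b d) * Ti 0) = T 0 * T 1 * Ti 0 := by
        rw [S.tf 1]
        simp only [mul_sum, sum_mul, mul_smul_comm, smul_mul_assoc, one_add_one_eq_two]
      rw [e3, e2, pt_right E _ (S.T_ce (by omega) (by omega)), pt_left E _ (ceTi (by omega) (by omega)),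
        S.ptk_T hP, mul_one, i2])
  let W : ι → ι → B := fun a x => pt E 0 (kp P) (E 0 a x * Ti 0)
  have h2 : ∀ d y, ∑ a, ∑ b, ∑ x, r a b x d • (E 1 b y * W a x) = kp P d y • (1:B) := by
    intro d y
    rw [← hX d y]
    have : T 0 * E 1 d y = ∑ a, ∑ b, ∑ x, r a b x d • (E 1 b y * E 0 a x) := by
      rw [S.tf 0]
      simp only [sum_mul, smul_mul_assoc, mul_assoc, zero_add, S.mu.mul, mul_ite, mul_zero, smul_ite, smul_zero]
      refine sum_congr rfl fun a _ => sum_congr rfl fun b _ => sum_congr rfl fun x _ => ?_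
      rw [Finset.sum_ite_eq']
      simp only [Finset.mem_univ, if_true]
      rw [(c10 b y a x).eq]
    rw [this]
    simp only [sum_mul, smul_mul_assoc, map_sum, map_smul, mul_assoc]
    refine sum_congr rfl fun a _ => sum_congr rfl fun b _ => sum_congr rfl fun x _ => ?_
    rw [pt_left E _ (c10 b y)]
  have h3 : ∀ v b' d y, ∑ a, ∑ x, r a b' x d • (E 1 v y * W a x) = kp P d y • E 1 v b' := by
    intro v b' d y
    have := congrArg (E 1 v b' * ·) (h2 d y)
    simp only [mul_sum, mul_smul_comm, mul_one, ← mul_assoc, S.mu.mul, ite_mul, zero_mul, smul_ite, smul_zero] at this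
    rw [← this]
    refine sum_congr rfl fun a _ => ?_
    conv_rhs => rw [sum_eq_single b' (fun x _ hx => by simp [hx.symm]) (by simp)]
    simp
  have h4 : ∀ v y a x, E 1 v y * W a x = ∑ b', ∑ d, (P a x b' d * kp P d y) • E 1 v b' := by
    intro v y a x
    simp only [← smul_smul, ← h3, smul_sum]
    rw [← sum4 (fun a' x' b' d => P a x b' d • r a' b' x' d • (E 1 v y * W a' x'))]
    simp only [smul_smul, ← sum_smul, hP.i1]
    rw [sum_eq_single a (fun x _ hx => by simp [hx.symm]) (by simp)]
    simp [ite_smul]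
  have h5 : ∑ a, W a a = sg q P • (1:B) := by
    simp only [W, ← map_sum, ← sum_mul, S.mu.one, one_mul]
    simp only [Ti, map_smul, map_sub, S.ptk_T hP, S.mu.pt_one, sg, dl_eq]
    module
  have h6 : ∀ v, sg q P • E 1 v y = ∑ b', (∑ d, Cm P b' d * kp P d y) • E 1 v b' := by
    intro v
    calc sg q P • E 1 v y = ∑ a, E 1 v y * W a a := by rw [← mul_sum, h5, mul_smul_comm, mul_one]
      _ = _ := by
        simp only [h4]
        rw [sum_comm]
        refine sum_congr rfl fun b' _ => ?_
        rw [sum_comm]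
        simp only [← sum_smul]
        simp only [Cm, sum_mul]
  have h7 := congrArg (fun z => ∑ v, z v) (funext fun v => congrArg (· * E 1 b v) (h6 v))
  simp only [smul_mul_assoc, sum_mul, S.mu.mul, smul_ite, smul_zero, Finset.sum_ite_eq', Finset.mem_univ, if_true] at h7
  rw [← smul_sum, S.mu.one] at h7
  have h8 : (∑ d, Cm P b d * kp P d y) • (1:B) = (if b = y then sg q P else 0) • (1:B) := by
    rw [← h7]
    split_ifs with h h' h'
    · rw [← smul_sum, S.mu.one]
    · exact absurd h.symm h'
    · exact absurd h'.symm h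
    · simp
  simp only [Algebra.smul_def, mul_one] at h8
  exact (algebraMap K B).injective h8
lemma kC [Nontrivial B] (h0 : sg q P ≠ 0) (a d : ι) : ∑ b, kp P a b * Cm P b d = if a = d then sg q P else 0 := by
  have h1 : Matrix.of (Cm P) * ((sg q P)⁻¹ • Matrix.of (kp P)) = 1 := by
    ext b y
    rw [Matrix.mul_smul, Matrix.smul_apply, Matrix.mul_apply]
    simp only [Matrix.of_apply, S.Ck hP, Matrix.one_apply]
    split_ifs <;> simp [h0]
  rw [mul_eq_one_comm] at h1
  have h2 := congrFun (congrFun h1 a) d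
  rw [Matrix.smul_mul, Matrix.smul_apply, Matrix.mul_apply, Matrix.one_apply] at h2
  simp only [Matrix.of_apply, smul_eq_mul] at h2
  rw [inv_mul_eq_iff_eq_mul₀ h0] at h2
  rw [h2]; split_ifs <;> simp
end TS
lemma cauchy (hq : q - 1 ≠ 0) {s A : Finset ℕ} (hc : s.card = A.card) {z y : ℕ → K} (hz : Set.InjOn z s)
    (z0 : ∀ i ∈ s, z i ≠ 0) (y0 : ∀ r ∈ A, y r ≠ 0) (yz : ∀ r ∈ A, ∀ i ∈ s, y r ≠ z i) :
    ∃ k : ℕ → K, (∀ r ∈ A, ∑ i ∈ s, k i * ((q-1) * y r / (y r - z i)) = 1) ∧ 1 - (q-1) * ∑ i ∈ s, k i ≠ 0 := by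
  let w : ℕ → K := fun i => (z i)⁻¹
  let w' : ℕ → K := fun i => (y i)⁻¹
  have hw : Set.InjOn w s := fun a ha b hb h => hz ha hb (inv_injective h)
  let N : K[X] := Lagrange.nodal s w - Lagrange.nodal A w'
  have hN : N.degree < s.card := by
    have := degree_sub_lt (p := Lagrange.nodal s w) (q := Lagrange.nodal A w')
      (by rw [Lagrange.degree_nodal, Lagrange.degree_nodal, hc]) (Lagrange.nodal_ne_zero)
      (by rw [(Lagrange.nodal_monic).leadingCoeff, (Lagrange.nodal_monic).leadingCoeff])
    rwa [Lagrange.degree_nodal] at this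
  have hI := Lagrange.eq_interpolate hw hN
  have key : ∀ x, (∀ i ∈ s, x ≠ w i) → N.eval x = (Lagrange.nodal s w).eval x *
      ∑ i ∈ s, Lagrange.nodalWeight s w i * (x - w i)⁻¹ * N.eval (w i) := fun x hx => by
    conv_lhs => rw [hI]
    exact Lagrange.eval_interpolate_not_at_node _ hx
  have nz : ∀ x, (∀ i ∈ s, x ≠ w i) → (Lagrange.nodal s w).eval x ≠ 0 := fun x hx => by
    rw [Lagrange.eval_nodal]
    exact Finset.prod_ne_zero_iff.2 fun i hi => sub_ne_zero.2 (hx i hi)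
  refine ⟨fun i => - (Lagrange.nodalWeight s w i * N.eval (w i)) * z i / (q-1), fun r hr => ?_, ?_⟩
  · have hx : ∀ i ∈ s, w' r ≠ w i := fun i hi h => yz r hr i hi (inv_injective h)
    have e1 : N.eval (w' r) = (Lagrange.nodal s w).eval (w' r) := by
      simp only [N, eval_sub, Lagrange.eval_nodal_at_node hr, sub_zero]
    have := key _ hx
    rw [e1] at this
    have := mul_left_cancel₀ (nz _ hx) ((mul_one _).trans this)
    conv_rhs => rw [this]
    refine sum_congr rfl fun i hi => ?_
    have a1 := z0 i hi
    have a2 := y0 r hr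
    have a3 := sub_ne_zero.2 (yz r hr i hi)
    have a4 : w' r - w i = -(y r - z i) / (y r * z i) := by simp only [w, w']; field_simp; ring
    rw [a4]
    field_simp
  · have hx : ∀ i ∈ s, (0:K) ≠ w i := fun i hi => (inv_ne_zero (z0 i hi)).symm
    have := key _ hx
    have e2 : (q-1) * ∑ i ∈ s, - (Lagrange.nodalWeight s w i * N.eval (w i)) * z i / (q-1) =
        ∑ i ∈ s, Lagrange.nodalWeight s w i * (0 - w i)⁻¹ * N.eval (w i) := by
      rw [mul_sum]
      refine sum_congr rfl fun i hi => ?_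
      have a1 := z0 i hi
      simp only [w, zero_sub, inv_neg, inv_inv]
      field_simp
    rw [e2]
    intro h0
    rw [← sub_eq_zero.1 h0, mul_one] at this
    simp only [N, eval_sub, sub_eq_self] at this
    rw [Lagrange.eval_nodal] at this
    obtain ⟨i, hi, h⟩ := Finset.prod_eq_zero_iff.1 this
    exact inv_ne_zero (y0 i hi) (by simpa [w'] using h)
def RemR (t : List ℕ) : Finset ℕ := (Finset.range t.length).filter fun i => t.count (i+1) < t.count i
def zr (q : K) (t : List ℕ) (j : ℕ) : K := q ^ (ct t j - 1)
lemma mem_RemR {t : List ℕ} (ht : Std t) {i : ℕ} : i ∈ RemR t ↔ t.count (i+1) < t.count i := by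
  simp only [RemR, mem_filter, mem_range, and_iff_right_iff_imp]
  exact fun h => ht.lt i (List.count_pos_iff.1 (by omega))
lemma RemR_perm {t t' : List ℕ} (h : t.Perm t') : RemR t = RemR t' := by
  simp only [RemR, h.length_eq, h.count_eq]
lemma zr_perm {t t' : List ℕ} (h : t.Perm t') (j : ℕ) : zr q t j = zr q t' j := by
  simp only [zr, ct_perm h]
lemma zr_cons (a : List ℕ) (j : ℕ) : zr q (j :: a) j = zz q a j := by
  simp [zr, zz, ct_cons_self]
lemma zz_perm {t t' : List ℕ} (h : t.Perm t') (j : ℕ) : zz q t j = zz q t' j := by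
  simp only [zz, ct_perm h]
lemma RemR_card {t : List ℕ} (ht : Std t) : (AddR t).card = (RemR t).card + 1 := by
  have : AddR t = insert 0 ((RemR t).image (· + 1)) := by
    ext r
    rw [ht.mem_iff]
    simp only [Finset.mem_insert, mem_image, mem_RemR ht]
    constructor
    · rintro (h | h)
      · exact Or.inl h
      · rcases Nat.eq_zero_or_pos r with h0 | h0
        · exact Or.inl h0
        · exact Or.inr ⟨r-1, by rwa [Nat.sub_add_cancel h0], Nat.sub_add_cancel h0⟩
    · rintro (h | ⟨a, ha, rfl⟩)
      · exact Or.inl h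
      · exact Or.inr (by simpa using ha)
  rw [this, Finset.card_insert_of_notMem (by simp), Finset.card_image_of_injective _ (add_left_injective 1)]
lemma Std.of_rem {t : List ℕ} (ht : Std t) {i : ℕ} (hi : i ∈ RemR t) : ∃ a, Std (i :: a) ∧ t.Perm (i :: a) :=
  ht.corner ((mem_RemR ht).1 hi)
lemma HK.exists_k (h : HK q T) {t : List ℕ} (ht : Std t) {r0 : ℕ} (hr0 : r0 ∈ AddR t) :
    ∃ k : ℕ → K, (∀ r ∈ AddR t, r ≠ r0 → ∑ i ∈ RemR t, k i * ((q-1) * zz q t r / (zz q t r - zr q t i)) = 1) ∧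
      1 - (q-1) * ∑ i ∈ RemR t, k i ≠ 0 := by
  have hne : ∀ r ∈ AddR t, ∀ i ∈ RemR t, ct t r ≠ ct t i - 1 := by
    intro r hr i hi
    rw [mem_RemR ht] at hi
    rcases Nat.lt_or_ge i r with h1 | h1
    · have := ht.le (a := i+1) (b := r) h1
      simp only [ct]; omega
    · have := ht.le h1
      simp only [ct]; omega
  obtain ⟨k, h1, h2⟩ := cauchy h.q1 (s := RemR t) (A := (AddR t).erase r0) (z := zr q t) (y := zz q t)
    (by rw [Finset.card_erase_of_mem hr0, RemR_card ht]; rfl)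
    (by
      intro a ha b hb hab
      have := h.zinj hab
      have ha' := (mem_RemR ht).1 ha
      have hb' := (mem_RemR ht).1 hb
      rcases lt_trichotomy a b with h3 | h3 | h3
      · have := ht.le h3.le; simp only [ct] at *; omega
      · exact h3
      · have := ht.le h3.le; simp only [ct] at *; omega)
    (fun i _ => zpow_ne_zero _ h.q0) (fun i _ => zpow_ne_zero _ h.q0)
    (fun r hr i hi e => hne r (Finset.mem_of_mem_erase hr) i hi (h.zinj e))
  exact ⟨k, fun r hr hr' => h1 r (Finset.mem_erase.2 ⟨hr', hr⟩), h2⟩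
structure Mv (K : Type) [Field K] [Algebra K B] (T : ℕ → B) (n : ℕ) (a b u u' : B) : Prop where
  mu : u ∈ HA K T n
  mu' : u' ∈ HA K T n
  uu' : u * u' = a
  u'u : u' * u = b
  au : a * u = u
  ub : u * b = u
  bu : b * u' = u'
  u'a : u' * a = u'
lemma MvN.data {n : ℕ} {a b : B} (h : MvN K T n a b) : ∃ u u', Mv K T n a b u u' := by
  obtain ⟨u, u', h1, h2, h3, h4, h5, h6, h7, h8⟩ := h
  exact ⟨u, u', h1, h2, h3, h4, h5, h6, h7, h8⟩
structure RD (q : K) (T : ℕ → B) (t : List ℕ) (a : ℕ → List ℕ) (u u' : ℕ → B) : Prop where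
  st : ∀ j ∈ RemR t, Std (j :: a j)
  pm : ∀ j ∈ RemR t, t.Perm (j :: a j)
  mv : ∀ j ∈ RemR t, Mv K T t.length (pp q T t) (pp q T (j :: a j)) (u j) (u' j)
namespace HK
variable (h : HK q T)
include h
lemma pTp {j : ℕ} {a : List ℕ} (hj : Std (j :: a)) : ϖ (j :: a) * T a.length * ϖ (j :: a) =
    ∑ r ∈ AddR (j :: a), ((q-1) * zz q (j :: a) r / (zz q (j :: a) r - zz q a j)) • ϖ (r :: j :: a) := by
  have hs := h.pp_sum hj
  conv_lhs => rw [← hs, mul_sum]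
  rw [hs]
  refine sum_congr rfl fun r hr => ?_
  have hr' : Std (r :: j :: a) := ⟨hr, hj⟩
  have g := h.good hj
  rw [mul_assoc]
  have q1 := h.q1
  have q0 := h.q0
  rcases h.adj hr' with ⟨hne, hra⟩ | ⟨hc, hcc⟩
  · have e := h.sw_TP hj hra (Ne.symm hne) g
    simp only at e
    have e0 : ϖ (j :: a) * ϖ (j :: r :: a) = 0 := by
      rw [← h.pp_sub hra (h.good hra) j, ← mul_assoc, h.pp_ne hj hra (h.good hj.2) (Ne.symm hne), zero_mul]
    have e1 : zz q (j :: a) r = zz q a r := by simp only [zz, ct_cons_ne hne]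
    have e2 := congrArg (ϖ (j :: a) * ·) e
    simp only [mul_sub, ← mul_assoc, e0, zero_mul, mul_smul_comm, h.pp_sub hj g] at e2
    rw [← mul_assoc, e1]
    exact (sub_eq_zero.1 e2.symm)
  · rcases h.TPdec hr' with ⟨hn, hst, -⟩ | ⟨hc, e⟩
    · rcases hcc with ⟨h1, h2⟩ | ⟨h1, h2⟩
      · exact absurd h1 hn
      · have := hst.2.ct_sep hst.1 (show j < r by omega)
        rw [ct_cons_ne hn] at h2; omega
    rw [e, mul_smul_comm, h.pp_sub hj g]
    congr 1
    have hz : zz q a j ≠ 0 := zpow_ne_zero _ q0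
    rcases hcc with ⟨h1, h2⟩ | ⟨h1, h2⟩
    · rw [if_pos h1]
      have : zz q (j :: a) r = zz q a j * q := by simp only [zz]; rw [h2, zpow_add_one₀ q0]
      rw [this]
      have : zz q a j * q - zz q a j = zz q a j * (q-1) := by ring
      rw [this]; field_simp
    · rw [if_neg (by omega)]
      have : zz q (j :: a) r = zz q a j / q := by simp only [zz]; rw [h2, zpow_sub_one₀ q0, div_eq_mul_inv]
      rw [this]
      have : zz q a j / q - zz q a j = -(zz q a j * (q-1) / q) := by field_simp; ring
      rw [this]; field_simp
lemma uTu {t a : List ℕ} {j : ℕ} {u u' : B} (hj : Std (j :: a)) (hp : t.Perm (j :: a))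
    (M : Mv K T t.length (ϖ t) (ϖ (j :: a)) u u') : u * T a.length * u' =
      ∑ r ∈ AddR t, ((q-1) * zz q t r / (zz q t r - zr q t j)) • ϖ (r :: t) := by
  have e1 : u * T a.length * u' = u * (ϖ (j :: a) * T a.length * ϖ (j :: a)) * u' := by
    conv_lhs => rw [← M.ub, ← M.bu]
    noncomm_ring
  rw [e1, h.pTp hj, AddR_perm hp, mul_sum, sum_mul]
  refine sum_congr rfl fun r hr => ?_
  rw [mul_smul_comm, smul_mul_assoc, zz_perm hp, zr_perm hp, zr_cons]
  congr 1
  have ed : ∀ w, ϖ (r :: w) = ϖ w * aeval (JM q T w.length) (ee q w r) := fun _ => rfl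
  rw [ed, ed, ee_perm hp, hp.length_eq, ← mul_assoc, M.ub, mul_assoc,
    (h.aeval_comm hp.length_eq.symm.ge M.mu' _).eq, ← mul_assoc, M.uu']
lemma CR {t : List ℕ} {r0 m : ℕ} (ht : Std t) (hm : t.length = m + 1) (hr0 : r0 ∈ AddR t) (h0 : ϖ (r0 :: t) = 0) {k : ℕ → K}
    (hk : ∀ r ∈ AddR t, r ≠ r0 → ∑ i ∈ RemR t, k i * ((q-1) * zz q t r / (zz q t r - zr q t i)) = 1)
    {a : ℕ → List ℕ} {u u' : ℕ → B} (D : RD q T t a u u') :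
    ∑ j ∈ RemR t, k j • (u j * T m * u' j) = ϖ t := by
  have e1 : ∀ j ∈ RemR t, k j • (u j * T m * u' j) =
      ∑ r ∈ AddR t, (k j * ((q-1) * zz q t r / (zz q t r - zr q t j))) • ϖ (r :: t) := fun j hj => by
    have hl : (a j).length = m := by have := (D.pm j hj).length_eq; simp at this; omega
    rw [← hl, h.uTu (D.st j hj) (D.pm j hj) (D.mv j hj), smul_sum]
    simp only [smul_smul]
  rw [sum_congr rfl e1, sum_comm, ← h.pp_sum ht]
  refine sum_congr rfl fun r hr => ?_
  rw [← sum_smul]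
  by_cases e : r = r0
  · rw [e, h0, smul_zero]
  · rw [hk r hr e, one_smul]
lemma exists_RD {t : List ℕ} (ht : Std t) (a : ℕ → List ℕ) (ha : ∀ j ∈ RemR t, Std (j :: a j) ∧ t.Perm (j :: a j)) :
    ∃ u u', RD q T t a u u' := by
  have : ∀ j, ∃ u u', j ∈ RemR t → Mv K T t.length (ϖ t) (ϖ (j :: a j)) u u' := fun j => by
    by_cases hj : j ∈ RemR t
    · obtain ⟨u, u', M⟩ := (h.eqv ht (ha j hj).1 (ha j hj).2).data
      exact ⟨u, u', fun _ => M⟩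
    · exact ⟨0, 0, fun h => absurd h hj⟩
  choose u u' M using this
  exact ⟨u, u', fun j hj => (ha j hj).1, fun j hj => (ha j hj).2, fun j hj => M j hj⟩
end HK
namespace TS
variable {r P : ι → ι → ι → ι → K} {E : ℕ → ι → ι → B} (S : TS q r E T) (hP : HP r P)
include S hP
lemma pt_HA {n : ℕ} {x : B} (hx : x ∈ HA K T (n+1)) : pt E n (Cm P) x ∈ HA K T n := by
  rcases n with _ | n
  · obtain ⟨c, rfl⟩ := HA_small (by omega) hx
    rw [map_smul, S.mu.pt_one, smul_smul]
    exact Subalgebra.smul_mem _ (Subalgebra.one_mem _) _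
  · have hx := S.hk.HA_dec hx
    have h1 : ∀ y ∈ HA K T (n+1), pt E (n+1) (Cm P) y = dl P • y := fun y hy => by
      have := pt_left E (Cm P) (S.HA_ce le_rfl hy) 1
      rwa [mul_one, S.mu.pt_one, mul_smul_comm, mul_one] at this
    refine Submodule.span_induction (p := fun x _ => pt E (n+1) (Cm P) x ∈ HA K T (n+1)) ?_ ?_ ?_ ?_ hx
    · rintro y (hy | ⟨a, b, ha, hb, rfl⟩)
      · rw [h1 y hy]; exact Subalgebra.smul_mem _ hy _
      · rw [pt_right E _ (S.HA_ce le_rfl hb), pt_left E _ (S.HA_ce le_rfl ha), S.ptC_T hP, mul_one]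
        exact Subalgebra.mul_mem _ ha hb
    · simp
    · intro x y _ _ h1 h2; rw [map_add]; exact Subalgebra.add_mem _ h1 h2
    · intro c x _ h1; rw [map_smul]; exact Subalgebra.smul_mem _ h1 _
lemma main_k [Nontrivial B] {t : List ℕ} {m : ℕ} (ht : Std t) (hm : t.length = m + 1) (hne : ϖ t ≠ 0)
    (H : ∃ r0 ∈ AddR t, ϖ (r0 :: t) = 0) : sg q P ≠ 0 ∧ ∃ k : ℕ → K,
      (∀ a u u', RD q T t a u u' → ∀ c d, ∑ j ∈ RemR t, k j • (u j * (E m c d * ∑ x, ∑ y, Cm P x y • E m y x) * u' j) =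
        (if c = d then sg q P else 0) • ϖ t) ∧
      ∀ i t1, Std (i :: t1) → t.Perm (i :: t1) → k i • pt E m (Cm P) (ϖ (i :: t1)) = sg q P • ϖ t1 := by
  obtain ⟨r0, hr0, h0⟩ := H
  obtain ⟨k, hk, hk0⟩ := S.hk.exists_k ht hr0
  have trP : ∀ t', Std t' → t.Perm t' → ∀ a u u', RD q T t' a u u' → ∀ c d,
      ∑ j ∈ RemR t', k j • (u j * E m c d * u' j) = kp P c d • ϖ t' := by
    intro t' ht' hp a u u' D
    have hm' : t'.length = m + 1 := by rw [← hp.length_eq, hm]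
    have h0' : ϖ (r0 :: t') = 0 := by
      have := S.hk.eqv (w := r0 :: t) (w' := r0 :: t') ⟨hr0, ht⟩ ⟨AddR_perm hp ▸ hr0, ht'⟩ (hp.cons r0)
      obtain ⟨u, u', M⟩ := this.data
      rw [← M.u'u, ← M.au, h0, zero_mul, mul_zero]
    have cr := S.hk.CR ht' hm' (AddR_perm hp ▸ hr0) h0' (k := k)
      (by simpa only [← AddR_perm hp, ← RemR_perm hp, ← zz_perm hp, ← zr_perm hp] using hk) D
    have ce : ∀ {x : B}, x ∈ HA K T t'.length → CE E (m+1) x := fun hx => S.HA_ce hm'.le hx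
    refine S.cmp hP (n := m+1) (X := fun c d => ∑ j ∈ RemR t', k j • (u j * E m c d * u' j)) (p := ϖ t')
      (fun c d x y => Commute.sum_left _ _ _ fun j hj => ?_) (ce (S.hk.pp_mem t')) ?_
    · exact (((ce (D.mv j hj).mu x y).mul_left (S.mu.comm m (m+1) (by omega) c d x y)).mul_left (ce (D.mv j hj).mu' x y)).smul_left _
    · rw [← cr]
      have e1 : ∀ j ∈ RemR t', k j • (u j * T m * u' j) =
          ∑ a, ∑ b, ∑ c, ∑ d, r a b c d • (k j • (u j * E m a c * u' j) * E (m+1) b d) := fun j hj => by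
        conv_lhs => rw [S.tf m]
        simp only [mul_sum, sum_mul, smul_sum, smul_mul_assoc, mul_smul_comm]
        refine sum_congr rfl fun a _ => sum_congr rfl fun b _ => sum_congr rfl fun c _ =>
          sum_congr rfl fun d _ => ?_
        rw [smul_comm]
        congr 2
        rw [mul_assoc, mul_assoc, mul_assoc, mul_assoc, ((ce (D.mv j hj).mu') b d).eq]
      rw [sum_congr rfl e1]
      simp only [sum_mul, smul_sum]
      conv_rhs => rw [sum_comm]
      refine sum_congr rfl fun a _ => ?_
      conv_rhs => rw [sum_comm]
      refine sum_congr rfl fun b _ => ?_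
      conv_rhs => rw [sum_comm]
      refine sum_congr rfl fun c _ => ?_
      conv_rhs => rw [sum_comm]
  have hs : sg q P ≠ 0 := by
    have ex : ∀ j, ∃ a, j ∈ RemR t → Std (j :: a) ∧ t.Perm (j :: a) := fun j => by
      by_cases hj : j ∈ RemR t
      · obtain ⟨a, h⟩ := ht.of_rem hj; exact ⟨a, fun _ => h⟩
      · exact ⟨[], fun h => absurd h hj⟩
    choose a ha using ex
    obtain ⟨u, u', D⟩ := S.hk.exists_RD ht a ha
    have cr := congrArg (pt E (m+1) (Cm P)) (S.hk.CR ht hm hr0 h0 hk D)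
    have ce : ∀ {x : B}, x ∈ HA K T t.length → CE E (m+1) x := fun hx => S.HA_ce hm.le hx
    have e2 := pt_left E (Cm P) (ce (S.hk.pp_mem t)) 1
    rw [mul_one, S.mu.pt_one, mul_smul_comm, mul_one] at e2
    rw [e2, map_sum] at cr
    have e3 : ∀ j ∈ RemR t, pt E (m+1) (Cm P) (k j • (u j * T m * u' j)) = k j • ϖ t := fun j hj => by
      rw [map_smul, pt_right E _ (ce (D.mv j hj).mu'), pt_left E _ (ce (D.mv j hj).mu), S.ptC_T hP, mul_one, (D.mv j hj).uu']
    rw [sum_congr rfl e3, ← sum_smul] at cr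
    have : ∑ j ∈ RemR t, k j = dl P := smul_left_injective K hne cr
    rw [sg, ← this]
    exact mul_ne_zero (inv_ne_zero S.hk.q0) hk0
  refine ⟨hs, k, fun a u u' D c d => ?_, fun i t1 hi hp => ?_⟩
  · have e1 : E m c d * ∑ x, ∑ y, Cm P x y • E m y x = ∑ x, Cm P x d • E m c x := by
      simp only [mul_sum, mul_smul_comm, S.mu.mul, smul_ite, smul_zero]
      simp
    have e2 : ∀ j, k j • (u j * (∑ x, Cm P x d • E m c x) * u' j) = ∑ x, Cm P x d • k j • (u j * E m c x * u' j) := fun j => by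
      simp only [mul_sum, sum_mul, smul_sum, smul_mul_assoc, mul_smul_comm]
      exact sum_congr rfl fun x _ => smul_comm _ _ _
    simp only [e1, e2]
    rw [sum_comm]
    simp only [← smul_sum]
    simp only [trP t ht (List.Perm.refl t) a u u' D]
    simp only [smul_smul]
    rw [← sum_smul, ← S.kC hP hs]
    simp only [mul_comm]
  · have ht' := hi
    set t' := i :: t1 with et
    have hl1 : t1.length = m := by have := hp.length_eq; simp [et] at this; omega
    have ex : ∀ j, ∃ a, (j = i → a = t1) ∧ (j ∈ RemR t' → Std (j :: a) ∧ t'.Perm (j :: a)) := fun j => by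
      by_cases hj' : j = i
      · exact ⟨t1, fun _ => rfl, fun _ => by rw [hj']; exact ⟨ht', List.Perm.refl _⟩⟩
      by_cases hj : j ∈ RemR t'
      · obtain ⟨a, h⟩ := ht'.of_rem hj; exact ⟨a, fun h => absurd h hj', fun _ => h⟩
      · exact ⟨[], fun h => absurd h hj', fun h => absurd h hj⟩
    choose a ha1 ha using ex
    obtain ⟨u0, u0', D0⟩ := S.hk.exists_RD ht' a ha
    let u := Function.update u0 i (ϖ t')
    let u' := Function.update u0' i (ϖ t')
    have D : RD q T t' a u u' := ⟨D0.st, D0.pm, fun j hj => by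
      by_cases e : j = i
      · subst e
        have p2 := S.hk.pp_id ht'
        have pm := S.hk.pp_mem (T := T) t'
        simp only [u, u', Function.update_self, ha1 j rfl, ← et]
        exact ⟨pm, pm, p2, p2, p2, p2, p2, p2⟩
      · simp only [u, u', Function.update_of_ne e]
        exact D0.mv j hj⟩
    have hX := trP t' ht' hp a u u' D
    have key : ∑ j ∈ RemR t', k j • (u j * pt E m (Cm P) (u' j)) = sg q P • ϖ t' := by
      have e1 : ∑ e, ∑ x, ∑ y, Cm P x y • ((∑ j ∈ RemR t', k j • (u j * E m e x * u' j)) * E m y e) = sg q P • ϖ t' := by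
        simp only [hX, smul_mul_assoc]
        have : ∀ e, ∑ x, ∑ y, Cm P x y • kp P e x • (ϖ t' * E m y e) = sg q P • (ϖ t' * E m e e) := fun e => by
          rw [sum_comm]
          simp only [smul_smul, ← sum_smul, mul_comm (Cm P _ _), S.kC hP hs, ite_smul, zero_smul]
          simp
        simp only [this]
        rw [← smul_sum, ← mul_sum, S.mu.one, mul_one]
      rw [← e1]
      simp only [pt_apply, mul_sum, sum_mul, smul_sum, smul_mul_assoc, mul_smul_comm]
      rw [sum_comm]
      conv_rhs => rw [sum_comm]
      refine sum_congr rfl fun x _ => ?_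
      rw [sum_comm]
      conv_rhs => rw [sum_comm]
      refine sum_congr rfl fun y _ => ?_
      rw [sum_comm]
      refine sum_congr rfl fun e _ => sum_congr rfl fun j _ => ?_
      rw [smul_comm]
      simp only [mul_assoc]
    have hmem : ∀ j ∈ RemR t', pt E m (Cm P) (u' j) ∈ HA K T m := fun j hj => S.pt_HA hP (by
      have := (D.mv j hj).mu'
      rwa [← hp.length_eq, hm] at this)
    have hir : i ∈ RemR t' := (mem_RemR ht').2 ht'.rem
    have hu : u i = ϖ t' ∧ u' i = ϖ t' := by simp [u, u']
    rw [Finset.sum_eq_single_of_mem i hir, hu.1, hu.2] at key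
    · have hst1 : Std t1 := ht'.2
      have cs : CE E m (ϖ t1) := S.HA_ce hl1.le (S.hk.pp_mem t1)
      have g := S.hk.good (T := T) ht'
      have e1 : ϖ t1 * pt E m (Cm P) (ϖ t') * ϖ t1 = pt E m (Cm P) (ϖ t') := by
        rw [← pt_left E _ cs, ← pt_right E _ cs, S.hk.pp_sub hst1 (S.hk.good hst1), S.hk.pp_sub' hst1 (S.hk.good hst1)]
      have hm1 := hmem i hir
      rw [hu.2] at hm1
      obtain ⟨c, hc⟩ := (S.hk.Cthm m _ hm1 t1 t1 hst1 hst1 hl1 hl1).2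
      rw [e1] at hc
      rw [hc, mul_smul_comm, S.hk.pp_sub' hst1 (S.hk.good hst1)] at key
      have hne' : ϖ t' ≠ 0 := fun h0 => hne (by
        obtain ⟨u, u', M⟩ := (S.hk.eqv ht ht' hp).data
        rw [← M.uu', ← M.ub, h0, mul_zero, zero_mul])
      rw [smul_smul] at key
      have := smul_left_injective K hne' key
      rw [hc, smul_smul, this]
    · intro j hj hne
      have hlj : (a j).length = m := by have := (D.pm j hj).length_eq; simp [et] at this; omega
      have hsj := (D.st j hj).2
      have cs1 : CE E m (ϖ t1) := S.HA_ce hl1.le (S.hk.pp_mem t1)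
      have cs2 : CE E m (ϖ (a j)) := S.HA_ce hlj.le (S.hk.pp_mem _)
      have e0 : u' j = ϖ (a j) * u' j * ϖ t1 := by
        conv_rhs => rw [← (D.mv j hj).bu, ← mul_assoc, S.hk.pp_sub hsj (S.hk.good hsj), (D.mv j hj).bu, ← (D.mv j hj).u'a,
          mul_assoc, S.hk.pp_sub' ht'.2 (S.hk.good ht'.2), (D.mv j hj).u'a]
      have : pt E m (Cm P) (u' j) = 0 := by
        conv_lhs => rw [e0]
        rw [pt_right E _ cs1, pt_left E _ cs2]
        refine (S.hk.Cthm m _ (hmem j hj) (a j) t1 hsj ht'.2 hlj hl1).1 fun hp' => ?_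
        have h1 := (D.pm j hj).count_eq j
        rw [et, cnt_cons, cnt_cons, hp'.count_eq j, if_pos rfl, if_neg (Ne.symm hne)] at h1
        omega
      rw [this, mul_zero, smul_zero]
end TS
def Dk (E : ℕ → ι → ι → B) (P : ι → ι → ι → ι → K) (k : ℕ) : B := ∑ x, ∑ y, Cm P x y • E k y x
def Ch (E : ℕ → ι → ι → B) (P : ι → ι → ι → ι → K) (m : ℕ) : ℕ → B
  | 0 => 1
  | l+1 => Ch E P m l * Dk E P (m+l)
def PT (E : ℕ → ι → ι → B) (P : ι → ι → ι → ι → K) (m : ℕ) : ℕ → B →ₗ[K] B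
  | 0 => LinearMap.id
  | l+1 => PT E P m l ∘ₗ pt E (m+l) (Cm P)
namespace MUF
variable {E : ℕ → ι → ι → B} (H : MUF E) (P : ι → ι → ι → ι → K)
include H
lemma Dk_mem {k n : ℕ} (h : k < n) : Dk E P k ∈ H.Loc K n :=
  Subalgebra.sum_mem _ fun _ _ => Subalgebra.sum_mem _ fun _ _ => Subalgebra.smul_mem _ (H.E_mem h _ _) _
lemma Ch_mem (m l : ℕ) : Ch E P m l ∈ H.Loc K (m+l) := by
  induction l with
  | zero => exact one_mem _
  | succ l ih => exact mul_mem (H.Loc_succ ih) (H.Dk_mem P (by omega))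
lemma ED (m : ℕ) (c d : ι) : E m c d * Dk E P m = ∑ x, Cm P x d • E m c x := by
  simp only [Dk, mul_sum, mul_smul_comm, H.mul, smul_ite, smul_zero]
  simp
variable [Nontrivial B] [Nonempty ι]
lemma tr_step {n : ℕ} {x y : B} (hx : x ∈ H.Loc K (n+1)) (hy : y ∈ H.Loc K n) :
    H.tr K (n+1) (x * y * Dk E P n) = H.tr K n (pt E n (Cm P) x * y) := by
  obtain ⟨z, hz, rfl⟩ := H.blk.1 hx
  have e1 : (∑ c, ∑ d, z c d * E n c d) * y * Dk E P n = ∑ c, ∑ x, (∑ d, Cm P x d • (z c d * y)) * E n c x := by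
    simp only [sum_mul]
    refine sum_congr rfl fun c _ => ?_
    conv_rhs => rw [sum_comm]
    refine sum_congr rfl fun d _ => ?_
    rw [mul_assoc, mul_assoc, ← mul_assoc _ y, ← (H.Loc_comm le_rfl hy c d).eq, mul_assoc, H.ED]
    simp only [mul_sum, mul_smul_comm, smul_mul_assoc, mul_assoc]
  have m1 : ∀ c x, ∑ d, Cm P x d • (z c d * y) ∈ H.Loc K n := fun c x =>
    Subalgebra.sum_mem _ fun d _ => Subalgebra.smul_mem _ (mul_mem (hz c d) hy) _
  rw [e1, H.tr_blk m1, ← H.tr_sum fun c _ => m1 c c]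
  congr 1
  rw [map_sum, sum_mul]
  refine sum_congr rfl fun c _ => ?_
  rw [map_sum, sum_mul]
  refine sum_congr rfl fun d _ => ?_
  rw [pt_left E _ (fun a b => H.Loc_comm le_rfl (hz c d) a b), H.pt_E, mul_smul_comm, mul_one, smul_mul_assoc]
lemma tr_PT (m : ℕ) : ∀ (l : ℕ) {x : B}, x ∈ H.Loc K (m+l) →
    H.tr K (m+l) (x * Ch E P m l) = H.tr K m (PT E P m l x)
  | 0, x, _ => by simp [Ch, PT]
  | l+1, x, hx => by
    rw [Ch, ← mul_assoc, ← add_assoc, H.tr_step (n := m+l) P hx (H.Ch_mem P m l), tr_PT m l (H.pt_Loc _ hx)]; rfl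
end MUF
open Classical in
def rep (v : List ℕ) : List ℕ := Classical.epsilon fun w => Std w ∧ ∀ i, w.count i = v.count i
lemma rep_spec {v : List ℕ} (hv : Std v) : Std (rep v) ∧ v.Perm (rep v) := by
  have := Classical.epsilon_spec (p := fun w => Std w ∧ ∀ i, w.count i = v.count i) ⟨v, hv, fun _ => rfl⟩
  exact ⟨this.1, List.perm_iff_count.2 fun i => (this.2 i).symm⟩
lemma rep_perm {v v' : List ℕ} (h : v.Perm v') : rep v = rep v' := by
  unfold rep; congr 1; funext w; simp only [h.count_eq]
open Classical in
def PF (l : ℕ) (t : List ℕ) : Finset (List ℕ) :=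
  t.permutations.toFinset.filter fun w => Std w ∧ w.drop l = rep (w.drop l)
lemma mem_PF {l : ℕ} {t w : List ℕ} : w ∈ PF l t ↔ t.Perm w ∧ Std w ∧ w.drop l = rep (w.drop l) := by
  simp only [PF, mem_filter, List.mem_toFinset, List.mem_permutations, List.perm_comm]
lemma PF_sum {M : Type*} [AddCommMonoid M] {l : ℕ} {t : List ℕ} (ht : Std t) {a : ℕ → List ℕ} (h0 : t ≠ [])
    (ha : ∀ j ∈ RemR t, Std (j :: a j) ∧ t.Perm (j :: a j)) (f : List ℕ → M) :
    ∑ w ∈ PF (l+1) t, f w = ∑ j ∈ RemR t, ∑ w ∈ PF l (a j), f (j :: w) := by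
  rw [Finset.sum_sigma']
  symm
  refine Finset.sum_bij (fun p _ => p.1 :: p.2) ?_ ?_ ?_ (fun _ _ => rfl)
  · rintro ⟨j, w⟩ hp
    obtain ⟨hj, hw⟩ := Finset.mem_sigma.1 hp
    obtain ⟨h1, h2, h3⟩ := mem_PF.1 hw
    dsimp only at hj h1 h2 h3 ⊢
    exact mem_PF.2 ⟨(ha j hj).2.trans (h1.cons j), ⟨AddR_perm h1 ▸ (ha j hj).1.1, h2⟩, h3⟩
  · rintro ⟨j, w⟩ _ ⟨j', w'⟩ _ h
    injection h with h1 h2; dsimp only at h1 h2; rw [h1, h2]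
  · intro w hw
    obtain ⟨h1, h2, h3⟩ := mem_PF.1 hw
    rcases w with _ | ⟨j, w⟩
    · exact absurd (List.perm_nil.1 h1) h0
    · have hj : j ∈ RemR t := (mem_RemR ht).2 (by rw [h1.count_eq, h1.count_eq]; exact h2.rem)
      exact ⟨⟨j, w⟩, Finset.mem_sigma.2 ⟨hj, mem_PF.2 ⟨((ha j hj).2.symm.trans h1).cons_inv, h2.2, h3⟩⟩, rfl⟩
def Hyp (q : K) (T : ℕ → B) (l : ℕ) (t : List ℕ) : Prop := ∀ s, Std s → (∀ i, s.count i ≤ t.count i) →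
  t.length < s.length + l → ∃ r0 ∈ AddR s, pp q T (r0 :: s) = 0
lemma HK.perm_ne (h : HK q T) {t t' : List ℕ} (ht : Std t) (ht' : Std t') (hp : t.Perm t') (h0 : ϖ t ≠ 0) :
    ϖ t' ≠ 0 := fun e => h0 <| by
  obtain ⟨u, u', M⟩ := (h.eqv ht ht' hp).data
  rw [← M.uu', ← M.ub, e, mul_zero, zero_mul]
namespace TS
variable {r P : ι → ι → ι → ι → K} {E : ℕ → ι → ι → B} (S : TS q r E T) (hP : HP r P)
include S hP
lemma PT_cross {v : List ℕ} (hv : Std v) : ∀ (l : ℕ) {t t' : List ℕ}, t ∈ PathsF v l → t' ∈ PathsF v l → t ≠ t' →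
    ∀ x ∈ HA K T (v.length+l), PT E P v.length l (ϖ t * x * ϖ t') = 0
  | 0, t, t', ht, ht', hne, _, _ => by
    simp only [PathsF, Finset.mem_singleton] at ht ht'; exact absurd (ht.trans ht'.symm) hne
  | l+1, t, t', ht, ht', hne, x, hx => by
    have s1 := PathsF_std hv ht
    have s2 := PathsF_std hv ht'
    obtain ⟨i, w, rfl, hw, hi⟩ := mem_PathsF_succ.1 ht
    obtain ⟨j, w', rfl, hw', hj⟩ := mem_PathsF_succ.1 ht'
    have l1 := (PathsF_std hv hw).2
    have l2 := (PathsF_std hv hw').2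
    have m1 : ϖ (i :: w) ∈ HA K T (v.length + (l+1)) := s1.2 ▸ S.hk.pp_mem _
    have m2 : ϖ (j :: w') ∈ HA K T (v.length + (l+1)) := s2.2 ▸ S.hk.pp_mem _
    by_cases e : w = w'
    · subst e
      have hij : i ≠ j := fun e => hne (by rw [e])
      have : ¬ (i :: w).Perm (j :: w) := fun hp => by
        have := hp.count_eq i
        rw [List.count_cons_self, List.count_cons_of_ne (Ne.symm hij)] at this; omega
      rw [(S.hk.Cthm _ x hx _ _ s1.1 s2.1 s1.2 s2.2).1 this, map_zero]
    · rw [← S.hk.pp_sub s1.1.2 (S.hk.good s1.1.2) i, ← S.hk.pp_sub' s2.1.2 (S.hk.good s2.1.2) j]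
      have c1 := S.HA_ce l1.le (S.hk.pp_mem w)
      have c2 := S.HA_ce l2.le (S.hk.pp_mem w')
      have e1 : ϖ w * ϖ (i :: w) * x * (ϖ (j :: w') * ϖ w') =
        ϖ w * (ϖ (i :: w) * x * ϖ (j :: w')) * ϖ w' := by simp only [mul_assoc]
      rw [PT, LinearMap.comp_apply, e1, pt_right E _ c2, pt_left E _ c1]
      exact PT_cross hv l hw hw' e _ (S.pt_HA hP (mul_mem (mul_mem m1 hx) m2))
variable [Nontrivial B] [Nonempty ι]
lemma opx (m : ℕ) : ∀ (l : ℕ) (t : List ℕ), Std t → t.length = m + l → ϖ t ≠ 0 → Hyp q T l t →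
    (l ≠ 0 → sg q P ≠ 0) ∧ ∃ k : List ℕ → K, (∀ A ∈ (S.mu.shift m).Loc K l, ∀ N, m + l ≤ N → ∀ Z ∈ S.mu.Loc K N,
      (∀ x ∈ HA K T (m+l), Commute x Z) → ∑ w ∈ PF l t, k w * S.mu.tr K N (ϖ w * A * Ch E P m l * Z) =
        sg q P ^ l * (S.mu.shift m).tr K l A * S.mu.tr K N (ϖ t * Z)) ∧
      ∀ w ∈ PF l t, k w • PT E P m l (ϖ w) = sg q P ^ l • ϖ (w.drop l) := by
  intro l
  induction l with
  | zero =>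
    intro t ht hl hne _
    obtain ⟨r1, r2⟩ := rep_spec ht
    have e0 : PF 0 t = {rep t} := by
      ext w
      rw [mem_PF, Finset.mem_singleton, List.drop_zero]
      constructor
      · rintro ⟨h1, _, h3⟩; rw [h3, rep_perm h1]
      · rintro rfl; exact ⟨r2, r1, rep_perm r2⟩
    refine ⟨fun h => absurd rfl h, fun _ => 1, fun A hA N hN Z hZ hc => ?_, fun w _ => by simp [PT]⟩
    obtain ⟨c, rfl⟩ := (S.mu.shift m).Loc0 hA
    obtain ⟨u, u', M⟩ := (S.hk.eqv ht r1 r2).data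
    rw [hl] at M
    have L : ∀ {x : B}, x ∈ HA K T (m+0) → x ∈ S.mu.Loc K N := fun h => S.mu.Loc_mono hN (TF_mem S.mu S.tf h)
    have lu := L M.mu
    have lu' := L M.mu'
    rw [e0, Finset.sum_singleton, (S.mu.shift m).tr_smul _ (one_mem _), (S.mu.shift m).tr_one0, one_mul, pow_zero, one_mul, mul_one,
      Ch, mul_one, mul_smul_comm, mul_one, smul_mul_assoc,
      S.mu.tr_smul _ (mul_mem (by rw [← M.u'u]; exact mul_mem lu' lu) hZ)]
    congr 1
    rw [← M.u'u, ← M.uu', mul_assoc, S.mu.tr_comm lu' (mul_mem lu hZ), mul_assoc, mul_assoc, (hc _ M.mu').eq]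
  | succ l ih =>
    intro t ht hl hne hy
    obtain ⟨hs, k, hk1, hk2⟩ := S.main_k hP ht (m := m + l) hl hne (hy t ht (fun _ => le_rfl) (by omega))
    have h0 : t ≠ [] := fun e => by rw [e] at hl; simp at hl
    have ex : ∀ j, ∃ a, j ∈ RemR t → Std (j :: a) ∧ t.Perm (j :: a) := fun j => by
      by_cases hj : j ∈ RemR t
      · obtain ⟨a, h⟩ := ht.of_rem hj; exact ⟨a, fun _ => h⟩
      · exact ⟨[], fun h => absurd h hj⟩
    choose a ha using ex
    obtain ⟨u, u', D⟩ := S.hk.exists_RD ht a ha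
    have al : ∀ j ∈ RemR t, (a j).length = m + l := fun j hj => by
      have := (ha j hj).2.length_eq; rw [List.length_cons] at this; omega
    have IH := fun j (hj : j ∈ RemR t) => (ih (a j) (ha j hj).1.2 (al j hj)
      (fun e => S.hk.perm_ne ht (ha j hj).1 (ha j hj).2 hne (by rw [pp, e, zero_mul]))
      (fun s hs h1 h2 => hy s hs (fun i => (h1 i).trans (by rw [(ha j hj).2.count_eq, cnt_cons]; omega))
        (by rw [al j hj] at h2; omega))).2
    choose! kj IH1 IH2 using IH
    refine ⟨fun _ => hs, fun w => k w.headI * kj w.headI w.tail, ?_, ?_⟩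
    · intro A hA N hN Z hZ hc
      obtain ⟨y, hy', rfl⟩ := (S.mu.shift m).blk.1 hA
      have yL : ∀ c d, y c d ∈ S.mu.Loc K (m+l) := fun c d => by
        simpa using (S.mu.tr_mul (one_mem (S.mu.Loc K m)) (hy' c d)).1
      have L : ∀ {n : ℕ}, n ≤ N → ∀ {x : B}, x ∈ S.mu.Loc K n → x ∈ S.mu.Loc K N := fun h _ hx => S.mu.Loc_mono h hx
      have LH : ∀ {n : ℕ}, n ≤ N → ∀ {x : B}, x ∈ HA K T n → x ∈ S.mu.Loc K N := fun h _ hx => L h (TF_mem S.mu S.tf hx)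
      have LE : ∀ c d, E (m+l) c d ∈ S.mu.Loc K N := fun c d => S.mu.E_mem (by omega) c d
      have LD : Dk E P (m+l) ∈ S.mu.Loc K N := S.mu.Dk_mem P (by omega)
      have LC := L (by omega) (S.mu.Ch_mem P m l)
      have key : ∀ c d, ∑ w ∈ PF (l+1) t, k w.headI * kj w.headI w.tail *
          S.mu.tr K N (ϖ w * (y c d * E (m+l) c d) * Ch E P m (l+1) * Z) =
          sg q P ^ l * (S.mu.shift m).tr K l (y c d) * ((if c = d then sg q P else 0) * S.mu.tr K N (ϖ t * Z)) := by
        intro c d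
        rw [PF_sum ht h0 ha]
        dsimp only [List.headI, List.tail_cons]
        have st : ∀ j ∈ RemR t, ∑ w ∈ PF l (a j), k j * kj j w * S.mu.tr K N (ϖ (j :: w) * (y c d * E (m+l) c d) * Ch E P m (l+1) * Z)
            = sg q P ^ l * (S.mu.shift m).tr K l (y c d) * S.mu.tr K N (k j • (u j * (E (m+l) c d * Dk E P (m+l)) * u' j) * Z) := by
          intro j hj
          set e := aeval (JM q T (m+l)) (ee q (a j) j) with he
          have em : e ∈ S.mu.Loc K N := LH hN (S.hk.aeval_mem (by omega) _)
          have ec : ∀ x ∈ HA K T (m+l), Commute x e := fun x hx => (S.hk.aeval_comm le_rfl hx _).symm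
          have W : E (m+l) c d * Dk E P (m+l) * Z * e ∈ S.mu.Loc K N := mul_mem (mul_mem (mul_mem (LE c d) LD) hZ) em
          have i1 := IH1 j hj _ (hy' c d) N (by omega) _ W fun x hx =>
            (((S.HA_ce le_rfl hx c d).mul_right (Commute.sum_right _ _ _ fun _ _ => Commute.sum_right _ _ _ fun _ _ =>
              (S.HA_ce le_rfl hx _ _).smul_right _)).mul_right (hc x (HA_mono (by omega) hx))).mul_right (ec x hx)
          have e1 : ∀ w ∈ PF l (a j), S.mu.tr K N (ϖ (j :: w) * (y c d * E (m+l) c d) * Ch E P m (l+1) * Z) =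
              S.mu.tr K N (ϖ w * y c d * Ch E P m l * (E (m+l) c d * Dk E P (m+l) * Z * e)) := fun w hw => by
            have hw := (mem_PF.1 hw).1
            have lw : w.length = m + l := by rw [← hw.length_eq, al j hj]
            have wm : ϖ w ∈ S.mu.Loc K N := LH (by omega) (S.hk.pp_mem w)
            rw [S.hk.pp_cons', lw, ← ee_perm hw, ← he]
            have : e * ϖ w * (y c d * E (m+l) c d) * Ch E P m (l+1) * Z =
                e * (ϖ w * y c d * Ch E P m l * (E (m+l) c d * Dk E P (m+l) * Z)) := by
              simp only [Ch, mul_assoc]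
              rw [← mul_assoc (E (m+l) c d) (Ch E P m l), ← (S.mu.Loc_comm le_rfl (S.mu.Ch_mem P m l) c d).eq]
              simp only [mul_assoc]
            rw [this, S.mu.tr_comm em (mul_mem (mul_mem (mul_mem wm (L (by omega) (yL c d))) LC) (mul_mem (mul_mem (LE c d) LD) hZ))]
            simp only [mul_assoc]
          rw [sum_congr rfl fun w hw => by rw [e1 w hw, mul_assoc], ← mul_sum, i1]
          have um := (D.mv j hj).mu
          have um' := (D.mv j hj).mu'
          rw [hl] at um um'
          have am : ϖ (a j) ∈ S.mu.Loc K N := LH ((al j hj).le.trans (by omega)) (S.hk.pp_mem _)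
          have F : E (m+l) c d * Dk E P (m+l) ∈ S.mu.Loc K N := mul_mem (LE c d) LD
          rw [smul_mul_assoc, S.mu.tr_smul _ (mul_mem (mul_mem (mul_mem (LH hN um) F) (LH hN um')) hZ), mul_left_comm]
          congr 2
          rw [← mul_assoc (ϖ (a j)), S.mu.tr_comm (mul_mem am (mul_mem F hZ)) em, ← mul_assoc, he, ← al j hj, ← S.hk.pp_cons',
            ← (D.mv j hj).u'u, al j hj, mul_assoc (u' j), S.mu.tr_comm (LH hN um') (mul_mem (LH hN um) (mul_mem F hZ))]
          simp only [mul_assoc]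
          rw [(hc _ um').eq]
        rw [sum_congr rfl st, ← mul_sum, ← S.mu.tr_sum, ← sum_mul]
        · have := hk1 a u u' D c d
          rw [Dk, this, smul_mul_assoc, S.mu.tr_smul _ (mul_mem (LH hN (hl ▸ S.hk.pp_mem t)) hZ)]
        · intro j hj
          have um := (D.mv j hj).mu
          have um' := (D.mv j hj).mu'
          rw [hl] at um um'
          exact mul_mem (Subalgebra.smul_mem _ (mul_mem (mul_mem (LH hN um) (mul_mem (LE c d) LD)) (LH hN um')) _) hZ
      have e2 : ∀ w ∈ PF (l+1) t, k w.headI * kj w.headI w.tail *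
          S.mu.tr K N (ϖ w * (∑ c, ∑ d, y c d * E (m+l) c d) * Ch E P m (l+1) * Z) = ∑ c, ∑ d,
          k w.headI * kj w.headI w.tail * S.mu.tr K N (ϖ w * (y c d * E (m+l) c d) * Ch E P m (l+1) * Z) := fun w hw => by
        have lw : w.length = m + (l + 1) := by rw [← (mem_PF.1 hw).1.length_eq, hl]
        have mm : ∀ c d, ϖ w * (y c d * E (m+l) c d) * Ch E P m (l+1) * Z ∈ S.mu.Loc K N := fun c d =>
          mul_mem (mul_mem (mul_mem (LH (by omega) (S.hk.pp_mem w)) (mul_mem (L (by omega) (yL c d)) (LE c d)))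
            (L hN (S.mu.Ch_mem P m (l+1)))) hZ
        simp only [← mul_sum]
        congr 1
        rw [sum_congr rfl fun c _ => (S.mu.tr_sum fun d _ => mm c d).symm,
          ← S.mu.tr_sum fun c _ => Subalgebra.sum_mem _ fun d _ => mm c d]
        simp only [mul_sum, sum_mul]
      rw [sum_congr rfl e2, sum_comm, (S.mu.shift m).tr_blk hy', mul_sum, sum_mul]
      refine sum_congr rfl fun c _ => ?_
      rw [sum_comm, sum_congr rfl fun d _ => key c d, sum_eq_single c]
      · rw [if_pos rfl]; ring
      · intro d _ h; rw [if_neg (Ne.symm h)]; ring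
      · simp
    · intro w hw
      obtain ⟨h1, h2, h3⟩ := mem_PF.1 hw
      rcases w with _ | ⟨j, w⟩
      · exact absurd (List.perm_nil.1 h1) h0
      · have hj : j ∈ RemR t := (mem_RemR ht).2 (by rw [h1.count_eq, h1.count_eq]; exact h2.rem)
        have := IH2 j hj w (mem_PF.2 ⟨((ha j hj).2.symm.trans h1).cons_inv, h2.2, h3⟩)
        dsimp only [List.headI, List.tail_cons, List.drop_succ_cons]
        rw [PT, LinearMap.comp_apply, mul_comm, mul_smul, ← map_smul, hk2 j w h2 h1, map_smul, smul_comm, this, smul_smul, pow_succ', List.drop_succ_cons]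
end TS
def ds (l : ℕ) : List ℕ → Finset (List ℕ)
  | [] => if l = 0 then {[]} else ∅
  | a :: μ => (Finset.range (l+1)).biUnion fun j =>
      if gd μ 0 + j ≤ a then (ds (l-j) μ).image (List.cons (a-j)) else ∅
lemma mem_ds {μ : List ℕ} : ∀ {l : ℕ} {t : List ℕ}, t ∈ ds l μ ↔ t.length = μ.length ∧ t.sum + l = μ.sum ∧
    ∀ i, gd t i ≤ gd μ i ∧ gd μ (i+1) ≤ gd t i := by
  induction μ with
  | nil =>
    intro l t
    simp only [ds]
    constructor
    · intro h
      split_ifs at h with hb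
      · rw [Finset.mem_singleton.1 h]; simp [hb]
      · simp at h
    · rintro ⟨h1, h2, h3⟩
      obtain rfl := List.length_eq_zero_iff.1 h1
      simp at h2
      simp [h2]
  | cons m μ ih =>
    intro l t
    simp only [ds, Finset.mem_biUnion, mem_range]
    constructor
    · rintro ⟨j, hj, h⟩
      split_ifs at h with hb
      · obtain ⟨u, hu, rfl⟩ := mem_image.1 h
        obtain ⟨h1, h2, h4⟩ := ih.1 hu
        refine ⟨by simp [h1], by simp [← h2]; omega, fun i => ?_⟩
        cases i with
        | zero => simp at hb ⊢; omega
        | succ i => simpa using h4 i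
      · simp at h
    · rintro ⟨h1, h2, h4⟩
      cases t with
      | nil => simp at h1
      | cons a t =>
        have h40 := h4 0
        simp at h1 h2 h40
        have hsum : t.sum ≤ μ.sum := by
          rw [← sum_gd, ← sum_gd, h1]
          exact Finset.sum_le_sum fun i _ => by simpa using (h4 (i+1)).1
        refine ⟨m - a, by omega, ?_⟩
        rw [if_pos (by simp; omega), mem_image]
        exact ⟨t, ih.2 ⟨h1, by omega, fun i => by simpa using h4 (i+1)⟩, by congr 1; omega⟩
lemma ds_sum {M : Type*} [AddCommMonoid M] (f : List ℕ → M) (l a : ℕ) (μ : List ℕ) :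
    ∑ t ∈ ds l (a :: μ), f t =
      ∑ j ∈ Finset.range (l+1), if gd μ 0 + j ≤ a then ∑ t ∈ ds (l-j) μ, f ((a-j) :: t) else 0 := by
  rw [ds, Finset.sum_biUnion]
  · refine sum_congr rfl fun j _ => ?_
    split_ifs
    · rw [Finset.sum_image fun x _ y _ h => List.cons_injective h]
    · simp
  · intro i _ j _ hij
    rw [Function.onFun, Finset.disjoint_left]
    intro t h1 h2
    apply hij
    split_ifs at h1 h2 <;> simp at h1 h2
    obtain ⟨x, _, rfl⟩ := h1
    obtain ⟨y, _, h⟩ := h2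
    have := (List.cons.inj h).1
    omega
lemma Std.app {v : List ℕ} : ∀ {s : List ℕ}, Std (s ++ v) → Std v
  | [], h => h
  | _ :: _, h => Std.app h.2
lemma mem_drop {w : List ℕ} (hw : Std w) {m l : ℕ} (hl : w.length = m + l) :
    Std (w.drop l) ∧ (w.drop l).length = m ∧ w ∈ PathsF (w.drop l) l := by
  have e := List.take_append_drop l w
  have hs : Std (w.take l ++ w.drop l) := e.symm ▸ hw
  refine ⟨hs.app, by simp; omega, ?_⟩
  have := PathsF_mem_app hs
  rwa [e, List.length_take, min_eq_left (by omega)] at this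
namespace TS
variable {r P : ι → ι → ι → ι → K} {E : ℕ → ι → ι → B} (S : TS q r E T) (hP : HP r P)
include S hP
variable [Nontrivial B] [Nonempty ι]
lemma dual0 {m l : ℕ} {t : List ℕ} (ht : Std t) (hl : t.length = m + l) (hne : ϖ t ≠ 0) (hy : Hyp q T l t)
    {ρ : List ℕ → K} (hρ : ∀ w ∈ PF l t, ϖ w * pp q (fun i => T (m+i)) (row l) * ϖ w = ρ w • ϖ w) :
    S.dd (row l) * S.dd t = ∑ w ∈ PF l t, ρ w * S.dd (w.drop l) := by
  obtain ⟨hs, k, h1, h2⟩ := S.opx hP m l t ht hl hne hy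
  have SY := S.hk.SYrow m
  have sm := SY.mem l
  have st := S.shift_tr m (row l)
  rw [List.length_replicate] at st
  set s := pp q (fun i => T (m+i)) (row l)
  have h1 := h1 s st.1 (m+l) le_rfl 1 (one_mem _) fun x _ => Commute.one_right x
  rw [st.2, mul_one, mul_assoc, show S.mu.tr K (m+l) (ϖ t) = S.dd t by rw [dd, hl]] at h1
  have h0 : sg q P ^ l ≠ 0 := by
    rcases eq_or_ne l 0 with rfl | h
    · simp
    · exact pow_ne_zero _ (hs h)
  refine mul_left_cancel₀ h0 ?_
  rw [← h1, mul_sum]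
  refine sum_congr rfl fun w hw => ?_
  have hw' := mem_PF.1 hw
  obtain ⟨d1, d2, d3⟩ := mem_drop hw'.2.1 (hw'.1.length_eq.symm.trans hl)
  have lw : ∀ w' ∈ PathsF (w.drop l) l, ϖ w' ∈ HA K T (m+l) := fun w' h => by
    rw [← d2, ← (PathsF_std d1 h).2]; exact S.hk.pp_mem w'
  have pL : ∀ (l : ℕ) {x : B}, x ∈ S.mu.Loc K (m+l) → PT E P m l x ∈ S.mu.Loc K m := by
    intro l
    induction l with
    | zero => exact fun h => h
    | succ l ih => exact fun h => ih (S.mu.pt_Loc _ h)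
  have LL := fun x => TF_mem (x := x) (n := m+l) S.mu S.tf
  rw [mul_one, S.mu.tr_PT P m l (LL _ (mul_mem (lw w d3) sm)), (S.hk.ins SY d1 d2 d3).1, map_sum,
    Finset.sum_eq_single_of_mem w d3 fun w' hw' hn => by
      have := S.PT_cross hP d1 l d3 hw' hn.symm s (by rwa [d2])
      rwa [d2] at this]
  rw [hρ w hw, map_smul, S.mu.tr_smul _ (pL l (LL _ (lw w d3))), mul_left_comm, ← S.mu.tr_smul _ (pL l (LL _ (lw w d3))), h2 w hw,
    S.mu.tr_smul _ (by rw [← d2]; exact S.pp_loc _), dd, d2]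
  ring
lemma dual1 [CharZero K] {μ : List ℕ} (hμ : Pt μ) {l m n : ℕ} (h0 : S.dp μ ≠ 0) (hV : ∀ κ, Pt κ → n < gd κ m → S.dp κ = 0)
    (hn : n ≤ gd μ (m+l)) (hm : m = 0 ∨ n + l ≤ gd μ (m-1)) (hsum : l ≤ μ.sum) :
    S.dd (row l) * S.dp μ = ∑ s ∈ ds l μ, S.dp s := by
  classical
  obtain ⟨t, ht, hc⟩ := exists_std hμ
  have hlen := count_len μ t hc
  obtain ⟨M, hM⟩ : ∃ M, t.length = M + l := ⟨μ.sum - l, by omega⟩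
  rw [S.dp_eq ht hc] at h0 ⊢
  have hne : ϖ t ≠ 0 := fun e => h0 ((S.dd_zero ht).2 e)
  have hy : Hyp q T l t := by
    intro s hs hle hlt
    obtain ⟨c, hp⟩ : ∃ c, t.Perm (s ++ c) := ⟨_, (List.subperm_append_diff_self_of_count_le fun x _ => hle x).symm⟩
    have cc : ∀ i, t.count i = s.count i + c.count i := fun i => by rw [hp.count_eq, List.count_append]
    have cl : c.length < l := by have := hp.length_eq; rw [List.length_append] at this; omega
    have tm : t.count m ≤ n := by
      by_contra hcon
      exact h0 (by rw [← S.dp_eq ht hc]; exact hV μ hμ (by rw [← hc]; omega))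
    have sn : n ≤ s.count m := by
      by_contra hcon
      have : (Finset.range l).image (m + ·) ⊆ c.toFinset := fun x hx => by
        obtain ⟨i, hi, rfl⟩ := mem_image.1 hx
        rw [List.mem_toFinset, ← List.count_pos_iff]
        have h1 := hs.le (Nat.le_add_right m i)
        have h2 := ht.le (show m + i ≤ m + l by have := mem_range.1 hi; omega)
        rw [hc (m+l)] at h2
        have := cc (m+i)
        omega
      have := Finset.card_le_card this
      rw [Finset.card_image_of_injective _ (fun a b h => by simpa using h), Finset.card_range] at this
      have := c.toFinset_card_le
      omega
    have ad : m ∈ AddR s := (hs.mem_iff m).2 <| hm.imp id fun h => by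
      have := cc (m-1)
      have := cc m
      have := List.count_le_length (l := c) (a := m-1)
      rw [← hc] at h
      omega
    refine ⟨m, ad, ?_⟩
    have hs' : Std (m :: s) := ⟨ad, hs⟩
    rw [← S.dd_zero hs']
    have ec : ∀ i, (m :: s).count i = gd ((List.range (s.length+1)).map (m :: s).count) i := fun i => by
      rw [gd_lam]
      split_ifs with h
      · rfl
      · exact List.count_eq_zero_of_not_mem fun hi => h (by simpa using hs'.lt i hi)
    rw [← S.dp_eq hs' ec]
    refine hV _ (fun i => ?_) ?_
    · rw [← ec, ← ec]; exact hs'.le (by omega)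
    · rw [← ec, List.count_cons_self]; omega
  have SY := S.hk.SYrow M
  have sm := SY.mem l
  have hr : ∀ w, ∃ ρ : K, Std w → w.length = M + l → ϖ w * pp q (fun i => T (M+i)) (row l) * ϖ w = ρ • ϖ w := fun w => by
    by_cases h : Std w ∧ w.length = M + l
    · obtain ⟨ρ, h⟩ := (S.hk.Cthm _ _ sm w w h.1 h.1 h.2 h.2).2; exact ⟨ρ, fun _ _ => h⟩
    · exact ⟨0, fun h1 h2 => absurd ⟨h1, h2⟩ h⟩
  choose ρ hρ using hr
  have F0 : ∀ w ∈ PF l t, t.Perm w ∧ Std w ∧ w.length = M + l ∧ Std (w.drop l) ∧ (w.drop l).length = M ∧ w ∈ PathsF (w.drop l) l := fun w hw => by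
    have hw' := mem_PF.1 hw
    have lw := hw'.1.length_eq.symm.trans hM
    exact ⟨hw'.1, hw'.2.1, lw, mem_drop hw'.2.1 lw⟩
  rw [S.dual0 hP ht hM hne hy (fun w hw => hρ w (F0 w hw).2.1 (F0 w hw).2.2.1),
    ← Finset.sum_filter_add_sum_filter_not _ (fun w => HSt (w.drop l) w), add_eq_left.2]
  swap
  · refine sum_eq_zero fun w hw => ?_
    obtain ⟨hw, hn⟩ := mem_filter.1 hw
    obtain ⟨f1, f2, f3, f4, f5, f6⟩ := F0 w hw
    have e := hρ w f2 f3
    rw [mul_assoc, S.hk.Zthm SY f4 f5 l w f6 hn, mul_zero] at e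
    rw [(smul_eq_zero.1 e.symm).resolve_right (S.hk.perm_ne ht f2 f1 hne), zero_mul]
  have Fm : ∀ w ∈ PF l t, ∀ i, gd ((List.range μ.length).map (w.drop l).count) i = (w.drop l).count i := by
    intro w hw i
    obtain ⟨f1, f2, f3, f4, f5, f6⟩ := F0 w hw
    rw [gd_lam]
    split_ifs with hi
    · rfl
    · have := PathsF_count f6 i
      rw [← f1.count_eq, hc, gd, List.getD_eq_default _ _ (by omega)] at this
      omega
  rw [← Finset.sum_fiberwise_of_maps_to (g := fun w => (List.range μ.length).map (w.drop l).count) (t := ds l μ)]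
  swap
  · intro w hw
    obtain ⟨hw, hH⟩ := mem_filter.1 hw
    obtain ⟨f1, f2, f3, f4, f5, f6⟩ := F0 w hw
    have e := count_len _ (w.drop l) fun i => (Fm w hw i).symm
    refine mem_ds.2 ⟨by simp, by omega, fun i => ?_⟩
    rw [Fm w hw, ← hc, ← hc, f1.count_eq, f1.count_eq]
    exact ⟨PathsF_count f6 i, hH i⟩
  refine sum_congr rfl fun u hu => ?_
  obtain ⟨h1, h2, h4⟩ := mem_ds.1 hu
  have hu' : Pt u := fun i => (h4 (i+1)).1.trans (h4 i).2
  obtain ⟨v0, hv0, hvc⟩ := exists_std hu'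
  obtain ⟨hv, hp0⟩ := rep_spec hv0
  have hvc : ∀ i, (rep v0).count i = gd u i := fun i => by rw [← hp0.count_eq, hvc]
  have hrr : rep (rep v0) = rep v0 := (rep_perm hp0).symm
  set v := rep v0
  have lv := count_len u v hvc
  obtain ⟨t0, ht0, hp⟩ := path_exists hv l t ht (fun i => by rw [hc, hvc]; exact (h4 i).1) (by omega)
  have hS := PathsF_std hv ht0
  have hH : HSt v t0 := fun i => by rw [← hp.count_eq, hc, hvc]; exact (h4 i).2
  have dv : ∀ w ∈ PathsF v l, w.drop l = v := fun w hw => by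
    obtain ⟨s, rfl, rfl⟩ := PathsF_app hw; simp
  have eF : ((PF l t).filter (fun w => HSt (w.drop l) w)).filter (fun w => (List.range μ.length).map (w.drop l).count = u) = Fil v l t0 := by
    ext w
    rw [mem_filter, mem_filter, mem_Fil]
    constructor
    · rintro ⟨⟨hw, hh⟩, e⟩
      obtain ⟨f1, f2, f3, f4, f5, f6⟩ := F0 w hw
      have : w.drop l = v := by
        rw [(mem_PF.1 hw).2.2, ← hrr]
        exact rep_perm (List.perm_iff_count.2 fun i => by rw [← Fm w hw, e, hvc])
      exact ⟨this ▸ f6, hp.symm.trans f1⟩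
    · rintro ⟨hw, e⟩
      have ed := dv w hw
      have hm : w ∈ PF l t := mem_PF.2 ⟨hp.trans e, (PathsF_std hv hw).1, by rw [ed, hrr]⟩
      refine ⟨⟨hm, fun i => by rw [ed, ← e.count_eq]; exact hH i⟩, gd_ext (by simp [h1]) fun i => by rw [Fm w hm, ed, hvc]⟩
  rw [eF, S.dp_eq hv hvc, sum_congr rfl fun w hw => by rw [dv w (mem_Fil.1 hw).1], ← sum_mul,
    S.hk.pieri SY hv (by omega) (fun w hw => ?_) ht0 (S.hk.perm_ne ht hS.1 hp hne), if_pos hH, one_mul]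
  have := PathsF_std hv hw
  exact hρ w this.1 (by omega)
end TS
lemma gd_anti {μ : List ℕ} (h : Pt μ) {i j : ℕ} (hij : i ≤ j) : gd μ j ≤ gd μ i := antitone_nat_of_succ_le h hij
lemma gd0_le (μ : List ℕ) : gd μ 0 ≤ μ.sum := by cases μ <;> simp
lemma hs_tail {b l a : ℕ} {μ t : List ℕ} (h : (a :: t) ∈ hs b l μ) : l ≤ a ∧ (a = l → t = μ) := by
  obtain ⟨h1, h2, -, h4⟩ := mem_hs.1 h
  have hl : t.length = μ.length := by simpa using h1
  have hle : ∀ i, gd t i ≤ gd μ i := fun i => by simpa using (h4 i).2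
  have hs : t.sum ≤ μ.sum := by
    rw [← sum_gd, ← sum_gd, hl]; exact Finset.sum_le_sum fun i _ => hle i
  simp only [List.sum_cons] at h2
  refine ⟨by omega, fun e => gd_ext hl fun i => ?_⟩
  have hs : t.sum = μ.sum := by omega
  rw [← sum_gd, ← sum_gd, hl, Finset.sum_eq_sum_iff_of_le fun i _ => hle i] at hs
  by_cases hi : i < μ.length
  · exact hs i (mem_range.2 hi)
  · rw [gd, gd, List.getD_eq_default _ _ (by omega), List.getD_eq_default _ _ (by omega)]
lemma hs_b {b b' l : ℕ} {μ : List ℕ} (h : l + μ.sum ≤ b) (h' : l + μ.sum ≤ b') : hs b l μ = hs b' l μ := by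
  ext t
  simp only [mem_hs]
  refine and_congr_right fun _ => and_congr_right fun h2 => and_congr_left fun _ => ?_
  have := gd0_le t
  constructor <;> intro <;> omega
namespace PS
variable {d : List ℕ → ℝ} {h : ℕ → ℝ} (A : PS d h)
include A
lemma le_of_mem {μ t : List ℕ} (hμ : Pt μ) {l : ℕ} (ht : t ∈ hs (l + μ.sum) l μ) : d t ≤ h l * d μ := by
  rw [A.pieri μ hμ l _ le_rfl]
  exact Finset.single_le_sum (fun s _ => A.nonneg s) ht
lemma cons_le {a : ℕ} {μ : List ℕ} (hμ : Pt (a :: μ)) : d (a :: μ) ≤ h a * d μ := by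
  refine A.le_of_mem (Pt_cons.1 hμ).2 (mem_hs.2 ⟨by simp, by simp [add_comm], by simp, fun i => ⟨?_, by simp⟩⟩)
  cases i with
  | zero => simpa using (Pt_cons.1 hμ).1
  | succ i => simpa using (Pt_cons.1 hμ).2 i
lemma one (l : ℕ) : d [l] = h l := by
  have := A.pieri [] (fun i => by simp) l l (by simp)
  simp [hs, A.nil] at this
  exact this.symm
lemma hnn (l : ℕ) : 0 ≤ h l := A.one l ▸ A.nonneg _
lemma cross {N l : ℕ} {μ : List ℕ} (hμ : Pt (N :: μ)) (hl : N ≤ l) :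
    h (l+1) * d (N :: μ) ≤ h l * d ((N+1) :: μ) := by
  have hμ' : Pt ((N+1) :: μ) := Pt_cons.2 ⟨(Pt_cons.1 hμ).1.trans (by omega), (Pt_cons.1 hμ).2⟩
  rw [A.pieri _ hμ (l+1) (l + 1 + N + μ.sum) (by simp; omega), A.pieri _ hμ' l (l + 1 + N + μ.sum) (by simp; omega)]
  refine Finset.sum_le_sum_of_subset_of_nonneg (fun t ht => ?_) fun t _ _ => A.nonneg t
  obtain ⟨h1, h2, h3, h4⟩ := mem_hs.1 ht
  cases t with
  | nil => simp at h1
  | cons a t =>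
  have ha := (hs_tail ht).1
  refine mem_hs.2 ⟨by simpa using h1, by simp at h2 ⊢; omega, h3, fun i => ?_⟩
  have := h4 i
  cases i with
  | zero => simp at this ⊢; omega
  | succ i => simpa using this
lemma logc (N : ℕ) : h (N+2) * h N ≤ h (N+1) * h (N+1) := by
  have := A.cross (N := N) (l := N+1) (μ := []) (Pt_cons.2 ⟨by simp, fun i => by simp⟩) (by omega)
  rwa [A.one, A.one] at this
lemma grow (h0 : h 0 = 1) {N : ℕ} (j : ℕ) {μ : List ℕ} (hμ : Pt (N :: μ)) (hz : d (N :: μ) = 0) : d ((N+j) :: μ) = 0 := by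
  have hμ' : Pt ((N+j) :: μ) := Pt_cons.2 ⟨(Pt_cons.1 hμ).1.trans (by omega), (Pt_cons.1 hμ).2⟩
  have e := A.pieri _ hμ' 0 (N+j+μ.sum) (by simp)
  rw [h0, one_mul] at e
  refine le_antisymm (e.trans_le (Finset.sum_nonpos fun t ht => ?_)) (A.nonneg _)
  obtain ⟨h1, h2, h3, h4⟩ := mem_hs.1 ht
  have key : ∀ i ∈ Finset.range t.length, gd ((N+j) :: μ) i = gd t i := by
    rw [← Finset.sum_eq_sum_iff_of_le fun i _ => (h4 i).1, sum_gd, h2, h1, Finset.sum_range_succ, sum_gd]; simp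
  refine (A.le_of_mem (l := j) hμ (mem_hs.2 ⟨h1, by simp [h2]; omega, h3.trans (by simp; omega), fun i => ?_⟩)).trans_eq (by rw [hz, mul_zero])
  have h5 := h4 i
  have k1 := key 1
  rw [h1] at k1
  simp at k1
  have := (Pt_cons.1 hμ).1
  cases i with
  | zero => simp at h5 this ⊢; omega
  | succ i => simpa using h5
lemma h_zero (h0 : h 0 = 1) {l k : ℕ} (hz : h l = 0) (hk : l ≤ k) : h k = 0 := by
  obtain ⟨j, rfl⟩ := Nat.exists_eq_add_of_le hk
  rw [← A.one] at hz ⊢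
  exact A.grow h0 j (Pt_cons.2 ⟨by simp, fun i => by simp⟩) hz
lemma full {n : ℕ} (hV : ∀ κ, Pt κ → n < gd κ 0 → d κ = 0) {ν : List ℕ} (hν : Pt (n :: ν)) :
    d (n :: ν) = h n * d ν := by
  rw [A.pieri ν (Pt_cons.1 hν).2 n _ le_rfl]
  have hm : n :: ν ∈ hs (n + ν.sum) n ν := by
    refine mem_hs.2 ⟨by simp, by simp [add_comm], by simp, fun i => ⟨?_, by simp⟩⟩
    cases i with
    | zero => simpa using (Pt_cons.1 hν).1
    | succ i => simpa using (Pt_cons.1 hν).2 i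
  rw [Finset.sum_eq_single_of_mem _ hm]
  intro t ht hne
  cases t with
  | nil => simpa using (mem_hs.1 ht).1
  | cons a t =>
    obtain ⟨h1, h2⟩ := hs_tail ht
    rcases h1.eq_or_lt with e | e
    · exact absurd (by rw [h2 e.symm, e]) hne
    · exact hV _ (Pt_hs ht) (by simpa using e)
lemma rep {n : ℕ} (hV : ∀ κ, Pt κ → n < gd κ 0 → d κ = 0) {j : ℕ} (hj : j ≤ n) :
    ∀ k, Pt (List.replicate k n ++ [j]) ∧ gd (List.replicate k n ++ [j]) 0 ≤ n ∧
      d (List.replicate k n ++ [j]) = h n ^ k * h j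
  | 0 => by simpa [A.one] using ⟨Pt_cons.2 ⟨by simp, fun i => by simp⟩, hj⟩
  | k+1 => by
    obtain ⟨h1, h2, h3⟩ := rep hV hj k
    have : Pt (n :: (List.replicate k n ++ [j])) := Pt_cons.2 ⟨h2, h1⟩
    rw [List.replicate_succ, List.cons_append]
    exact ⟨this, by simp, by rw [A.full hV this, h3, pow_succ']; ring⟩
end PS
lemma ds_rep (f : List ℕ → ℝ) (n l : ℕ) : ∀ k, ∀ f : List ℕ → ℝ,
    ∑ t ∈ ds l (List.replicate k n ++ [n]), f t = if l ≤ n then f (List.replicate k n ++ [n-l]) else 0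
  | 0, f => by
    rw [List.replicate_zero, List.nil_append, ds_sum, Finset.sum_eq_single_of_mem l (by simp)]
    · simp [ds]
    · intro j hj hne
      have : l - j ≠ 0 := by have := mem_range.1 hj; omega
      simp [ds, this]
  | k+1, f => by
    have hg : gd (List.replicate k n ++ [n]) 0 = n := by cases k <;> simp
    rw [List.replicate_succ, List.cons_append, ds_sum, Finset.sum_eq_single_of_mem 0 (by simp), hg, if_pos (by simp)]
    · exact ds_rep f n l k fun t => f ((n-0) :: t)
    · intro j hj hne
      rw [hg, if_neg (by omega)]
def DP (m n : ℕ) (d : List ℕ → ℝ) (g : ℕ → ℝ) : Prop := ∀ l μ, Pt μ → d μ ≠ 0 → n ≤ gd μ (m+l) →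
  (m = 0 ∨ n + l ≤ gd μ (m-1)) → g l * d μ = ∑ s ∈ ds l μ, d s
structure CC (d : List ℕ → ℝ) (h : ℕ → ℝ) (L : List ℝ) (n : ℕ) (P : ℝ[X]) : Prop where
  pos : ∀ a ∈ L, 0 < a
  c0 : P.coeff 0 = 1
  deg : P.natDegree = n
  cn : P.coeff n ≠ 0
  nn : ∀ i, 0 ≤ P.coeff i
  V : ∀ κ, Pt κ → n < gd κ L.length → d κ = 0
  eq : PowerSeries.mk h * ((L.map fun a => 1 - C a * X).prod : ℝ[X]) = (P : PowerSeries ℝ)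
  dual : ∀ g, DP L.length n d g →
    PowerSeries.mk g * ((L.map fun a => 1 - C a⁻¹ * X).prod : ℝ[X]) * PowerSeries.C (P.coeff n) = (P.reverse : PowerSeries ℝ)
  c : (∀ k, h k ≠ 0) → ∃ c, 0 < c ∧ ∀ k, c * h k ≤ h (k+1)
lemma PS.base {d : List ℕ → ℝ} {h : ℕ → ℝ} (A : PS d h) (h0 : h 0 = 1) (hz : ∃ l, h l = 0) :
    ∃ L n P, CC d h L n P := by
  classical
  obtain ⟨n, hn, hn1⟩ : ∃ n, h n ≠ 0 ∧ h (n+1) = 0 := by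
    have h1 := Nat.find_spec hz
    obtain ⟨n, hn⟩ : ∃ n, Nat.find hz = n + 1 := Nat.exists_eq_succ_of_ne_zero fun e => by rw [e, h0] at h1; simp at h1
    exact ⟨n, Nat.find_min hz (by omega), hn ▸ h1⟩
  have hk : ∀ k, n < k → h k = 0 := fun k hk => A.h_zero h0 hn1 hk
  set P : ℝ[X] := PowerSeries.trunc (n+1) (PowerSeries.mk h) with hP
  have hc : ∀ k, P.coeff k = h k := fun k => by
    rw [hP, PowerSeries.coeff_trunc, PowerSeries.coeff_mk]
    split_ifs with hh
    · rfl
    · rw [hk k (by omega)]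
  have hd : P.natDegree = n := natDegree_eq_of_le_of_coeff_ne_zero
    (natDegree_le_iff_coeff_eq_zero.2 fun k hh => by rw [hc, hk k hh]) (by rwa [hc])
  have hV : ∀ κ, Pt κ → n < gd κ 0 → d κ = 0 := fun κ hκ hh => by
    cases κ with
    | nil => simp at hh
    | cons a κ => exact le_antisymm ((A.cons_le hκ).trans_eq (by rw [hk a (by simpa using hh), zero_mul])) (A.nonneg _)
  refine ⟨[], n, P, by simp, by rw [hc, h0], hd, by rwa [hc], fun i => by rw [hc]; exact A.hnn i, hV, ?_, fun g hg => ?_,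
    fun hh => absurd hn1 (hh _)⟩
  · ext k; simp [hc]
  · have hg : ∀ l, g l * h n = if l ≤ n then h (n-l) else 0 := fun l => by
      obtain ⟨p1, -, p3⟩ := A.rep hV le_rfl l
      have gl : gd (List.replicate l n ++ [n]) l = n := by
        rw [gd, List.getD_append_right _ _ _ _ (by simp)]; simp
      have := hg l _ p1 (p3 ▸ by positivity) (by simpa using gl.ge) (Or.inl rfl)
      rw [ds_rep d, p3] at this
      have hp : h n ^ l ≠ 0 := pow_ne_zero _ hn
      apply mul_left_cancel₀ hp
      split_ifs at this ⊢ with hl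
      · rw [(A.rep hV (Nat.sub_le n l) l).2.2] at this
        rw [← this]; ring
      · rw [mul_zero, ← this]; ring
    ext k
    rw [List.map_nil, List.prod_nil, Polynomial.coe_one, mul_one, PowerSeries.coeff_mul_C, PowerSeries.coeff_mk, hc, hg,
      Polynomial.coeff_coe, coeff_reverse, hd, hc]
    split_ifs with hl
    · rw [revAt_le hl]
    · rw [revAt_eq_self_of_lt (by omega), hk k (by omega)]
open Filter Topology
lemma conv_step {α : ℝ} (A : ℕ → ℝ) (f : ℕ → ℝ) (D : ℝ) (l : ℕ)
    (hf : ∀ k ≤ l, f k * D = ∑ j ∈ Finset.range (k+1), α^j * A (k-j)) :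
    (f l - if l = 0 then 0 else α * f (l-1)) * D = A l := by
  cases l with
  | zero => simpa using hf 0 le_rfl
  | succ l =>
    have h1 := hf (l+1) le_rfl
    have h2 := hf l (by omega)
    rw [Finset.sum_range_succ'] at h1
    have : ∀ j ∈ Finset.range (l+1), α^(j+1) * A (l+1-(j+1)) = α * (α^j * A (l-j)) := fun j _ => by
      rw [pow_succ']; simp [mul_assoc]
    rw [sum_congr rfl this, ← mul_sum, ← h2] at h1
    simp at h1 ⊢
    linear_combination h1
lemma mk_step (α : ℝ) (f : ℕ → ℝ) :
    PowerSeries.mk (fun l => f l - if l = 0 then 0 else α * f (l-1)) = PowerSeries.mk f * ((1 - C α * X : ℝ[X]) : PowerSeries ℝ) := by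
  ext l
  have : ((1 - C α * X : ℝ[X]) : PowerSeries ℝ) = 1 - PowerSeries.C α * PowerSeries.X := by simp
  rw [this, mul_sub, mul_one, map_sub, mul_left_comm, PowerSeries.coeff_C_mul, PowerSeries.coeff_mk, PowerSeries.coeff_mk]
  cases l with
  | zero => simp
  | succ l => rw [PowerSeries.coeff_succ_mul_X]; simp
structure Lim (d : List ℕ → ℝ) (h : ℕ → ℝ) (α : ℝ) (d' : List ℕ → ℝ) : Prop where
  r : Tendsto (fun N => h (N+1) / h N) atTop (𝓝 α)
  rle : ∀ N, α * h N ≤ h (N+1)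
  nn : ∀ μ, 0 ≤ d' μ
  t : ∀ μ, Pt μ → Tendsto (fun N => d (N :: μ) / h N) atTop (𝓝 (d' μ))
  le : ∀ μ, Pt μ → ∀ N, gd μ 0 ≤ N → d (N :: μ) / h N ≤ d' μ
lemma PS.lim {d : List ℕ → ℝ} {h : ℕ → ℝ} (A : PS d h) (hz : ∀ l, h l ≠ 0) : ∃ α d', Lim d h α d' := by
  have hp : ∀ l, 0 < h l := fun l => (A.hnn l).lt_of_ne' (hz l)
  have ha : Antitone fun N => h (N+1) / h N := antitone_nat_of_succ_le fun N => by
    rw [div_le_div_iff₀ (hp _) (hp _)]; exact A.logc N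
  have hb : BddBelow (Set.range fun N => h (N+1) / h N) := ⟨0, by rintro _ ⟨N, rfl⟩; exact div_nonneg (hp _).le (hp _).le⟩
  have : ∀ μ, ∃ x : ℝ, 0 ≤ x ∧ (Pt μ → Tendsto (fun N => d (N :: μ) / h N) atTop (𝓝 x) ∧
      ∀ N, gd μ 0 ≤ N → d (N :: μ) / h N ≤ x) := fun μ => by
    by_cases hμ : Pt μ
    swap
    · exact ⟨0, le_rfl, fun hh => absurd hh hμ⟩
    have hc : ∀ N, gd μ 0 ≤ N → Pt (N :: μ) := fun N hN => Pt_cons.2 ⟨hN, hμ⟩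
    have hm : Monotone fun N => d ((N + gd μ 0) :: μ) / h (N + gd μ 0) := monotone_nat_of_le_succ fun N => by
      rw [div_le_div_iff₀ (hp _) (hp _)]
      have := A.cross (hc (N + gd μ 0) (by omega)) le_rfl
      rw [show N + 1 + gd μ 0 = N + gd μ 0 + 1 by ring]; linarith
    have hB : BddAbove (Set.range fun N => d ((N + gd μ 0) :: μ) / h (N + gd μ 0)) := ⟨d μ, by
      rintro _ ⟨N, rfl⟩
      simp only
      rw [div_le_iff₀ (hp _), mul_comm]
      exact A.cons_le (hc _ (by omega))⟩
    refine ⟨_, ?_, fun _ => ⟨(tendsto_add_atTop_iff_nat (f := fun N => d (N :: μ) / h N) (gd μ 0)).1 (tendsto_atTop_ciSup hm hB), fun N hN => ?_⟩⟩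
    · exact (div_nonneg (A.nonneg _) (hp _).le).trans (le_ciSup hB 0)
    · have := le_ciSup hB (N - gd μ 0)
      simpa only [Nat.sub_add_cancel hN] using this
  choose d' h1 h2 using this
  refine ⟨_, d', tendsto_atTop_ciInf ha hb, fun N => ?_, h1, fun μ hμ => (h2 μ hμ).1, fun μ hμ => (h2 μ hμ).2⟩
  rw [← le_div_iff₀ (hp _)]
  exact ciInf_le hb N
namespace Lim
variable {d d' : List ℕ → ℝ} {h : ℕ → ℝ} {α : ℝ} (D : Lim d h α d') (A : PS d h) (hz : ∀ l, h l ≠ 0)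
include D A hz
lemma rj (j : ℕ) : Tendsto (fun N => h (N+j) / h N) atTop (𝓝 (α^j)) := by
  induction j with
  | zero => simp [div_self (hz _)]
  | succ j ih =>
    refine (((tendsto_add_atTop_iff_nat j).2 D.r).mul ih).congr' ?_ |>.trans_eq ?_
    · exact Eventually.of_forall fun N => by have := hz N; have := hz (N+j); field_simp; try rfl
    · rw [pow_succ']
lemma tj {μ : List ℕ} (hμ : Pt μ) (j : ℕ) : Tendsto (fun N => d ((N+j) :: μ) / h N) atTop (𝓝 (α^j * d' μ)) :=
  ((D.rj A hz j).mul ((tendsto_add_atTop_iff_nat j).2 (D.t μ hμ))).congr fun N => by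
    have := hz N; have := hz (N+j); field_simp; try rfl
lemma zero {μ : List ℕ} (hμ : Pt μ) (e : d' μ = 0) {N : ℕ} (hN : gd μ 0 ≤ N) : d (N :: μ) = 0 := by
  have hp : 0 < h N := (A.hnn N).lt_of_ne' (hz N)
  have := D.le μ hμ N hN
  rw [e, div_le_iff₀ hp, zero_mul] at this
  exact this.antisymm (A.nonneg _)
lemma pieri' {μ : List ℕ} (hμ : Pt μ) (l : ℕ) :
    h l * d' μ = ∑ j ∈ Finset.range (l+1), α^j * ∑ t ∈ hs (l-j+μ.sum) (l-j) μ, d' t := by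
  have h1 : Tendsto (fun N => h l * (d (N :: μ) / h N)) atTop (𝓝 (h l * d' μ)) := (D.t μ hμ).const_mul _
  have h2 : Tendsto (fun N => ∑ j ∈ Finset.range (l+1), ∑ t ∈ hs (l-j+μ.sum) (l-j) μ, d ((N+j) :: t) / h N) atTop
      (𝓝 (∑ j ∈ Finset.range (l+1), ∑ t ∈ hs (l-j+μ.sum) (l-j) μ, α^j * d' t)) :=
    tendsto_finset_sum _ fun j _ => tendsto_finset_sum _ fun t ht => D.tj A hz (Pt_hs ht) j
  simp only [mul_sum]
  refine tendsto_nhds_unique h1 (h2.congr' ?_)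
  filter_upwards [eventually_ge_atTop (l + μ.sum)] with N hN
  have := gd0_le μ
  rw [← mul_div_assoc, A.pieri _ (Pt_cons.2 ⟨by omega, hμ⟩) l (l + N + μ.sum) (by simp; omega), hs_sum, Finset.sum_div]
  refine sum_congr rfl fun j hj => ?_
  have := mem_range.1 hj
  rw [if_pos (by omega), hs_b (b := N) (b' := l-j+μ.sum) (by omega) le_rfl, Finset.sum_div]
lemma ps' : PS d' (fun l => h l - if l = 0 then 0 else α * h (l-1)) where
  nonneg := D.nn
  nil := tendsto_nhds_unique (D.t [] fun i => by simp) (by simp [A.one, div_self (hz _)])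
  pieri μ hμ l b hb := by
    rw [hs_b hb (b' := l + μ.sum) le_rfl]
    exact conv_step (fun k => ∑ t ∈ hs (k+μ.sum) k μ, d' t) h _ l fun k _ => D.pieri' A hz hμ k
lemma dp' (ha : α ≠ 0) {m n : ℕ} {g : ℕ → ℝ} (hg : DP (m+1) n d g) :
    DP m n d' (fun l => g l - if l = 0 then 0 else α⁻¹ * g (l-1)) := by
  intro l μ hμ hd hn hm
  refine conv_step (fun k => ∑ t ∈ ds k μ, d' t) g _ l fun k hk => ?_
  have h1 : Tendsto (fun N => g k * (d ((N+k) :: μ) / h (N+k))) atTop (𝓝 (g k * d' μ)) :=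
    ((tendsto_add_atTop_iff_nat k).2 (D.t μ hμ)).const_mul _
  have hP : ∀ j, ∀ t ∈ ds j μ, Pt t := fun j t ht i => ((mem_ds.1 ht).2.2 (i+1)).1.trans ((mem_ds.1 ht).2.2 i).2
  have h2 : Tendsto (fun N => ∑ j ∈ Finset.range (k+1), ∑ t ∈ ds (k-j) μ, d ((N+k-j) :: t) / h (N+k)) atTop
      (𝓝 (∑ j ∈ Finset.range (k+1), ∑ t ∈ ds (k-j) μ, α⁻¹^j * d' t)) := by
    refine tendsto_finset_sum _ fun j hj => tendsto_finset_sum _ fun t ht => ?_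
    have hj := mem_range.1 hj
    have := ((D.rj A hz j).inv₀ (pow_ne_zero _ ha)).mul (D.t t (hP _ t ht))
    rw [← inv_pow] at this
    refine ((tendsto_add_atTop_iff_nat (k-j)).2 this).congr fun N => ?_
    rw [show N + k - j = N + (k-j) by omega, show N + (k-j) + j = N + k by omega]
    have := hz (N+(k-j)); have := hz (N+k); field_simp
  simp only [mul_sum]
  refine tendsto_nhds_unique h1 (h2.congr' ?_)
  filter_upwards [eventually_ge_atTop (n + l + gd μ 0), ((tendsto_add_atTop_iff_nat k).2 (D.t μ hμ)).eventually_ne hd] with N hN hne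
  have := hg k ((N+k) :: μ) (Pt_cons.2 ⟨by omega, hμ⟩) (fun e => hne (by rw [e, zero_div])) ?_ (Or.inr ?_)
  · rw [← mul_div_assoc, this, ds_sum, Finset.sum_div]
    refine sum_congr rfl fun j hj => ?_
    have := mem_range.1 hj
    rw [if_pos (by omega), Finset.sum_div]
  · rw [show m + 1 + k = m + k + 1 by ring]
    exact hn.trans (by simpa using gd_anti hμ (show m + k ≤ m + l by omega))
  · cases m with
    | zero => simp; omega
    | succ m => simp at hm ⊢; omega
lemma step {L : List ℝ} {n : ℕ} {P : ℝ[X]} (I : CC d' (fun l => h l - if l = 0 then 0 else α * h (l-1)) L n P) :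
    CC d h (α :: L) n P := by
  have hp : ∀ l, 0 < h l := fun l => (A.hnn l).lt_of_ne' (hz l)
  have a0 : 0 ≤ α := ge_of_tendsto' D.r fun N => div_nonneg (hp _).le (hp _).le
  have ha : α ≠ 0 := by
    rintro rfl
    obtain ⟨c, hc, h1⟩ := I.c (by simpa using hz)
    simp at h1
    exact hc.not_ge (ge_of_tendsto' D.r fun N => by rw [le_div_iff₀ (hp _)]; exact h1 N)
  have ha' := a0.lt_of_ne' ha
  refine ⟨?_, I.c0, I.deg, I.cn, I.nn, fun κ hκ hh => ?_, ?_, fun g hg => ?_, fun _ => ⟨α, ha', D.rle⟩⟩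
  · simpa using ⟨ha', I.pos⟩
  · cases κ with
    | nil => simp at hh
    | cons a κ => exact D.zero A hz (Pt_cons.1 hκ).2 (I.V κ (Pt_cons.1 hκ).2 (by simpa using hh)) (Pt_cons.1 hκ).1
  · have := I.eq
    rw [mk_step] at this
    rw [List.map_cons, List.prod_cons, Polynomial.coe_mul, ← mul_assoc, this]
  · have := I.dual _ (D.dp' A hz ha hg)
    rw [mk_step] at this
    rw [List.map_cons, List.prod_cons, Polynomial.coe_mul, ← mul_assoc, this]
end Lim
theorem PS.main : ∀ κ : List ℕ, Pt κ → ∀ {d : List ℕ → ℝ} {h : ℕ → ℝ}, PS d h → h 0 = 1 → d κ = 0 →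
    ∃ L n P, CC d h L n P
  | [], _, d, h, A, _, e => by simp [A.nil] at e
  | a :: κ, hκ, d, h, A, h0, e => by
    by_cases hz : ∃ l, h l = 0
    · exact A.base h0 hz
    push Not at hz
    obtain ⟨α, d', D⟩ := A.lim hz
    have e' : d' κ = 0 := by
      refine tendsto_nhds_unique (D.t κ (Pt_cons.1 hκ).2) (tendsto_const_nhds.congr' ?_)
      filter_upwards [eventually_ge_atTop a] with N hN
      obtain ⟨j, rfl⟩ := Nat.exists_eq_add_of_le hN
      rw [A.grow h0 j hκ e, zero_div]
    obtain ⟨L, n, P, I⟩ := PS.main κ (Pt_cons.1 hκ).2 (D.ps' A hz) (by simp [h0]) e'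
    exact ⟨_, n, P, D.step A hz I⟩
def FF (M : Multiset ℝ) : ℝ[X] := (M.map fun a => 1 + C a * X).prod
lemma FF_cons (a : ℝ) (M : Multiset ℝ) : FF (a ::ₘ M) = (1 + C a * X) * FF M := by simp [FF]
lemma FF_add (M N : Multiset ℝ) : FF (M + N) = FF M * FF N := by simp [FF]
lemma FF_eq (M : Multiset ℝ) : (∀ a ∈ M, a ≠ 0) →
    FF M = C M.prod * ((M.map fun a => -a⁻¹).map fun r => X - C r).prod := by
  induction M using Multiset.induction with
  | empty => simp [FF]
  | cons a M ih =>
    intro h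
    have ha : a ≠ 0 := h a (by simp)
    rw [FF_cons, ih fun b hb => h b (by simp [hb])]
    have : (1 + C a * X : ℝ[X]) = C a * (X - C (-a⁻¹)) := by
      rw [mul_sub, ← C_mul]; simp [ha, add_comm]
    simp only [Multiset.map_cons, Multiset.prod_cons, this, C_mul]
    ring
lemma prod_ne {M : Multiset ℝ} (h : ∀ a ∈ M, a ≠ 0) : M.prod ≠ 0 := Multiset.prod_ne_zero fun h0 => h 0 h0 rfl
lemma FF_roots {M : Multiset ℝ} (h : ∀ a ∈ M, a ≠ 0) : (FF M).roots = M.map fun a => -a⁻¹ := by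
  rw [FF_eq M h, roots_C_mul _ (prod_ne h), roots_multiset_prod_X_sub_C]
lemma FF_deg {M : Multiset ℝ} (h : ∀ a ∈ M, a ≠ 0) : (FF M).natDegree = M.card := by
  rw [FF_eq M h, natDegree_C_mul (prod_ne h), natDegree_multiset_prod_X_sub_C_eq_card, Multiset.card_map]
lemma FF_inj {M N : Multiset ℝ} (h : ∀ a ∈ M, a ≠ 0) (h' : ∀ a ∈ N, a ≠ 0) (e : FF M = FF N) : M = N := by
  have := FF_roots h
  rw [e, FF_roots h'] at this
  exact (Multiset.map_injective (fun a b hab => by simpa using hab) this).symm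
lemma FF_ne (M : Multiset ℝ) : FF M ≠ 0 := by
  rw [FF, Ne, Multiset.prod_eq_zero_iff, Multiset.mem_map]
  rintro ⟨a, -, h⟩
  simpa using congrArg (eval 0) h
lemma FF_rev (M : Multiset ℝ) : (∀ a ∈ M, a ≠ 0) → (FF M).reverse = C M.prod * FF (M.map fun a => a⁻¹) := by
  induction M using Multiset.induction with
  | empty => intro _; simp only [FF, Multiset.map_zero, Multiset.prod_zero, C_1, mul_one]; rw [← C_1, reverse_C]
  | cons a M ih =>
    intro h
    have ha : a ≠ 0 := h a (by simp)
    have : (1 + C a * X : ℝ[X]).reverse = C a * (1 + C a⁻¹ * X) := by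
      rw [← C_1, reverse_C_add]
      rw [natDegree_C_mul_X _ ha]
      rw [reverse_mul_X, reverse_C, mul_add, ← mul_assoc, ← C_mul (a := a) (b := a⁻¹), mul_inv_cancel₀ ha]; simp [add_comm]
    rw [FF_cons, reverse_mul_of_domain, ih fun b hb => h b (by simp [hb]), this, Multiset.map_cons, FF_cons, Multiset.prod_cons, C_mul]
    ring
lemma FF_lead {M : Multiset ℝ} (h : ∀ a ∈ M, a ≠ 0) : (FF M).coeff (FF M).natDegree = M.prod := by
  rw [coeff_natDegree, FF_eq M h, leadingCoeff_mul, leadingCoeff_C, (monic_multisetProd_X_sub_C _).leadingCoeff, mul_one]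
lemma FF_comp (M : Multiset ℝ) : (FF M).comp (C (-1) * X) = FF (M.map fun a => -a) := by
  rw [FF, FF, Polynomial.multiset_prod_comp, Multiset.map_map, Multiset.map_map]
  congr 1
  exact Multiset.map_congr rfl fun a _ => by simp
lemma sig_coe (p : ℝ[X]) : PowerSeries.rescale (-1) (p : PowerSeries ℝ) = (p.comp (C (-1) * X) : ℝ[X]) := by
  ext n
  rw [PowerSeries.coeff_rescale, Polynomial.coeff_coe, Polynomial.coeff_coe, comp_C_mul_X_coeff, mul_comm]
lemma FF_recip {M : Multiset ℝ} (h : ∀ a ∈ M, 0 < a) (e : M.map (fun a => a⁻¹) = M) {i : ℕ} (hi : i ≤ M.card) :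
    (FF M).coeff i = (FF M).coeff (M.card - i) := by
  have hn : ∀ a ∈ M, a ≠ 0 := fun a ha => (h a ha).ne'
  have p0 : 0 < M.prod := Multiset.prod_induction (fun x => 0 < x) M (fun a b => mul_pos) one_pos h
  have p1 : M.prod = 1 := by
    have : M.prod⁻¹ = M.prod := by conv_rhs => rw [← e, Multiset.prod_map_inv, Multiset.map_id']
    have : M.prod * M.prod = 1 := by nth_rewrite 1 [← this]; exact inv_mul_cancel₀ p0.ne'
    nlinarith
  have := FF_rev M hn
  rw [e, p1, C_1, one_mul] at this
  conv_lhs => rw [← this, coeff_reverse, FF_deg hn, revAt_le hi]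
lemma split_pos {P : ℝ[X]} (c0 : P.coeff 0 = 1) (nn : ∀ i, 0 ≤ P.coeff i) (hs : P.Splits) :
    ∃ Y : Multiset ℝ, (∀ y ∈ Y, 0 < y) ∧ P = FF Y := by
  have hP : P ≠ 0 := fun e => by simp [e] at c0
  have hr : ∀ r ∈ P.roots, r < 0 := fun r hr => by
    by_contra hc
    push Not at hc
    have h0 : P.eval r = 0 := (mem_roots hP).1 hr
    rw [eval_eq_sum_range, Finset.sum_range_succ'] at h0
    have : 0 ≤ ∑ i ∈ Finset.range P.natDegree, P.coeff (i+1) * r^(i+1) :=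
      Finset.sum_nonneg fun i _ => mul_nonneg (nn _) (pow_nonneg hc _)
    simp [c0] at h0
    linarith
  refine ⟨P.roots.map fun r => -r⁻¹, fun y hy => ?_, ?_⟩
  · obtain ⟨r, h, rfl⟩ := Multiset.mem_map.1 hy
    have := inv_lt_zero.2 (hr r h); linarith
  have hne : ∀ a ∈ P.roots.map fun r => -r⁻¹, a ≠ 0 := fun y hy => by
    obtain ⟨r, h, rfl⟩ := Multiset.mem_map.1 hy
    simpa using (hr r h).ne
  have e1 := FF_eq _ hne
  have e2 := hs.eq_prod_roots
  have : (P.roots.map fun r : ℝ => -r⁻¹).map (fun a => -a⁻¹) = P.roots := by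
    rw [Multiset.map_map]
    conv_rhs => rw [← Multiset.map_id P.roots]
    exact Multiset.map_congr rfl fun r _ => by simp
  rw [this] at e1
  have l0 : P.leadingCoeff ≠ 0 := leadingCoeff_ne_zero.2 hP
  have e3 : C P.leadingCoeff * FF (P.roots.map fun r => -r⁻¹) = C (P.roots.map fun r => -r⁻¹).prod * P := by
    rw [e1, mul_left_comm, ← e2]
  have e4 := congrArg (fun p => coeff p 0) e3
  have f0 : ∀ M, (FF M).coeff 0 = 1 := fun M => by
    rw [coeff_zero_eq_eval_zero, FF, eval_multiset_prod, Multiset.map_map]; simp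
  simp only [coeff_C_mul, f0, c0, mul_one] at e4
  rw [← e4] at e3
  exact (mul_left_cancel₀ (C_ne_zero.2 l0) e3).symm
lemma inv_of_cross {α Y : Multiset ℝ} (ha : ∀ a ∈ α, 0 < a) (hy : ∀ y ∈ Y, 0 < y)
    (e : FF Y * FF (α.map fun a => -a⁻¹) = FF (Y.map fun y => y⁻¹) * FF (α.map fun a => -a)) :
    α.map (fun a => a⁻¹) = α ∧ Y.map (fun y => y⁻¹) = Y := by
  rw [← FF_add, ← FF_add] at e
  have p1 : ∀ x ∈ Y.map fun y => y⁻¹, 0 < x := fun x hx => by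
    obtain ⟨r, h, rfl⟩ := Multiset.mem_map.1 hx; exact inv_pos.2 (hy r h)
  have n1 : ∀ x ∈ α.map fun a => -a⁻¹, x < 0 := fun x hx => by
    obtain ⟨r, h, rfl⟩ := Multiset.mem_map.1 hx; exact neg_lt_zero.2 (inv_pos.2 (ha r h))
  have n2 : ∀ x ∈ α.map fun a => -a, x < 0 := fun x hx => by
    obtain ⟨r, h, rfl⟩ := Multiset.mem_map.1 hx; exact neg_lt_zero.2 (ha r h)
  have key := FF_inj (fun x hx => ?_) (fun x hx => ?_) e
  · have k1 := congrArg (Multiset.filter (fun x => 0 < x)) key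
    have k2 := congrArg (Multiset.filter (fun x => x < 0)) key
    rw [Multiset.filter_add, Multiset.filter_add, Multiset.filter_eq_self.2 hy, Multiset.filter_eq_self.2 p1,
      Multiset.filter_eq_nil.2 fun x hx => (n1 x hx).not_gt, Multiset.filter_eq_nil.2 fun x hx => (n2 x hx).not_gt] at k1
    rw [Multiset.filter_add, Multiset.filter_add, Multiset.filter_eq_self.2 n1, Multiset.filter_eq_self.2 n2,
      Multiset.filter_eq_nil.2 fun x hx => (hy x hx).not_gt, Multiset.filter_eq_nil.2 fun x hx => (p1 x hx).not_gt] at k2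
    refine ⟨?_, by simpa using k1.symm⟩
    simp only [zero_add] at k2
    have := congrArg (Multiset.map fun x => -x) k2
    simpa [Multiset.map_map] using this
  · rcases Multiset.mem_add.1 hx with h | h
    exacts [(hy x h).ne', (n1 x h).ne]
  · rcases Multiset.mem_add.1 hx with h | h
    exacts [(p1 x h).ne', (n2 x h).ne]
lemma real_final {α β : Multiset ℝ} {P P2 : ℝ[X]} {H E : PowerSeries ℝ} (ha : ∀ a ∈ α, 0 < a) (hb : ∀ a ∈ β, 0 < a)
    (c0 : P.coeff 0 = 1) (nn : ∀ i, 0 ≤ P.coeff i) (h1 : H * (FF (α.map fun a => -a) : ℝ[X]) = (P : PowerSeries ℝ))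
    (h2 : H * (FF (α.map fun a => -a⁻¹) : ℝ[X]) * PowerSeries.C (P.coeff P.natDegree) = (P.reverse : PowerSeries ℝ))
    (h3 : E * (FF (β.map fun a => -a) : ℝ[X]) = (P2 : PowerSeries ℝ)) (h4 : PowerSeries.rescale (-1) E * H = 1) :
    ∃ Y : Multiset ℝ, (∀ y ∈ Y, 0 < y) ∧ α.map (fun a => a⁻¹) = α ∧ Y.map (fun y => y⁻¹) = Y ∧
      E * (FF (Y.map fun y => -y) : ℝ[X]) = (FF α : PowerSeries ℝ) := by
  have nn' : ∀ M : Multiset ℝ, (M.map fun a => -a).map (fun a => -a) = M := fun M => by simp [Multiset.map_map]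
  have hs : P.Splits := by
    have h5 := congrArg (PowerSeries.rescale (-1 : ℝ)) h3
    rw [map_mul, sig_coe, sig_coe, FF_comp, nn'] at h5
    have h6 : P * P2.comp (C (-1) * X) = FF (α.map fun a => -a) * FF β := by
      apply Polynomial.coe_injective
      rw [Polynomial.coe_mul, Polynomial.coe_mul, ← h1, ← h5]
      linear_combination ((FF (α.map fun a => -a) : ℝ[X]) : PowerSeries ℝ) * (FF β : ℝ[X]) * h4
    rw [← FF_add] at h6
    refine Splits.of_dvd (Splits.multisetProd fun f hf => ?_) (FF_ne _) (Dvd.intro _ h6)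
    obtain ⟨a, -, rfl⟩ := Multiset.mem_map.1 hf
    exact Splits.of_natDegree_le_one (by compute_degree)
  obtain ⟨Y, hY, rfl⟩ := split_pos c0 nn hs
  have hn : ∀ y ∈ Y, y ≠ 0 := fun y hy => (hY y hy).ne'
  rw [FF_lead hn, FF_rev Y hn, Polynomial.coe_mul, Polynomial.coe_C, mul_comm] at h2
  have h2' := mul_left_cancel₀ (by simpa using prod_ne hn) h2
  have hc : FF Y * FF (α.map fun a => -a⁻¹) = FF (Y.map fun y => y⁻¹) * FF (α.map fun a => -a) := by
    apply Polynomial.coe_injective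
    rw [Polynomial.coe_mul, Polynomial.coe_mul, ← h1, ← h2']
    ring
  obtain ⟨r1, r2⟩ := inv_of_cross ha hY hc
  refine ⟨Y, hY, r1, r2, ?_⟩
  have h5 := congrArg (PowerSeries.rescale (-1 : ℝ)) h1
  have h6 := congrArg (PowerSeries.rescale (-1 : ℝ)) h4
  rw [map_mul, sig_coe, sig_coe, FF_comp, FF_comp, nn'] at h5
  rw [map_mul, map_one, PowerSeries.rescale_rescale] at h6
  simp only [mul_neg, mul_one, neg_neg, PowerSeries.rescale_one, RingHom.id_apply] at h6
  rw [← h5]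
  linear_combination ((FF α : ℝ[X]) : PowerSeries ℝ) * h6
lemma real_shape {E : PowerSeries ℝ} {α Y : Multiset ℝ} (ha : ∀ a ∈ α, 0 < a) (hy : ∀ y ∈ Y, 0 < y)
    (r1 : α.map (fun a => a⁻¹) = α) (r2 : Y.map (fun y => y⁻¹) = Y)
    (he : E * (FF (Y.map fun y => -y) : ℝ[X]) = (FF α : PowerSeries ℝ)) :
    ∃ (m n : ℕ) (x : Fin m → ℝ) (y : Fin n → ℝ), (∀ i, 0 < x i) ∧ (∀ j, 0 < y j) ∧
      E * ((∏ j : Fin n, (1 - Polynomial.C (y j) * Polynomial.X) : Polynomial ℝ) : PowerSeries ℝ) =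
        ((∏ i : Fin m, (1 + Polynomial.C (x i) * Polynomial.X) : Polynomial ℝ) : PowerSeries ℝ) ∧
      (∀ i ≤ m, (∏ i : Fin m, (1 + Polynomial.C (x i) * Polynomial.X)).coeff i =
          (∏ i : Fin m, (1 + Polynomial.C (x i) * Polynomial.X)).coeff (m - i)) ∧
      (∀ j ≤ n, (-1 : ℝ) ^ j * (∏ j : Fin n, (1 - Polynomial.C (y j) * Polynomial.X)).coeff j =
          (-1 : ℝ) ^ (n - j) * (∏ j : Fin n, (1 - Polynomial.C (y j) * Polynomial.X)).coeff (n - j)) := by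
  have e1 : ∏ i : Fin α.toList.length, (1 + C α.toList[i.1] * X : ℝ[X]) = FF α := by
    rw [Fin.prod_univ_fun_getElem α.toList (fun a => (1 + C a * X : ℝ[X])), FF]
    conv_rhs => rw [← Multiset.coe_toList α, Multiset.map_coe, Multiset.prod_coe]
  have e2 : ∏ i : Fin Y.toList.length, (1 - C Y.toList[i.1] * X : ℝ[X]) = FF (Y.map fun y => -y) := by
    rw [Fin.prod_univ_fun_getElem Y.toList (fun a => (1 - C a * X : ℝ[X])), FF, Multiset.map_map]
    conv_rhs => rw [← Multiset.coe_toList Y, Multiset.map_coe, Multiset.prod_coe]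
    simp [Function.comp_def, sub_eq_add_neg]
  refine ⟨α.toList.length, Y.toList.length, fun i => α.toList[i.1], fun i => Y.toList[i.1],
    fun i => ha _ (Multiset.mem_toList.1 (List.getElem_mem _)), fun i => hy _ (Multiset.mem_toList.1 (List.getElem_mem _)), ?_⟩
  rw [e1, e2]
  refine ⟨he, fun i hi => ?_, fun j hj => ?_⟩
  · rw [Multiset.length_toList] at hi ⊢
    exact FF_recip ha r1 hi
  · rw [Multiset.length_toList] at hj ⊢
    have : ∀ j, (-1:ℝ)^j * (FF (Y.map fun y => -y)).coeff j = (FF Y).coeff j := fun j => by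
      rw [← FF_comp, comp_C_mul_X_coeff, mul_comm, mul_assoc, ← mul_pow]; simp
    rw [this, this]
    exact FF_recip hy r2 hj
namespace TS
variable {r P : ι → ι → ι → ι → K} {E : ℕ → ι → ι → B} (S : TS q r E T) (hP : HP r P)
variable [Nontrivial B] [Nonempty ι] [CharZero K]
include S
lemma hN0 : S.hN 0 = 1 := by
  have h0 := S.hN_spec 0
  have : S.dd (row 0) = 1 := S.mu.tr_one0
  rw [this] at h0
  exact_mod_cast h0.symm
lemma hN1 : S.hN 1 ≠ 0 := fun e => by
  have h1 := S.hN_spec 1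
  rw [e, Nat.cast_zero, S.dd_zero (row_std 1)] at h1
  have : ϖ (row 1) = 1 := by
    have : AddR [] = {0} := by
      ext a; simp [AddR]
    simp [row, pp, ee, this]
  rw [this] at h1
  exact one_ne_zero h1
include hP in
lemma DP_self {m n : ℕ} (hV : ∀ κ, Pt κ → n < gd κ m → (S.dN κ : ℝ) = 0) :
    DP m n (fun μ => (S.dN μ : ℝ)) (fun l => (S.hN l : ℝ)) := by
  intro l μ hμ h0 hn hm
  dsimp only at h0 ⊢
  have hs : l ≤ μ.sum := by
    have hg : ∀ i, gd μ i ≤ μ.sum := fun i => (gd_anti hμ (Nat.zero_le i)).trans (gd0_le μ)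
    rcases Nat.eq_zero_or_pos m with rfl | h
    · rcases Nat.eq_zero_or_pos n with rfl | h'
      · have := hV [1] (Pt_cons.2 ⟨by simp, fun i => by simp⟩) (by simp)
        have e := S.dN_spec [1]
        rw [Nat.cast_eq_zero.1 this, dp_one, hN_spec, Nat.cast_inj] at e
        exact absurd e S.hN1
      · rw [zero_add] at hn
        have hl : l < μ.length := by
          by_contra hc
          rw [gd, List.getD_eq_default _ _ (by omega)] at hn
          omega
        rw [← sum_gd]
        calc l = ∑ i ∈ Finset.range l, 1 := by simp
          _ ≤ ∑ i ∈ Finset.range l, gd μ i := Finset.sum_le_sum fun i hi => by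
            have := gd_anti hμ (mem_range.1 hi).le; omega
          _ ≤ _ := Finset.sum_le_sum_of_subset (Finset.range_subset_range.2 hl.le)
    · have := hg (m-1); omega
  have := S.dual1 hP hμ (l := l) (by rw [dN_spec]; exact_mod_cast h0)
    (fun κ hκ hh => by rw [dN_spec, Nat.cast_eq_zero.1 (hV κ hκ hh), Nat.cast_zero]) hn hm hs
  simp only [dN_spec, hN_spec] at this
  exact_mod_cast this
include hP in
lemma final : ∃ α Y : Multiset ℝ, (∀ a ∈ α, 0 < a) ∧ (∀ y ∈ Y, 0 < y) ∧ α.map (fun a => a⁻¹) = α ∧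
    Y.map (fun y => y⁻¹) = Y ∧
    PowerSeries.mk (fun l => (S.neg.hN l : ℝ)) * (FF (Y.map fun y => -y) : ℝ[X]) = (FF α : PowerSeries ℝ) := by
  obtain ⟨κ, k1, k2⟩ := S.van
  obtain ⟨L, n, P, I⟩ := PS.main κ k1 S.ps (by rw [S.hN0]; simp) (by rw [k2]; simp)
  obtain ⟨κ', k1', k2'⟩ := S.neg.van
  obtain ⟨L', n', P', I'⟩ := PS.main κ' k1' S.neg.ps (by rw [S.neg.hN0]; simp) (by rw [k2']; simp)
  have e : ∀ (L : List ℝ) (f : ℝ → ℝ), FF ((L : Multiset ℝ).map fun a => -f a) = (L.map fun a => 1 - C (f a) * X).prod := fun L f => by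
    simp [FF, Function.comp_def, sub_eq_add_neg]
  have h2 := I.dual _ (S.DP_self hP I.V)
  rw [← I.deg] at h2
  obtain ⟨Y, y1, y2, y3, y4⟩ := real_final (α := L) (β := L') (P := P) (P2 := P') (by simpa using I.pos) (by simpa using I'.pos) I.c0 I.nn
    (by rw [e L fun a => a]; exact I.eq) (by rw [e L fun a => a⁻¹]; exact h2) (by rw [e L' fun a => a]; exact I'.eq) (by
      ext l
      rw [PowerSeries.coeff_mul, Finset.Nat.sum_antidiagonal_eq_sum_range_succ_mk]
      simp only [PowerSeries.coeff_rescale, PowerSeries.coeff_mk]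
      cases l with
      | zero => simp [S.hN0, S.neg.hN0]
      | succ l => rw [S.koszul l, PowerSeries.coeff_one, if_neg (by omega)])
  exact ⟨L, Y, by simpa using I.pos, y1, y2, y3, y4⟩
end TS
section
variable {V : Type} [AddCommGroup V] [Module K V]
lemma pl_triv [Subsingleton V] (R : V ⊗[K] V →ₗ[K] V ⊗[K] V) : poincareLambda K V R = 1 := by
  have h0 : LinearMap.range (TensorAlgebra.ι K : V →ₗ[K] TensorAlgebra K V) = ⊥ := by
    rw [LinearMap.range_eq_bot]; exact Subsingleton.elim _ _
  have nt : Nontrivial (RingQuot (lambdaRel K V R)) := by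
    let f : RingQuot (lambdaRel K V R) →ₐ[K] K := RingQuot.liftAlgHom K ⟨TensorAlgebra.algebraMapInv, by
      rintro a b ⟨rfl, u, rfl⟩
      rw [Subsingleton.elim u 0]; simp⟩
    exact f.toRingHom.domain_nontrivial
  ext l
  rw [poincareLambda, PowerSeries.coeff_mk, lambdaGrade, h0, PowerSeries.coeff_one]
  cases l with
  | zero =>
    rw [pow_zero, Submodule.one_eq_span, Submodule.map_span, Set.image_singleton, AlgHom.toLinearMap_apply, map_one,
      finrank_span_singleton one_ne_zero]
    simp
  | succ l =>
    rw [pow_succ, Submodule.mul_bot, Submodule.map_bot, finrank_bot]; simp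
end
end
end

/-- The Poincaré series of the exterior algebra of a Hecke symmetry is a rational
function `∏ (1 + xᵢ t) / ∏ (1 - yⱼ t)` with `xᵢ, yⱼ > 0`, whose numerator is a
reciprocal polynomial and whose denominator is a skew-reciprocal polynomial. -/
theorem poincare_series_lambda_reciprocal
    (K : Type) [Field K] [CharZero K]
    (V : Type) [AddCommGroup V] [Module K V] [FiniteDimensional K V]
    (q : K) (hq0 : q ≠ 0) (hq : ∀ n : ℕ, 1 < n → q ^ n ≠ 1)
    (R : V ⊗[K] V →ₗ[K] V ⊗[K] V) (hR : IsHeckeSymmetry K V q R) :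
    ∃ (m n : ℕ) (x : Fin m → ℝ) (y : Fin n → ℝ),
      (∀ i, 0 < x i) ∧ (∀ j, 0 < y j) ∧
      poincareLambda K V R *
          ((∏ j : Fin n, (1 - Polynomial.C (y j) * Polynomial.X) : Polynomial ℝ) :
            PowerSeries ℝ) =
        ((∏ i : Fin m, (1 + Polynomial.C (x i) * Polynomial.X) : Polynomial ℝ) :
          PowerSeries ℝ) ∧
      (∀ i ≤ m,
        (∏ i : Fin m, (1 + Polynomial.C (x i) * Polynomial.X)).coeff i =
          (∏ i : Fin m, (1 + Polynomial.C (x i) * Polynomial.X)).coeff (m - i)) ∧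
      (∀ j ≤ n,
        (-1 : ℝ) ^ j * (∏ j : Fin n, (1 - Polynomial.C (y j) * Polynomial.X)).coeff j =
          (-1 : ℝ) ^ (n - j) *
            (∏ j : Fin n, (1 - Polynomial.C (y j) * Polynomial.X)).coeff (n - j)) := by
  rcases subsingleton_or_nontrivial V with h | h
  · refine real_shape (α := 0) (Y := 0) (by simp) (by simp) (by simp) (by simp) ?_
    rw [pl_triv]; simp [FF]
  · haveI : Nonempty (Fin (Module.finrank K V)) := ⟨⟨0, Module.finrank_pos⟩⟩
    obtain ⟨S, hS, P, i1, i2⟩ := lambda_setup R (Module.finBasis K V) hq0 hq hR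
    obtain ⟨α, Y, a1, y1, r1, r2, e⟩ := S.final (HP.mk i1 i2)
    refine real_shape a1 y1 r1 r2 ?_
    rw [← e, poincareLambda]
    simp only [hS]

end
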